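/- Let F be a number field and D a central division F-algebra of degree n > 2. Then D admits no F-linear anti-automorphism; in particular, D has no involution of the first kind. -/

import Mathlib

namespace BQ

/-- norm index lemma -/
theorem norm_index {G H : Type*} [CommGroup G] [CommGroup H] (A : Subgroup G) (B : Subgroup H)
    (i : G →* H) (N : H →* G) (h1 : A ≤ B.comap i) (h2 : B ≤ A.comap N)
    (h3 : ∀ g, N (i g) ∈ A) (h4 : A.relIndex (B.comap i) = 2)
    (h5 : ∀ h, N h ∈ A → ∃ g, ∃ b ∈ B, h = i g * b) :
    (N.range ⊔ A).index * B.index * 2 = A.index ^ 2 := by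
  have e1 : (A.comap N) = i.range ⊔ B := by
    apply le_antisymm
    · intro h hh
      obtain ⟨g, b, hb, rfl⟩ := h5 h hh
      exact Subgroup.mul_mem_sup ⟨g, rfl⟩ hb
    · refine sup_le ?_ h2
      rintro _ ⟨g, rfl⟩
      exact h3 g
  have e2 : A.relIndex (N.range ⊔ A) = (A.comap N).index := by
    rw [Subgroup.relIndex_sup_right, Subgroup.index_comap]
  have e3 : B.relIndex (A.comap N) = (B.comap i).index := by
    rw [e1, Subgroup.relIndex_sup_right, Subgroup.index_comap]
  have e4 := Subgroup.relIndex_mul_index (le_sup_right : A ≤ N.range ⊔ A)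
  have e5 := Subgroup.relIndex_mul_index h2
  have e6 := Subgroup.relIndex_mul_index h1
  rw [← e5, e3, pow_two]
  nth_rewrite 1 [← e4]
  rw [← e6, h4, e2]; ring

/-- subgroup of squares -/
def sq {G : Type*} [CommGroup G] (U : Subgroup G) : Subgroup G := U.map (powMonoidHom 2)

theorem mem_sq {G : Type*} [CommGroup G] {U : Subgroup G} {x : G} :
    x ∈ sq U ↔ ∃ y ∈ U, y ^ 2 = x := Iff.rfl

theorem sq_le {G : Type*} [CommGroup G] (U : Subgroup G) : sq U ≤ U := by
  rintro _ ⟨y, hy, rfl⟩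
  exact U.pow_mem hy 2

theorem sq_mono {G : Type*} [CommGroup G] {U V : Subgroup G} (h : U ≤ V) : sq U ≤ sq V :=
  Subgroup.map_mono h

theorem sq_relIndex_step {G : Type*} [CommGroup G] (A B : Subgroup G) (hAB : A ≤ B)
    (φ : B →* Multiplicative ℤ) (hne : φ ≠ 1) (hker : ∀ x : B, φ x = 1 ↔ (x : G) ∈ A) :
    (sq B).relIndex B = 2 * (sq A).relIndex A := by
  obtain ⟨⟨_, b0, rfl⟩, hg⟩ := IsCyclic.exists_generator (α := φ.range)
  have hg' : ∀ b : B, ∃ k : ℤ, φ b = φ b0 ^ k := by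
    intro b
    obtain ⟨k, hk⟩ := hg ⟨φ b, b, rfl⟩
    exact ⟨k, by simpa using (congrArg Subtype.val hk).symm⟩
  have hb0 : φ b0 ≠ 1 := by
    intro h
    apply hne
    ext b
    obtain ⟨k, hk⟩ := hg' b
    rw [hk, h]; simp
  have hinj : ∀ k : ℤ, φ b0 ^ k = 1 → k = 0 := by
    intro k hk
    by_contra hk0
    apply hb0
    have := congrArg Multiplicative.toAdd hk
    rw [toAdd_zpow] at this
    simp [hk0] at this
    exact this
  -- A ∩ B² = A²
  have f1 : (sq B ⊓ A) = sq A := by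
    apply le_antisymm
    · rintro _ ⟨⟨y, hy, rfl⟩, hA⟩
      refine ⟨y, ?_, rfl⟩
      have h2 : φ (⟨y, hy⟩ ^ 2) = 1 := (hker _).2 hA
      rw [map_pow] at h2
      apply (hker ⟨y, hy⟩).1
      have := congrArg Multiplicative.toAdd h2
      rw [toAdd_pow] at this
      simpa using this
    · exact le_inf (sq_mono hAB) (sq_le A)
  have f2 : (sq B).relIndex (A ⊔ sq B) = (sq A).relIndex A := by
    rw [Subgroup.relIndex_sup_right, ← f1, Subgroup.inf_relIndex_right]
  have f3 : (A ⊔ sq B).relIndex B = 2 := by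
    rw [Subgroup.relIndex, Subgroup.index_eq_two_iff]
    refine ⟨b0, ?_⟩
    have key : ∀ b : B, ∀ k : ℤ, φ b = φ b0 ^ k → ((b : G) ∈ A ⊔ sq B ↔ Even k) := by
      intro b k hk
      constructor
      · intro hb
        obtain ⟨a, ha, c, ⟨d, hd, rfl⟩, hab⟩ := Subgroup.mem_sup.1 hb
        obtain ⟨l, hl⟩ := hg' ⟨d, hd⟩
        have e : b = ⟨a, hAB ha⟩ * ⟨d, hd⟩ ^ 2 := by
          ext; simpa using hab.symm
        have e2 : φ b = φ b0 ^ (l * 2) := by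
          rw [e, map_mul, (hker ⟨a, hAB ha⟩).2 ha, map_pow, hl, one_mul, zpow_mul]; rfl
        have e3 : k - l * 2 = 0 := hinj _ (by rw [zpow_sub, ← hk, ← e2]; simp)
        exact ⟨l, by omega⟩
      · rintro ⟨l, rfl⟩
        have : ((b * (b0 ^ l)⁻¹ ^ 2 : B) : G) ∈ A := by
          rw [← hker, map_mul, hk, map_pow, map_inv, map_zpow, zpow_add]
          simp [pow_two]
        have h2 : (b : G) = ((b * (b0 ^ l)⁻¹ ^ 2 : B) : G) * ((b0 ^ l : B) : G) ^ 2 := by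
          simp
        rw [h2]
        exact Subgroup.mul_mem_sup this ⟨_, (b0 ^ l).2, rfl⟩
    intro b
    obtain ⟨k, hk⟩ := hg' b
    rw [Subgroup.mem_subgroupOf, Subgroup.mem_subgroupOf, key b k hk,
      key (b * b0) (k + 1) (by rw [map_mul, hk, zpow_add_one])]
    rw [Int.even_add_one]
    by_cases h : Even k <;> simp [h]
  have := Subgroup.relIndex_mul_relIndex (sq B) (A ⊔ sq B) B le_sup_right
    (sup_le hAB (sq_le B))
  rw [← this, f2, f3, mul_comm]

theorem count_le {G ι : Type*} [CommGroup G] (U M : Subgroup G) (T : Finset ι)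
    (H : ι → Subgroup G) (hM : ∀ v ∈ T, M ≤ H v) (hfin : M.relIndex U ≠ 0)
    (hex : ∀ A ⊆ T, ∃ x ∈ U, ∀ v ∈ T, (x ∈ H v ↔ v ∈ A)) :
    2 ^ T.card ≤ M.relIndex U := by
  classical
  choose! x hxU hx using hex
  rw [← Finset.card_powerset, Subgroup.relIndex, Subgroup.index]
  rw [Subgroup.relIndex] at hfin
  have : Finite (U ⧸ M.subgroupOf U) := Nat.finite_of_card_ne_zero hfin
  have hinj : Function.Injective (fun A : T.powerset =>
      (QuotientGroup.mk (⟨x A.1, hxU A.1 (Finset.mem_powerset.1 A.2)⟩ : U) : U ⧸ M.subgroupOf U)) := by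
    rintro ⟨A, hA⟩ ⟨A', hA'⟩ h
    have hA := Finset.mem_powerset.1 hA
    have hA' := Finset.mem_powerset.1 hA'
    have h' := QuotientGroup.eq.1 h
    rw [Subgroup.mem_subgroupOf] at h'
    simp only [Subgroup.coe_mul, InvMemClass.coe_inv] at h'
    ext v
    show v ∈ A ↔ v ∈ A'
    by_cases hv : v ∈ T
    · rw [← hx A hA v hv, ← hx A' hA' v hv]
      have h3 := hM v hv h'
      constructor
      · intro h4
        simpa using (H v).mul_mem h4 h3
      · intro h4
        have := (H v).mul_mem h4 ((H v).inv_mem h3)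
        simpa using this
    · exact ⟨fun h => absurd (hA h) hv, fun h => absurd (hA' h) hv⟩
  have := Nat.card_le_card_of_injective _ hinj
  rwa [Nat.card_eq_fintype_card, Fintype.card_coe] at this

end BQ

namespace BQ
open WithZero

section Val
variable {K : Type*} [Field K] (v : Valuation K ℤᵐ⁰)

theorem v_two_le : v 2 ≤ 1 := by
  have := v.map_add 1 1
  rw [one_add_one_eq_two] at this
  simpa using this

theorem v_four : v 4 = v 2 * v 2 := by
  rw [← map_mul]; norm_num

theorem v_four_le : v 4 ≤ 1 := by
  rw [v_four]; exact mul_le_one' (v_two_le v) (v_two_le v)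

theorem v_eq_one_of {x γ} (hγ : γ ≤ 1) (h : v (x - 1) < γ) : v x = 1 := by
  have h2 : v (x - 1) < v 1 := by rw [map_one]; exact h.trans_le hγ
  have := Valuation.map_add_eq_of_lt_left v h2
  simpa using this

theorem mul_sub_one_lt {x y : K} {γ : ℤᵐ⁰} (hx : v x = 1) (h1 : v (x - 1) < γ) (h2 : v (y - 1) < γ) :
    v (x * y - 1) < γ := by
  have : x * y - 1 = x * (y - 1) + (x - 1) := by ring
  rw [this]
  exact v.map_add_lt (by rw [map_mul, hx, one_mul]; exact h2) h1

theorem inv_sub_one {x : K} (hx : v x = 1) : v (x⁻¹ - 1) = v (x - 1) := by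
  have h0 : x ≠ 0 := by rintro rfl; simp at hx
  have : x⁻¹ - 1 = -(x⁻¹ * (x - 1)) := by field_simp; ring
  rw [this, Valuation.map_neg, map_mul, map_inv₀, hx]; simp

/-- one-units -/
def OU (γ : ℤᵐ⁰) (hγ : 0 < γ) : Subgroup Kˣ where
  carrier := {x | v (x : K) = 1 ∧ v ((x : K) - 1) < γ}
  mul_mem' := by
    rintro x y ⟨hx, hx'⟩ ⟨hy, hy'⟩
    refine ⟨by simp [hx, hy], ?_⟩
    rw [Units.val_mul]
    exact mul_sub_one_lt v hx hx' hy'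
  one_mem' := by simp [hγ]
  inv_mem' := by
    rintro x ⟨hx, hx'⟩
    refine ⟨by simp [hx], ?_⟩
    rw [Units.val_inv_eq_inv_val, inv_sub_one v hx]; exact hx'

theorem mem_OU {γ hγ} {x : Kˣ} : x ∈ OU v γ hγ ↔ v (x : K) = 1 ∧ v ((x : K) - 1) < γ := Iff.rfl

/-- local squares -/
def LL (h2 : (2 : K) ≠ 0) : Subgroup Kˣ where
  carrier := {x | ∃ y : Kˣ, v ((x : K) * y ^ 2 - 1) < v 4}
  mul_mem' := by
    rintro a b ⟨y, hy⟩ ⟨z, hz⟩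
    refine ⟨y * z, ?_⟩
    have := mul_sub_one_lt v (v_eq_one_of v (v_four_le v) hy) hy hz
    convert this using 3
    push_cast; ring
  one_mem' := ⟨1, by
    have : (4 : K) ≠ 0 := by
      have : (4 : K) = 2 * 2 := by norm_num
      rw [this]; exact mul_ne_zero h2 h2
    simp [zero_lt_iff, this]⟩
  inv_mem' := by
    rintro a ⟨y, hy⟩
    refine ⟨y⁻¹, ?_⟩
    rw [← inv_sub_one v (v_eq_one_of v (v_four_le v) hy)] at hy
    convert hy using 3
    push_cast; field_simp

variable (h2 : (2 : K) ≠ 0)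

theorem mem_LL {x : Kˣ} : x ∈ LL v h2 ↔ ∃ y : Kˣ, v ((x : K) * y ^ 2 - 1) < v 4 := Iff.rfl

theorem four_ne (h2 : (2 : K) ≠ 0) : (4 : K) ≠ 0 := by
  have : (4 : K) = 2 * 2 := by norm_num
  rw [this]; exact mul_ne_zero h2 h2

theorem v_four_pos (h2 : (2 : K) ≠ 0) : 0 < v 4 := by simp [zero_lt_iff, four_ne h2]

theorem v_two_pos (h2 : (2 : K) ≠ 0) : 0 < v 2 := by simp [zero_lt_iff, h2]

theorem sq_mem_LL (y : Kˣ) : y ^ 2 ∈ LL v h2 := ⟨y⁻¹, by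
  have : ((y ^ 2 : Kˣ) : K) * ((y⁻¹ : Kˣ) : K) ^ 2 - 1 = 0 := by
    push_cast; field_simp; ring
  rw [this, map_zero]; exact v_four_pos v h2⟩

theorem sq_top_le_LL : sq ⊤ ≤ LL v h2 := by
  rintro _ ⟨y, -, rfl⟩; exact sq_mem_LL v h2 y

theorem mul_sq_mem_LL (x y : Kˣ) : x * y ^ 2 ∈ LL v h2 ↔ x ∈ LL v h2 :=
  Subgroup.mul_mem_cancel_right _ (sq_mem_LL v h2 y)

theorem mem_LL_of_lt {x : Kˣ} (h : v ((x : K) - 1) < v 4) : x ∈ LL v h2 := ⟨1, by simpa using h⟩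

/-- elements close together are in the same class -/
theorem mem_LL_of_close {x y : Kˣ} (h : v ((x : K) - y) < v 4 * v y) : x / y ∈ LL v h2 := by
  apply mem_LL_of_lt
  have hy : (y : K) ≠ 0 := y.ne_zero
  have : ((x / y : Kˣ) : K) - 1 = (x - y) / y := by push_cast; field_simp
  rw [this, map_div₀]
  rw [div_lt_iff₀ (by simp [zero_lt_iff])]
  exact h

theorem newton_aux (h2 : (2 : K) ≠ 0) {x : K} (n : ℕ) (h : ∃ y : Kˣ, v (x * y ^ 2 - 1) < v 4) :
    ∃ (y : Kˣ) (z : K), x * y ^ 2 = 1 + 4 * z ∧ v z ≤ exp (-((n : ℤ) + 1)) := by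
  have h4 := four_ne h2
  induction n with
  | zero =>
    obtain ⟨y, hy⟩ := h
    refine ⟨y, (x * y ^ 2 - 1) / 4, by field_simp; ring, ?_⟩
    have : v ((x * y ^ 2 - 1) / 4) < 1 := by
      rw [map_div₀, div_lt_iff₀ (v_four_pos v h2)]; simpa using hy
    have h1 : (1 : ℤᵐ⁰) = exp 0 := by simp
    rw [h1, ] at this
    by_cases h0 : v ((x * y ^ 2 - 1) / 4) = 0
    · rw [h0]; exact zero_le
    · rw [← log_lt_iff_lt_exp h0] at this
      rw [← log_le_iff_le_exp h0]
      push_cast; omega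
  | succ n ih =>
    obtain ⟨y, z, hyz, hz⟩ := ih
    have hz1 : v z < 1 := by
      refine hz.trans_lt ?_
      rw [← exp_zero, exp_lt_exp]; omega
    have hw : v (1 + 2 * z) = 1 := by
      have : v (2 * z) < v 1 := by
        rw [map_mul, map_one]; exact (mul_le_of_le_one_left' (v_two_le v)).trans_lt hz1
      rw [Valuation.map_add_eq_of_lt_left v this, map_one]
    have hw0 : (1 + 2 * z) ≠ 0 := by intro h; rw [h] at hw; simp at hw
    refine ⟨y * (Units.mk0 _ hw0)⁻¹, - z ^ 2 / (1 + 2 * z) ^ 2, ?_, ?_⟩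
    · have : x * ((y * (Units.mk0 _ hw0)⁻¹ : Kˣ) : K) ^ 2 = (x * y ^ 2) / (1 + 2 * z) ^ 2 := by
        push_cast; simp; field_simp
      rw [this, hyz, eq_comm, eq_div_iff (pow_ne_zero 2 hw0), add_mul, mul_div_assoc', div_mul_cancel₀ _ (pow_ne_zero 2 hw0)]; ring
    · rw [map_div₀, Valuation.map_neg, map_pow, map_pow, hw, one_pow, div_one, pow_two]
      calc v z * v z ≤ exp (-((n : ℤ) + 1)) * exp (-((n : ℤ) + 1)) := mul_le_mul' hz hz
        _ ≤ _ := by rw [← exp_add, exp_le_exp]; push_cast; omega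

theorem newton {x : Kˣ} (h : x ∈ LL v h2) {γ : ℤᵐ⁰} (hγ : 0 < γ) :
    ∃ y : Kˣ, v ((x : K) * y ^ 2 - 1) < γ := by
  have hg : ∃ n : ℕ, exp (-((n : ℤ) + 1)) < γ := by
    refine ⟨(-(log γ)).toNat, ?_⟩
    rw [← lt_log_iff_exp_lt hγ.ne']
    omega
  obtain ⟨n, hn⟩ := hg
  obtain ⟨y, z, hyz, hz⟩ := newton_aux v h2 n h
  refine ⟨y, ?_⟩
  rw [hyz]
  have : (1 + 4 * z - 1) = 4 * z := by ring
  rw [this, map_mul]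
  exact (mul_le_of_le_one_left' (v_four_le v)).trans_lt (hz.trans_lt hn)

/-- strong form: elements of LL are near squares -/
theorem newton' {x : Kˣ} (h : x ∈ LL v h2) {γ : ℤᵐ⁰} (hγ : 0 < γ) :
    ∃ y : Kˣ, v ((y : K) ^ 2 - x) < γ ∧ v (y : K) ^ 2 = v x := by
  have hx : 0 < v (x : K) := by simp [zero_lt_iff]
  obtain ⟨y, hy⟩ := newton v h2 h (γ := min 1 (γ / v x)) (by
    rw [lt_min_iff]; exact ⟨zero_lt_one, div_pos hγ hx⟩)
  rw [lt_min_iff] at hy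
  have hy0 : (y : K) ≠ 0 := y.ne_zero
  have e1 := v_eq_one_of v le_rfl hy.1
  have hvy : v (y : K) ≠ 0 := by simp
  refine ⟨y⁻¹, ?_, ?_⟩
  · have e2 : ((y⁻¹ : Kˣ) : K) ^ 2 - x = - (((x:K) * (y:K) ^ 2 - 1) * x * ((x:K) * (y:K) ^ 2)⁻¹) := by
      push_cast; field_simp; ring
    rw [e2, Valuation.map_neg, map_mul, map_mul, map_inv₀, e1, inv_one, mul_one]
    rw [← lt_div_iff₀ hx]; exact hy.2
  · rw [map_mul, map_pow] at e1
    rw [Units.val_inv_eq_inv_val, map_inv₀, inv_pow]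
    exact inv_eq_of_mul_eq_one_left e1

end Val
end BQ

namespace BQ
open WithZero

section Val
variable {K : Type*} [Field K] (v : Valuation K ℤᵐ⁰)

/-- additive filtration -/
def MM (n : ℕ) : AddSubgroup K where
  carrier := {x | v x ≤ exp (-(n : ℤ))}
  add_mem' := fun ha hb => v.map_add_le ha hb
  zero_mem' := by simp
  neg_mem' := by intro x hx; simpa using hx

theorem mem_MM {n : ℕ} {x : K} : x ∈ MM v n ↔ v x ≤ exp (-(n : ℤ)) := Iff.rfl

theorem MM_anti {m n : ℕ} (h : m ≤ n) : MM v n ≤ MM v m := by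
  intro x hx
  rw [mem_MM] at *
  exact hx.trans (by rw [exp_le_exp]; omega)

/-- size of the residue field -/
noncomputable def qq : ℕ := (MM v 1).relIndex (MM v 0)

variable (hv : ∃ p : K, v p = exp (-1 : ℤ))

theorem MM_step (hv : ∃ p : K, v p = exp (-1 : ℤ)) (n : ℕ) : (MM v (n + 1)).relIndex (MM v n) = qq v := by
  obtain ⟨p, hp⟩ := hv
  have hp0 : p ≠ 0 := by rintro rfl; rw [map_zero] at hp; exact exp_ne_zero hp.symm
  have hpn : v (p ^ n) = exp (-(n : ℤ)) := by
    rw [map_pow, hp, ← exp_nsmul]; simp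
  have key : ∀ k, MM v (n + k) = (MM v k).map (AddMonoidHom.mulLeft (p ^ n)) := by
    intro k
    ext x
    constructor
    · intro hx
      refine ⟨x / p ^ n, ?_, ?_⟩
      · show v _ ≤ _
        rw [map_div₀, hpn, div_le_iff₀ exp_pos, ← exp_add]
        rw [mem_MM] at hx
        convert hx using 2
        push_cast; ring
      · simp only [AddMonoidHom.coe_mulLeft]; field_simp
    · rintro ⟨y, hy, rfl⟩
      have hy : v y ≤ _ := hy
      show v (p ^ n * y) ≤ _
      rw [map_mul, hpn]
      calc _ ≤ exp (-(n : ℤ)) * exp (-(k : ℤ)) := mul_le_mul_right hy _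
        _ = _ := by rw [← exp_add]; congr 1; push_cast; ring
  have := key 0
  rw [add_zero] at this
  rw [this, key 1, qq]
  exact AddSubgroup.relIndex_map_map_of_injective _ _ (mul_right_injective₀ (pow_ne_zero n hp0))

theorem MM_rel (hv : ∃ p : K, v p = exp (-1 : ℤ)) (m n : ℕ) : (MM v (m + n)).relIndex (MM v m) = qq v ^ n := by
  induction n with
  | zero => simp
  | succ n ih =>
    rw [← AddSubgroup.relIndex_mul_relIndex (MM v (m + (n + 1))) (MM v (m + n)) (MM v m)
      (MM_anti v (by omega)) (MM_anti v (by omega)), ih]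
    have := MM_step v hv (m + n)
    rw [← add_assoc, this]; ring

theorem lt_exp_iff {x : K} {n : ℤ} : v x < exp n ↔ v x ≤ exp (n - 1) := by
  by_cases h : v x = 0
  · simp [h]
  · rw [← log_lt_iff_lt_exp h, ← log_le_iff_le_exp h]; omega

variable (h2 : (2 : K) ≠ 0)

/-- units of the valuation -/
def VU : Subgroup Kˣ where
  carrier := {x | v (x : K) = 1}
  mul_mem' := by intro a b ha hb; simp_all
  one_mem' := by simp
  inv_mem' := by intro a ha; simp_all

theorem mem_VU {x : Kˣ} : x ∈ VU v ↔ v (x : K) = 1 := Iff.rfl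

theorem OU_le_VU {γ hγ} : OU v γ hγ ≤ VU v := fun _ h => h.1

theorem OU_fin (hv : ∃ p : K, v p = exp (-1 : ℤ)) (n : ℕ) (hq : qq v ≠ 0) : (OU v (exp (-(n : ℤ))) (by simp)).relIndex (VU v) ≠ 0 := by
  have h := MM_rel v hv 0 (n + 1)
  have h0 : (MM v (0 + (n + 1))).relIndex (MM v 0) ≠ 0 := by rw [h]; exact pow_ne_zero _ hq
  rw [AddSubgroup.relIndex] at h0
  have hf : Finite (MM v 0 ⧸ (MM v (0 + (n + 1))).addSubgroupOf (MM v 0)) :=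
    Nat.finite_of_card_ne_zero h0
  rw [Subgroup.relIndex, Subgroup.index]
  apply Nat.card_ne_zero.2 ⟨⟨1⟩, ?_⟩
  have hmem : ∀ x : VU v, ((x : Kˣ) : K) ∈ MM v 0 := by
    intro x
    rw [mem_MM, (mem_VU v).1 x.2]; simp
  refine Finite.of_injective (β := MM v 0 ⧸ (MM v (0 + (n + 1))).addSubgroupOf (MM v 0))
    (fun a => QuotientAddGroup.mk ⟨_, hmem a.out⟩) ?_
  intro a b hab
  have hab := QuotientAddGroup.eq.1 hab
  rw [AddSubgroup.mem_addSubgroupOf] at hab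
  rw [← a.out_eq, ← b.out_eq]
  apply QuotientGroup.eq.2
  rw [Subgroup.mem_subgroupOf]
  set x := a.out
  set y := b.out
  have hx : v ((x : Kˣ) : K) = 1 := x.2
  have hy : v ((y : Kˣ) : K) = 1 := y.2
  have hab : v (-((x : Kˣ) : K) + ((y : Kˣ) : K)) ≤ exp (-((0 + (n + 1) : ℕ) : ℤ)) := hab
  refine ⟨by simp [hx, hy], ?_⟩
  have : (((x⁻¹ * y : VU v) : Kˣ) : K) - 1 = ((x : Kˣ) : K)⁻¹ * (-((x : Kˣ) : K) + ((y : Kˣ) : K)) := by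
    push_cast; simp [mul_add]; ring
  rw [this, map_mul, map_inv₀, hx, inv_one, one_mul, lt_exp_iff]
  convert hab using 2
  push_cast; ring

theorem OU_rel (hv : ∃ p : K, v p = exp (-1 : ℤ)) (h2 : (2 : K) ≠ 0) (e : ℕ) (he : v 2 = exp (-(e : ℤ))) :
    (OU v (v 4) (v_four_pos v h2)).relIndex (OU v (v 2) (v_two_pos v h2)) = qq v ^ e := by
  obtain ⟨p, hp⟩ := id hv
  have hp0 : p ≠ 0 := by rintro rfl; rw [map_zero] at hp; exact exp_ne_zero hp.symm
  rw [← MM_rel v hv 0 e, AddSubgroup.relIndex, AddSubgroup.index, Subgroup.relIndex, Subgroup.index]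
  have h2p : v (2 * p) = exp (-(e : ℤ) - 1) := by rw [map_mul, he, hp, ← exp_add]; congr 1
  have h2p0 : 2 * p ≠ 0 := mul_ne_zero h2 hp0
  have hmem : ∀ x : OU v (v 2) (v_two_pos v h2), (((x : Kˣ) : K) - 1) / (2 * p) ∈ MM v 0 := by
    rintro ⟨x, hx, hx'⟩
    rw [he, lt_exp_iff] at hx'
    rw [mem_MM, map_div₀, h2p, div_le_iff₀ exp_pos]
    simpa using hx'
  let Q := MM v 0 ⧸ (MM v (0 + e)).addSubgroupOf (MM v 0)
  let φ : OU v (v 2) (v_two_pos v h2) →* Multiplicative Q :=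
    { toFun := fun x => Multiplicative.ofAdd (QuotientAddGroup.mk ⟨_, hmem x⟩)
      map_one' := by
        rw [← ofAdd_zero]; congr 1
        rw [QuotientAddGroup.eq_zero_iff, AddSubgroup.mem_addSubgroupOf]
        simp
      map_mul' := by
        intro x y
        rw [← ofAdd_add, ← QuotientAddGroup.mk_add]
        congr 1
        apply QuotientAddGroup.eq.2
        rw [AddSubgroup.mem_addSubgroupOf]
        obtain ⟨x, hx, hx'⟩ := x
        obtain ⟨y, hy, hy'⟩ := y
        have hh : ((-⟨_, hmem (⟨x, hx, hx'⟩ * ⟨y, hy, hy'⟩)⟩ +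
          (⟨_, hmem ⟨x, hx, hx'⟩⟩ + ⟨_, hmem ⟨y, hy, hy'⟩⟩) : MM v 0) : K)
            = - (((x : K) - 1) * ((y : K) - 1) / (2 * p)) := by
          simp; field_simp; ring
        rw [hh]
        rw [he, lt_exp_iff] at hx' hy'
        rw [mem_MM, Valuation.map_neg, map_div₀, h2p, div_le_iff₀ exp_pos, map_mul]
        refine (mul_le_mul' hx' hy').trans ?_
        rw [← exp_add, ← exp_add, exp_le_exp]
        push_cast; omega }
  have hsurj : Function.Surjective φ := by
    intro z
    obtain ⟨⟨z, hz⟩, hz'⟩ := QuotientAddGroup.mk_surjective (Multiplicative.toAdd z)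
    have hz : v z ≤ _ := hz
    have h1 : v (2 * p * z) < v 2 := by
      rw [he, lt_exp_iff, map_mul, h2p]
      simp at hz
      exact mul_le_of_le_one_right' hz
    have h3 := v_eq_one_of v (x := 1 + 2 * p * z) (v_two_le v) (by simpa using h1)
    have h4 : 1 + 2 * p * z ≠ 0 := by intro h; rw [h] at h3; simp at h3
    refine ⟨⟨Units.mk0 _ h4, h3, by simpa using h1⟩, ?_⟩
    refine Eq.trans ?_ (congrArg Multiplicative.ofAdd hz')
    show Multiplicative.ofAdd _ = _
    congr 2
    ext
    simp; field_simp
  have hker : φ.ker = (OU v (v 4) (v_four_pos v h2)).subgroupOf (OU v (v 2) (v_two_pos v h2)) := by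
    ext ⟨x, hx, hx'⟩
    rw [MonoidHom.mem_ker, Subgroup.mem_subgroupOf]
    have : φ ⟨x, hx, hx'⟩ = 1 ↔ ((x : K) - 1) / (2 * p) ∈ MM v (0 + e) := by
      show Multiplicative.ofAdd _ = Multiplicative.ofAdd 0 ↔ _
      rw [Equiv.apply_eq_iff_eq, QuotientAddGroup.eq_zero_iff, AddSubgroup.mem_addSubgroupOf]
    have h4 : v 4 = exp (-(e : ℤ) + -(e : ℤ)) := by rw [v_four, he, ← exp_add]
    rw [this, mem_MM, map_div₀, h2p, div_le_iff₀ exp_pos, mem_OU, h4, ← exp_add, lt_exp_iff]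
    simp only [hx, true_and]
    have : -((0 + e : ℕ) : ℤ) + (-(e : ℤ) - 1) = -(e : ℤ) + -(e : ℤ) - 1 := by push_cast; ring
    rw [this]
  have := Nat.card_congr (QuotientGroup.quotientKerEquivOfSurjective φ hsurj).toEquiv
  rw [hker] at this
  exact this

theorem sq_index_aux {W : Type*} [CommGroup W] (A : Subgroup W) (hA : A.index ≠ 0) :
    (A ⊔ sq ⊤).index = A.relIndex (A.comap (powMonoidHom 2)) := by
  have h1 : A ≤ A.comap (powMonoidHom 2) := fun x hx => A.pow_mem hx 2
  have e1 := Subgroup.relIndex_mul_index h1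
  have e2 := Subgroup.relIndex_mul_index (le_sup_left : A ≤ A ⊔ sq ⊤)
  have e3 : A.relIndex (A ⊔ sq ⊤) = (A.comap (powMonoidHom 2)).index := by
    rw [Subgroup.relIndex_sup_left, Subgroup.index_comap, sq, MonoidHom.range_eq_map]
  rw [e3] at e2
  rw [mul_comm] at e1
  have h0 : (A.comap (powMonoidHom 2)).index ≠ 0 := by
    intro h; rw [h, zero_mul] at e1; exact hA e1.symm
  exact Nat.eq_of_mul_eq_mul_left (Nat.pos_of_ne_zero h0) (e2.trans e1.symm)

end Val
end BQ

namespace BQ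
open WithZero

section Val
variable {K : Type*} [Field K] (v : Valuation K ℤᵐ⁰)
variable (hv : ∃ p : K, v p = exp (-1 : ℤ)) (h2 : (2 : K) ≠ 0)

theorem sq_near_one {x : K} (h : v (x ^ 2 - 1) < v 4) : v (x - 1) < v 2 ∨ v (-x - 1) < v 2 := by
  by_contra hc
  push Not at hc
  have e : x ^ 2 - 1 = -((x - 1) * (-x - 1)) := by ring
  rw [e, Valuation.map_neg, map_mul, v_four] at h
  exact absurd h (not_lt.2 (mul_le_mul' hc.1 hc.2))

theorem sq_close {x : K} (h : v (x - 1) < v 2) : v (x ^ 2 - 1) < v 4 := by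
  have e : x ^ 2 - 1 = (x - 1) * (x - 1 + 2) := by ring
  have : v (x - 1 + 2) = v 2 := Valuation.map_add_eq_of_lt_right v h
  rw [e, map_mul, this, v_four]
  have h2 : 0 < v 2 := lt_of_le_of_lt zero_le h
  exact (mul_lt_mul_iff_left₀ h2).2 h

theorem LL_relIndex (hv : ∃ p : K, v p = exp (-1 : ℤ)) (h2 : (2 : K) ≠ 0) (e : ℕ) (he : v 2 = exp (-(e : ℤ))) (hq : qq v ≠ 0) :
    (LL v h2).relIndex (VU v) = 2 * qq v ^ e := by
  have h4 : v 4 = exp (-((2 * e : ℕ) : ℤ)) := by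
    rw [v_four, he, ← exp_add]; congr 1; push_cast; ring
  set A := (OU v (v 4) (v_four_pos v h2)).subgroupOf (VU v) with hA
  set C := (OU v (v 2) (v_two_pos v h2)).subgroupOf (VU v) with hC
  have hA0 : A.index ≠ 0 := by
    have := OU_fin v hv (2 * e) hq
    rw [hA]
    simp only [h4]
    exact this
  have hAC : A ≤ C := by
    rintro ⟨x, hx⟩ ⟨h1, h3⟩
    refine ⟨h1, lt_of_lt_of_le h3 ?_⟩
    rw [v_four]; exact mul_le_of_le_one_left' (v_two_le v)
  have hCs : C ≤ A.comap (powMonoidHom 2) := by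
    rintro ⟨x, hx⟩ ⟨h1, h3⟩
    exact ⟨by simpa using h1, sq_close v h3⟩
  have e1 : C.relIndex (A.comap (powMonoidHom 2)) = 2 := by
    rw [Subgroup.relIndex_eq_two_iff]
    refine ⟨⟨-1, by simp [mem_VU]⟩, ⟨?_, ?_⟩, ?_⟩
    · simp
    · simpa using v_four_pos v h2
    · rintro ⟨b, hb⟩ ⟨hb1, hb2⟩
      have hb2 : v ((b : K) ^ 2 - 1) < v 4 := hb2
      have hb : v (b : K) = 1 := hb
      have i1 : (⟨b, hb⟩ * ⟨-1, by simp [mem_VU]⟩ : VU v) ∈ C ↔ v (-(b : K) - 1) < v 2 := by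
        show (_ ∧ _) ↔ _
        simp [hb]
      have i2 : (⟨b, hb⟩ : VU v) ∈ C ↔ v ((b : K) - 1) < v 2 := by
        show (_ ∧ _) ↔ _
        simp [hb]
      rw [i1, i2]
      rcases sq_near_one v hb2 with h | h
      · right
        refine ⟨h, fun h' => ?_⟩
        have := v.map_add_lt h h'
        have e : (b : K) - 1 + (-b - 1) = -2 := by ring
        rw [e, Valuation.map_neg] at this
        exact lt_irrefl _ this
      · left
        refine ⟨h, fun h' => ?_⟩
        have := v.map_add_lt h h'
        have e : (-b - 1) + ((b : K) - 1)  = -2 := by ring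
        rw [e, Valuation.map_neg] at this
        exact lt_irrefl _ this
  have e2 : A.relIndex C = qq v ^ e := by
    rw [← OU_rel v hv h2 e he, hA, hC]
    exact Subgroup.relIndex_subgroupOf (OU_le_VU v)
  have e3 : (LL v h2).subgroupOf (VU v) = A ⊔ sq ⊤ := by
    ext ⟨x, hx⟩
    have hx1 : v (x : K) = 1 := hx
    rw [Subgroup.mem_subgroupOf, Subgroup.mem_sup]
    constructor
    · rintro ⟨y, hy⟩
      have h1 := v_eq_one_of v (v_four_le v) hy
      have h1' := h1
      rw [map_mul, map_pow] at h1
      rw [show v (((⟨x, hx⟩ : VU v) : Kˣ) : K) = 1 from hx1, one_mul] at h1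
      have hy1 : v (y : K) = 1 := by
        have := (pow_eq_one_iff (n := 2)).1 h1
        simpa using this
      refine ⟨⟨x * y ^ 2, by simp [mem_VU, hx1, hy1]⟩, ⟨by simpa using h1', ?_⟩, ⟨y⁻¹, by simp [mem_VU, hy1]⟩ ^ 2, ⟨_, trivial, rfl⟩, ?_⟩
      · simpa using hy
      · ext; simp
    · rintro ⟨⟨a, ha⟩, ⟨ha1, ha2⟩, _, ⟨⟨b, hb⟩, -, rfl⟩, h⟩
      have : x = a * b ^ 2 := by simpa using (congrArg Subtype.val h).symm
      show x ∈ _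
      rw [this, mul_sq_mem_LL]
      exact mem_LL_of_lt _ _ ha2
  rw [Subgroup.relIndex, e3, sq_index_aux A hA0,
    ← Subgroup.relIndex_mul_relIndex A C _ hAC hCs, e1, e2, mul_comm]

theorem LL_index (hv : ∃ p : K, v p = exp (-1 : ℤ)) (h2 : (2 : K) ≠ 0) (e : ℕ) (he : v 2 = exp (-(e : ℤ))) (hq : qq v ≠ 0) :
    (LL v h2).index = 4 * qq v ^ e := by
  obtain ⟨p, hp⟩ := id hv
  have hp0 : p ≠ 0 := by rintro rfl; rw [map_zero] at hp; exact exp_ne_zero hp.symm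
  have key : ∀ b : Kˣ, b ∈ LL v h2 ⊔ VU v ↔ Even (log (v (b : K))) := by
    intro b
    rw [Subgroup.mem_sup]
    constructor
    · rintro ⟨a, ⟨y, hy⟩, c, hc, rfl⟩
      have h1 := v_eq_one_of v (v_four_le v) hy
      have hc : v (c : K) = 1 := hc
      rw [Units.val_mul, map_mul, hc, mul_one]
      have := congrArg log h1
      rw [map_mul, map_pow, log_mul (by simp) (by simp), log_pow, log_one] at this
      simp at this
      exact ⟨-log (v (y : K)), by linarith⟩
    · rintro ⟨k, hk⟩
      have hb : v (b : K) = exp (k + k) := by rw [← hk, exp_log]; simp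
      refine ⟨((Units.mk0 p hp0) ^ (-k)) ^ 2, sq_mem_LL _ _ _, b * ((Units.mk0 p hp0) ^ k) ^ 2, ?_, ?_⟩
      · rw [mem_VU]
        push_cast
        simp only [map_mul, map_pow, map_zpow₀, Units.val_mk0]
        rw [hb, hp, ← exp_zsmul, ← exp_nsmul, ← exp_add, ← exp_zero]
        congr 1
        simp; ring
      · rw [mul_comm, mul_assoc, ← mul_pow, ← zpow_add]; simp
  have e1 : (LL v h2 ⊔ VU v).index = 2 := by
    rw [Subgroup.index_eq_two_iff]
    refine ⟨Units.mk0 p hp0, fun b => ?_⟩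
    rw [key, key, Units.val_mul, map_mul, log_mul (by simp) (by simp [hp0]), Units.val_mk0, hp, log_exp]
    rw [← sub_eq_add_neg, Int.even_sub_one]
    by_cases h : Even (log (v (b : K))) <;> simp [h]
  rw [← Subgroup.relIndex_mul_index (le_sup_left : LL v h2 ≤ LL v h2 ⊔ VU v), e1,
    Subgroup.relIndex_sup_left, LL_relIndex v hv h2 e he hq]
  ring

end Val
end BQ

namespace BQ
open WithZero NumberField IsDedekindDomain

section
variable (F : Type*) [Field F] [NumberField F]

/-- finite places -/
abbrev FP := HeightOneSpectrum (𝓞 F)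
/-- finite or real places -/
abbrev Pl := FP F ⊕ (F →+* ℝ)

variable {F}

/-- positive elements at a real place -/
def posR (s : F →+* ℝ) : Subgroup Fˣ where
  carrier := {x | 0 < s x}
  mul_mem' := by intro a b ha hb; simpa using mul_pos ha hb
  one_mem' := by simp
  inv_mem' := by intro a ha; simpa using ha

/-- local squares -/
noncomputable def L : Pl F → Subgroup Fˣ
  | .inl v => LL (v.valuation F) two_ne_zero
  | .inr s => posR s

theorem mem_L_inr {s : F →+* ℝ} {x : Fˣ} : x ∈ L (.inr s) ↔ 0 < s x := Iff.rfl

theorem sq_mem_L (v : Pl F) (y : Fˣ) : y ^ 2 ∈ L v := by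
  rcases v with v | s
  · exact sq_mem_LL _ two_ne_zero y
  · show 0 < s _
    have : s (y : F) ≠ 0 := by simp
    push_cast
    rw [map_pow]; positivity

theorem exists_unif (v : FP F) : ∃ p : F, v.valuation F p = exp (-1 : ℤ) :=
  v.valuation_exists_uniformizer F

theorem posR_index (s : F →+* ℝ) : (L (.inr s)).index = 2 := by
  rw [Subgroup.index_eq_two_iff]
  refine ⟨-1, fun b => ?_⟩
  rw [mem_L_inr, mem_L_inr]
  have : s (b : F) ≠ 0 := by simp
  have e : s ((b * -1 : Fˣ) : F) = - s b := by simp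
  rw [e]
  rcases lt_or_gt_of_ne this with h | h
  · left; exact ⟨by linarith, by linarith⟩
  · right; exact ⟨by linarith, by linarith⟩

theorem qq_eq (v : FP F) : qq (v.valuation F) = Ideal.absNorm v.asIdeal := by
  have hmem : ∀ r : 𝓞 F, algebraMap (𝓞 F) F r ∈ MM (v.valuation F) 0 := by
    intro r; rw [mem_MM]; simpa using v.valuation_le_one r
  let φ : 𝓞 F →+ MM (v.valuation F) 0 ⧸ (MM (v.valuation F) 1).addSubgroupOf (MM (v.valuation F) 0) :=
    (QuotientAddGroup.mk' _).comp ((algebraMap (𝓞 F) F).toAddMonoidHom.codRestrict _ hmem)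
  have hs : Function.Surjective φ := by
    intro z
    obtain ⟨⟨z, hz⟩, rfl⟩ := QuotientAddGroup.mk_surjective z
    have hz' : v.valuation F z ≤ 1 := by simpa [mem_MM] using hz
    obtain ⟨a, ha⟩ := v.exists_valuation_sub_lt_of_integer (K := F) hz' 1
    rw [Units.val_one] at ha
    refine ⟨a, ?_⟩
    apply QuotientAddGroup.eq.2
    rw [AddSubgroup.mem_addSubgroupOf]
    show -(algebraMap (𝓞 F) F a) + z ∈ _
    rw [mem_MM]
    rw [← exp_zero, lt_exp_iff, Valuation.map_sub_swap] at ha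
    rw [neg_add_eq_sub]
    simpa [Valuation.map_sub_swap] using ha
  have hk : φ.ker = v.asIdeal.toAddSubgroup := by
    ext r
    rw [AddMonoidHom.mem_ker]
    show QuotientAddGroup.mk _ = 0 ↔ _
    rw [QuotientAddGroup.eq_zero_iff, AddSubgroup.mem_addSubgroupOf]
    show algebraMap (𝓞 F) F r ∈ _ ↔ r ∈ v.asIdeal
    rw [mem_MM, ← v.valuation_lt_one_iff_mem (K := F), ← exp_zero, lt_exp_iff]
    simp
  have := Nat.card_congr (QuotientAddGroup.quotientKerEquivOfSurjective φ hs).toEquiv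
  rw [hk] at this
  exact this.symm

theorem qq_ne (v : FP F) : qq (v.valuation F) ≠ 0 := by
  rw [qq_eq]
  exact Ideal.absNorm_ne_zero_of_nonZeroDivisors ⟨v.asIdeal, mem_nonZeroDivisors_of_ne_zero v.ne_bot⟩

/-- exponent of 2 -/
noncomputable def ee (v : FP F) : ℕ := (Associates.mk v.asIdeal).count (Associates.mk (Ideal.span {(2 : 𝓞 F)})).factors

theorem v_two (v : FP F) : v.valuation F 2 = exp (-(ee v : ℤ)) := by
  have h : (2 : F) = algebraMap (𝓞 F) F 2 := (map_ofNat _ 2).symm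
  rw [h, v.valuation_of_algebraMap, v.intValuation_if_neg two_ne_zero]; rfl

theorem L_index (v : FP F) : (L (.inl v)).index = 4 * qq (v.valuation F) ^ (ee v) :=
  LL_index (v.valuation F) (exists_unif v) two_ne_zero (ee v) (v_two v) (qq_ne v)

theorem L_index_ne (v : Pl F) : (L v).index ≠ 0 := by
  rcases v with v | s
  · rw [L_index]; simp [qq_ne v]
  · rw [posR_index]; norm_num

theorem prod_two (S : Finset (FP F)) (hS : ∀ v : FP F, v.valuation F 2 ≠ 1 → v ∈ S) :
    ∏ v ∈ S, qq (v.valuation F) ^ (ee v) = 2 ^ Module.finrank ℚ F := by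
  have h0 : Ideal.span {(2 : 𝓞 F)} ≠ 0 := by simp
  have h1 := Ideal.finprod_heightOneSpectrum_factorization h0
  rw [finprod_eq_prod_of_mulSupport_subset (s := S)] at h1
  · have h3 := congrArg Ideal.absNorm h1
    rw [map_prod, Ideal.absNorm_span_singleton] at h3
    have h4 : (Algebra.norm ℤ (2 : 𝓞 F)).natAbs = 2 ^ Module.finrank ℚ F := by
      have : (2 : 𝓞 F) = algebraMap ℤ (𝓞 F) 2 := by simp
      rw [this, Algebra.norm_algebraMap, RingOfIntegers.rank, Int.natAbs_pow]; rfl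
    rw [h4] at h3
    rw [← h3]
    apply Finset.prod_congr rfl
    intro v _
    rw [qq_eq, HeightOneSpectrum.maxPowDividing, map_pow, ee]
  · intro v hv
    apply hS
    intro h
    apply hv
    rw [v_two, ← exp_zero, exp_inj] at h
    unfold HeightOneSpectrum.maxPowDividing
    have : ee v = 0 := by omega
    rw [ee] at this
    show v.asIdeal ^ _ = 1
    rw [this, pow_zero]

theorem card_real : Fintype.card (F →+* ℝ) = InfinitePlace.nrRealPlaces F := by
  classical
  rw [← InfinitePlace.card_real_embeddings]
  apply Fintype.card_congr
  refine ⟨fun s => ⟨Complex.ofRealHom.comp s, ?_⟩, fun φ => φ.2.embedding, ?_, ?_⟩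
  · ext x; simp
  · intro s; ext x; rfl
  · rintro ⟨φ, h⟩
    ext x
    simp

theorem prod_index (S : Finset (FP F)) (hS : ∀ v : FP F, v.valuation F 2 ≠ 1 → v ∈ S) :
    (∏ v ∈ S, (L (.inl v)).index) * ∏ s : F →+* ℝ, (L (.inr s)).index =
      4 ^ (S.card + Fintype.card (InfinitePlace F)) := by
  simp only [posR_index, L_index]
  rw [Finset.prod_mul_distrib, prod_two S hS, Finset.prod_const, Finset.prod_const, Finset.card_univ,
    card_real, InfinitePlace.card_eq_nrRealPlaces_add_nrComplexPlaces,
    ← InfinitePlace.card_add_two_mul_card_eq_rank]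
  have : (4 : ℕ) = 2 ^ 2 := by norm_num
  rw [this, ← pow_mul, ← pow_mul, ← pow_add, ← pow_add]
  congr 1; ring
end
end BQ

namespace BQ
open WithZero NumberField IsDedekindDomain

section
variable {F : Type*} [Field F] [NumberField F]

/-- S-units -/
noncomputable def US (S : Finset (FP F)) : Subgroup Fˣ where
  carrier := {x | ∀ v : FP F, v ∉ S → v.valuation F (x : F) = 1}
  mul_mem' := by intro a b ha hb v hv; simp [ha v hv, hb v hv]
  one_mem' := by simp
  inv_mem' := by intro a ha v hv; simp [ha v hv]

theorem mem_US {S : Finset (FP F)} {x : Fˣ} :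
    x ∈ US S ↔ ∀ v : FP F, v ∉ S → v.valuation F (x : F) = 1 := Iff.rfl

theorem US_mono {S T : Finset (FP F)} (h : S ⊆ T) : US S ≤ US T :=
  fun _ hx v hv => hx v (fun h' => hv (h h'))

theorem finite_supp (x : Fˣ) : {v : FP F | v.valuation F (x : F) ≠ 1}.Finite := by
  obtain ⟨a, b, hb, hx⟩ := IsFractionRing.div_surjective (A := 𝓞 F) (x : F)
  have hb0 : b ≠ 0 := nonZeroDivisors.ne_zero hb
  have ha0 : a ≠ 0 := by rintro rfl; rw [map_zero, zero_div] at hx; exact x.ne_zero hx.symm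
  have h1 := Ideal.finite_factors (I := Ideal.span {a}) (by simpa using ha0)
  have h2 := Ideal.finite_factors (I := Ideal.span {b}) (by simpa using hb0)
  refine (h1.union h2).subset ?_
  intro v hv
  by_contra hc
  simp only [Set.mem_union, not_or] at hc
  apply hv
  rw [← hx, map_div₀]
  have h3 : ∀ c : 𝓞 F, ¬ (v.asIdeal ∣ Ideal.span {c}) → v.valuation F (algebraMap (𝓞 F) F c) = 1 := by
    intro c hc
    refine le_antisymm (v.valuation_le_one c) (not_lt.1 fun h => hc ?_)
    exact (v.valuation_lt_one_iff_dvd (K := F) c).1 h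
  rw [h3 a hc.1, h3 b hc.2, div_one]

theorem val_of_span {I : Ideal (𝓞 F)} {f : 𝓞 F} (h : Ideal.span {f} = I) {v : FP F}
    (hv : ¬ v.asIdeal ∣ I) : v.valuation F (algebraMap (𝓞 F) F f) = 1 := by
  refine le_antisymm (v.valuation_le_one f) (not_lt.1 fun h' => hv ?_)
  rw [← h]
  exact (v.valuation_lt_one_iff_dvd (K := F) f).1 h'

theorem asIdeal_dvd {v w : FP F} (h : v.asIdeal ∣ w.asIdeal) : v = w := by
  have h1 : w.asIdeal ≤ v.asIdeal := Ideal.le_of_dvd h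
  have h2 := (w.isMaximal.eq_of_le v.isPrime.ne_top h1)
  exact HeightOneSpectrum.ext h2.symm

theorem exists_pow_principal (v : FP F) : ∃ f : Fˣ, v.valuation F (f : F) ≠ 1 ∧
    ∀ w : FP F, w ≠ v → w.valuation F (f : F) = 1 := by
  have hv : v.asIdeal ∈ nonZeroDivisors (Ideal (𝓞 F)) := mem_nonZeroDivisors_of_ne_zero v.ne_bot
  set h := Fintype.card (ClassGroup (𝓞 F)) with hh
  have hpos : 0 < h := Fintype.card_pos
  have h1 : (ClassGroup.mk0 ⟨v.asIdeal ^ h, pow_mem hv h⟩ : ClassGroup (𝓞 F)) = 1 := by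
    have : (⟨v.asIdeal ^ h, pow_mem hv h⟩ : nonZeroDivisors (Ideal (𝓞 F))) = ⟨v.asIdeal, hv⟩ ^ h := rfl
    rw [this, map_pow, pow_card_eq_one]
  rw [ClassGroup.mk0_eq_one_iff] at h1
  obtain ⟨f, hf⟩ := h1
  have hf' : Ideal.span {f} = v.asIdeal ^ h := hf.symm
  have hf0 : f ≠ 0 := by
    rintro rfl
    have : v.asIdeal ^ h = 0 := by rw [← hf']; simp
    exact v.ne_bot (pow_eq_zero_iff hpos.ne' |>.1 this)
  refine ⟨Units.mk0 (algebraMap (𝓞 F) F f) (by simpa using hf0), ?_, ?_⟩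
  · apply ne_of_lt
    rw [Units.val_mk0, v.valuation_lt_one_iff_dvd, hf']
    exact dvd_pow_self _ hpos.ne'
  · intro w hw
    apply val_of_span hf'
    intro hdv
    exact hw (asIdeal_dvd (w.prime.dvd_of_dvd_pow hdv))

/-- class group condition -/
def CG (S : Finset (FP F)) : Prop := ∀ v : FP F, v ∉ S → ∃ f : Fˣ, v.valuation F (f : F) = exp (-1 : ℤ) ∧
  ∀ w : FP F, w ∉ S → w ≠ v → w.valuation F (f : F) = 1

theorem CG.mono {S T : Finset (FP F)} (h : S ⊆ T) (hS : CG S) : CG T := by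
  intro v hv
  obtain ⟨f, h1, h2⟩ := hS v (fun h' => hv (h h'))
  exact ⟨f, h1, fun w hw => h2 w (fun h' => hw (h h'))⟩

theorem exists_CG : ∃ S : Finset (FP F), CG S := by
  classical
  choose I hI using ClassGroup.mk0_surjective (R := 𝓞 F)
  have hfin : ∀ c, {v : FP F | v.asIdeal ∣ (I c : Ideal (𝓞 F))}.Finite := fun c =>
    Ideal.finite_factors (nonZeroDivisors.ne_zero (I c).2)
  refine ⟨Finset.univ.biUnion fun c => (hfin c).toFinset, ?_⟩
  intro v hv
  have hvn : ∀ c, ∀ w : FP F, w ∉ (Finset.univ.biUnion fun c => (hfin c).toFinset) →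
      ¬ w.asIdeal ∣ (I c : Ideal (𝓞 F)) := by
    intro c w hw hd
    exact hw (Finset.mem_biUnion.2 ⟨c, Finset.mem_univ _, (hfin c).mem_toFinset.2 hd⟩)
  have hv0 : v.asIdeal ∈ nonZeroDivisors (Ideal (𝓞 F)) := mem_nonZeroDivisors_of_ne_zero v.ne_bot
  obtain ⟨c, hc⟩ : ∃ c, c = (ClassGroup.mk0 ⟨v.asIdeal, hv0⟩)⁻¹ := ⟨_, rfl⟩
  have h1 : (ClassGroup.mk0 ⟨v.asIdeal * (I c : Ideal (𝓞 F)), mul_mem hv0 (I c).2⟩ : ClassGroup (𝓞 F)) = 1 := by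
    have : (⟨v.asIdeal * (I c : Ideal (𝓞 F)), mul_mem hv0 (I c).2⟩ : nonZeroDivisors (Ideal (𝓞 F)))
      = ⟨v.asIdeal, hv0⟩ * I c := rfl
    rw [this, map_mul, hI, hc, mul_inv_cancel]
  rw [ClassGroup.mk0_eq_one_iff] at h1
  obtain ⟨f, hf⟩ := h1
  have hf' : Ideal.span {f} = v.asIdeal * (I c : Ideal (𝓞 F)) := hf.symm
  have hf0 : f ≠ 0 := by
    rintro rfl
    have : v.asIdeal * (I c : Ideal (𝓞 F)) = 0 := by rw [← hf']; simp
    rcases mul_eq_zero.1 this with h | h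
    · exact v.ne_bot h
    · exact (nonZeroDivisors.ne_zero (I c).2) h
  refine ⟨Units.mk0 (algebraMap (𝓞 F) F f) (by simpa using hf0), ?_, ?_⟩
  · rw [Units.val_mk0]
    apply le_antisymm
    · rw [v.valuation_of_algebraMap]
      have := (v.intValuation_le_pow_iff_dvd f 1).2 (by rw [hf', pow_one]; exact dvd_mul_right _ _)
      simpa using this
    · by_contra hlt
      rw [not_le, lt_exp_iff, v.valuation_of_algebraMap] at hlt
      have := (v.intValuation_le_pow_iff_dvd f 2).1 (by simpa using hlt)
      rw [hf', pow_two] at this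
      exact hvn c v hv ((mul_dvd_mul_iff_left v.ne_bot).1 this)
  · intro w hw hwv
    apply val_of_span hf'
    intro h'
    rcases w.prime.dvd_or_dvd h' with h | h
    · exact hwv (asIdeal_dvd h)
    · exact hvn c w hw h

/-- logarithmic valuation as a homomorphism -/
noncomputable def vlog (v : FP F) : Fˣ →* Multiplicative ℤ where
  toFun x := Multiplicative.ofAdd (log (v.valuation F (x : F)))
  map_one' := by simp
  map_mul' := by intro x y; rw [Units.val_mul, map_mul, log_mul (by simp) (by simp), ofAdd_add]

theorem vlog_eq_one {v : FP F} {x : Fˣ} : vlog v x = 1 ↔ v.valuation F (x : F) = 1 := by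
  show Multiplicative.ofAdd _ = Multiplicative.ofAdd 0 ↔ _
  rw [Equiv.apply_eq_iff_eq]
  constructor
  · intro h
    rw [← exp_log (x := v.valuation F (x : F)) (by simp), h, exp_zero]
  · intro h; rw [h, log_one]

theorem US_step (S : Finset (FP F)) (v : FP F) (hv : v ∉ S) :
    letI := Classical.decEq (FP F)
    (sq (US (insert v S))).relIndex (US (insert v S)) = 2 * (sq (US S)).relIndex (US S) := by
  classical
  apply sq_relIndex_step _ _ (US_mono (Finset.subset_insert _ _)) ((vlog v).comp (Subgroup.subtype _))
  · intro h
    obtain ⟨f, hf1, hf2⟩ := exists_pow_principal v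
    have := DFunLike.congr_fun h ⟨f, fun w hw => hf2 w (fun h => hw (by rw [h]; exact Finset.mem_insert_self _ _))⟩
    exact hf1 (vlog_eq_one.1 this)
  · rintro ⟨x, hx⟩
    show vlog v x = 1 ↔ x ∈ _
    rw [vlog_eq_one]
    constructor
    · intro h w hw
      by_cases hwv : w = v
      · rw [hwv]; exact h
      · exact hx w (by simp [hwv, hw])
    · intro h; exact h v hv

theorem basis_hom {r : ℕ} {U Q : Type*} [CommGroup U] [CommGroup Q] (b : Module.Basis (Fin r) ℤ (Additive Q))
    (π : U →* Q) (hπ : Function.Surjective π) : ∃ ψ : Fin r → U →* Multiplicative ℤ,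
      (∀ x, (∀ i, ψ i x = 1) ↔ π x = 1) ∧ ∀ i, ∃ e, ψ i e ≠ 1 ∧ ∀ j, j ≠ i → ψ j e = 1 := by
  let ψ : Fin r → U →* Multiplicative ℤ := fun i =>
    { toFun := fun x => Multiplicative.ofAdd (b.repr (Additive.ofMul (π x)) i)
      map_one' := by simp
      map_mul' := by intro x y; simp }
  have hψ : ∀ i x, ψ i x = 1 ↔ b.repr (Additive.ofMul (π x)) i = 0 := by
    intro i x
    show Multiplicative.ofAdd _ = Multiplicative.ofAdd 0 ↔ _
    rw [Equiv.apply_eq_iff_eq]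
  refine ⟨ψ, ?_, ?_⟩
  · intro x
    simp only [hψ]
    rw [← ofMul_eq_zero, ← b.repr.map_eq_zero_iff]
    constructor
    · intro h; ext i; exact h i
    · intro h i; rw [h]; rfl
  · intro i
    obtain ⟨e, he⟩ := hπ (b i).toMul
    refine ⟨e, ?_, ?_⟩
    · rw [Ne, hψ, he]; simp
    · intro j hj; rw [hψ, he]; simp [Finsupp.single_apply, hj.symm]

theorem unit_homs : ∃ ψ : Fin (Units.rank F) → (𝓞 F)ˣ →* Multiplicative ℤ,
      (∀ x, (∀ i, ψ i x = 1) ↔ x ∈ Units.torsion F) ∧ ∀ i, ∃ e, ψ i e ≠ 1 ∧ ∀ j, j ≠ i → ψ j e = 1 := by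
  obtain ⟨ψ, h1, h2⟩ := basis_hom (Units.basisModTorsion F) (QuotientGroup.mk' (Units.torsion F))
    (QuotientGroup.mk'_surjective _)
  refine ⟨ψ, fun x => (h1 x).trans ?_, h2⟩
  exact QuotientGroup.eq_one_iff x

theorem units_sq_aux : (sq (⊤ : Subgroup (𝓞 F)ˣ)).relIndex ⊤ = 2 ^ (Units.rank F + 1) := by
  classical
  obtain ⟨ψ, hψ1, hψ2⟩ := unit_homs (F := F)
  let B : Finset (Fin (Units.rank F)) → Subgroup (𝓞 F)ˣ := fun T => ⨅ i : {i // i ∉ T}, (ψ i).ker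
  have hB : ∀ T x, x ∈ B T ↔ ∀ i ∉ T, ψ i x = 1 := by
    intro T x
    simp only [B, Subgroup.mem_iInf, MonoidHom.mem_ker, Subtype.forall]
  suffices h : ∀ T, (sq (B T)).relIndex (B T) = 2 ^ (T.card + 1) by
    have h1 := h Finset.univ
    have : B Finset.univ = ⊤ := by ext x; simp [hB]
    rw [this, Finset.card_univ, Fintype.card_fin] at h1
    exact h1
  intro T
  induction T using Finset.induction_on with
  | empty =>
    have hT : B ∅ = Units.torsion F := by
      ext x
      rw [hB, ← hψ1]; simp
    rw [hT]
    have h1 := sq_index_aux (W := Units.torsion F) ⊥ (by rw [Subgroup.index_bot]; exact Nat.card_pos.ne')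
    rw [bot_sup_eq, Subgroup.relIndex_bot_left] at h1
    have h2 : (sq (Units.torsion F)).relIndex (Units.torsion F) = (sq (⊤ : Subgroup (Units.torsion F))).index := by
      rw [Subgroup.relIndex]
      congr 1
      ext ⟨x, hx⟩
      constructor
      · rintro ⟨y, hy, h⟩
        exact ⟨⟨y, hy⟩, trivial, Subtype.ext h⟩
      · rintro ⟨⟨y, hy⟩, -, h⟩
        exact ⟨y, hy, congrArg Subtype.val h⟩
    rw [h2, h1, Finset.card_empty, zero_add, pow_one, Nat.card_eq_two_iff]
    have hm1 : (-1 : (𝓞 F)ˣ) ∈ Units.torsion F := by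
      rw [Units.torsion, CommGroup.mem_torsion, isOfFinOrder_iff_pow_eq_one]
      exact ⟨2, by norm_num, by simp⟩
    refine ⟨⟨1, one_mem _⟩, ⟨⟨-1, hm1⟩, ?_⟩, ?_, ?_⟩
    · rw [Subgroup.mem_comap, Subgroup.mem_bot]
      ext; simp
    · intro h
      have := congrArg (fun z => (((z.1 : Units.torsion F) : (𝓞 F)ˣ) : 𝓞 F)) h
      simp at this
      have h3 : (1 : F) = -1 := by
        have := congrArg (algebraMap (𝓞 F) F) this
        simpa using this
      norm_num at h3
    · ext ⟨⟨x, hx⟩, hx2⟩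
      simp only [Set.mem_insert_iff, Set.mem_singleton_iff, Set.mem_univ, iff_true]
      rw [Subgroup.mem_comap, Subgroup.mem_bot] at hx2
      have h3 : x ^ 2 = 1 := congrArg Subtype.val hx2
      have h4 : (x : 𝓞 F) ^ 2 = 1 := by simpa using congrArg Units.val h3
      rcases (sq_eq_sq_iff_eq_or_eq_neg.1 (h4.trans (one_pow 2).symm)) with h | h
      · left; ext; simp [h]
      · right; ext; simp [h]
  | insert i T hi ih =>
    rw [sq_relIndex_step (B T) (B (insert i T)) ?_ ((ψ i).comp (Subgroup.subtype _)) ?_ ?_, ih,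
      Finset.card_insert_of_notMem hi]
    · ring
    · intro x hx
      rw [hB] at hx ⊢
      intro j hj
      exact hx j (fun h => hj (Finset.mem_insert_of_mem h))
    · intro h
      obtain ⟨e, he1, he2⟩ := hψ2 i
      have hf : e ∈ B (insert i T) := by
        rw [hB]
        intro j hj
        exact he2 j (by rintro rfl; exact hj (Finset.mem_insert_self _ _))
      exact he1 (DFunLike.congr_fun h ⟨_, hf⟩)
    · rintro ⟨x, hx⟩
      show ψ i x = 1 ↔ x ∈ _
      rw [hB]
      rw [hB] at hx
      constructor
      · intro h j hj
        by_cases hji : j = i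
        · rw [hji]; exact h
        · exact hx j (by simp [hji, hj])
      · intro h; exact h i hi

theorem US_empty : US (∅ : Finset (FP F)) = (⊤ : Subgroup (𝓞 F)ˣ).map (Units.map (algebraMap (𝓞 F) F : 𝓞 F →* F)) := by
  ext x
  constructor
  · intro hx
    have h1 : ∃ a : 𝓞 F, algebraMap (𝓞 F) F a = x :=
      HeightOneSpectrum.mem_integers_of_valuation_le_one F (x : F) fun v => (hx v (by simp)).le
    have h2 : ∃ a : 𝓞 F, algebraMap (𝓞 F) F a = (x⁻¹ : Fˣ) :=
      HeightOneSpectrum.mem_integers_of_valuation_le_one F ((x⁻¹ : Fˣ) : F) fun v => by simp [hx v (by simp)]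
    obtain ⟨a, ha⟩ := h1
    obtain ⟨b, hb⟩ := h2
    have hab : a * b = 1 := by
      apply FaithfulSMul.algebraMap_injective (𝓞 F) F
      rw [map_mul, ha, hb]; simp
    refine ⟨⟨a, b, hab, by rw [mul_comm]; exact hab⟩, trivial, ?_⟩
    ext; exact ha
  · rintro ⟨u, -, rfl⟩ v -
    have h1 := v.valuation_le_one (K := F) (u : 𝓞 F)
    have h2 := v.valuation_le_one (K := F) ((u⁻¹ : (𝓞 F)ˣ) : 𝓞 F)
    have h3 : v.valuation F (algebraMap (𝓞 F) F (u : 𝓞 F)) * v.valuation F (algebraMap (𝓞 F) F ((u⁻¹ : (𝓞 F)ˣ) : 𝓞 F)) = 1 := by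
      rw [← map_mul, ← map_mul]; simp
    apply le_antisymm h1
    rw [← h3]
    exact mul_le_of_le_one_right' h2

theorem US_card (S : Finset (FP F)) :
    (sq (US S)).relIndex (US S) = 2 ^ (S.card + Fintype.card (InfinitePlace F)) := by
  classical
  induction S using Finset.induction_on with
  | empty =>
    have hs : sq (US (∅ : Finset (FP F))) = (sq (⊤ : Subgroup (𝓞 F)ˣ)).map (Units.map (algebraMap (𝓞 F) F : 𝓞 F →* F)) := by
      rw [US_empty, sq, sq, Subgroup.map_map, Subgroup.map_map]
      congr 1
    rw [hs, US_empty, Subgroup.relIndex_map_map_of_injective, units_sq_aux]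
    · congr 1
      rw [Units.rank, Finset.card_empty]
      have : 0 < Fintype.card (InfinitePlace F) := Fintype.card_pos
      omega
    · exact Units.map_injective (FaithfulSMul.algebraMap_injective (𝓞 F) F)
  | insert v S hv ih =>
    have := US_step S v hv
    rw [ih] at this
    rw [Finset.card_insert_of_notMem hv]
    convert this using 1
    ring
end
end BQ

namespace BQ
open WithZero NumberField IsDedekindDomain

section
variable {F : Type*} [Field F] [NumberField F]

theorem int_approx (S : Finset (FP F)) (x : FP F → 𝓞 F) (n : ℕ) :
    ∃ y : 𝓞 F, ∀ v ∈ S, v.valuation F (algebraMap (𝓞 F) F y - algebraMap (𝓞 F) F (x v)) ≤ exp (-(n : ℤ)) := by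
  obtain ⟨y, hy⟩ := IsDedekindDomain.exists_forall_sub_mem_ideal (s := S)
    (fun v : FP F => v.asIdeal) (fun _ => n) (fun v _ => v.prime)
    (fun v _ w _ h h' => h (HeightOneSpectrum.ext h')) (fun v => x v.1)
  refine ⟨y, fun v hv => ?_⟩
  rw [← map_sub, v.valuation_of_algebraMap, v.intValuation_le_pow_iff_mem]
  exact hy v hv

theorem exists_exp_lt {γ : ℤᵐ⁰} (hγ : 0 < γ) : ∃ n : ℕ, exp (-(n : ℤ)) < γ := by
  refine ⟨(1 - log γ).toNat, ?_⟩
  rw [← lt_log_iff_exp_lt hγ.ne']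
  omega

end

/-- quadratic extension data -/
structure Quad (F E : Type*) [Field F] [Field E] [Algebra F E] where
  a : Fˣ
  θ : E
  σ : E ≃ₐ[F] E
  hθ : θ ^ 2 = algebraMap F E a
  hσ : σ θ = -θ
  span : ∀ z : E, ∃ p q : F, z = algebraMap F E p + algebraMap F E q * θ
  nsq : ∀ x : F, x ^ 2 ≠ a

universe u
theorem adjoin_span {F : Type u} [Field F] (f : Polynomial F) (hmon : f.Monic) (h2 : f.natDegree = 2)
    (z : AdjoinRoot f) :
    ∃ p q : F, z = algebraMap F (AdjoinRoot f) p + algebraMap F (AdjoinRoot f) q * AdjoinRoot.root f := by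
  obtain ⟨p, rfl⟩ := AdjoinRoot.mk_surjective z
  obtain ⟨r, hr, hd⟩ : ∃ r, AdjoinRoot.mk f p = AdjoinRoot.mk f r ∧ r.natDegree < 2 := by
    refine ⟨p %ₘ f, ?_, ?_⟩
    · rw [AdjoinRoot.mk_eq_mk]
      refine ⟨p /ₘ f, ?_⟩
      have := Polynomial.modByMonic_add_div p f
      rw [sub_eq_iff_eq_add, add_comm]; exact this.symm
    · rw [← h2]
      apply Polynomial.natDegree_modByMonic_lt _ hmon
      intro h; rw [h] at h2; simp at h2
  refine ⟨r.coeff 0, r.coeff 1, ?_⟩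
  rw [hr]
  have hr2 := Polynomial.eq_X_add_C_of_natDegree_le_one (Nat.lt_succ_iff.1 hd)
  have := congrArg (AdjoinRoot.mk f) hr2
  rw [this, map_add, map_mul, AdjoinRoot.mk_C, AdjoinRoot.mk_C, AdjoinRoot.mk_X, add_comm]
  rfl

theorem exists_quad {F : Type u} [Field F] [NumberField F] (a : Fˣ) (ha : ∀ x : F, x ^ 2 ≠ a) :
    ∃ (E : Type u) (_ : Field E) (_ : NumberField E) (_ : Algebra F E) (Q : Quad F E), Q.a = a := by
  have hirr : Irreducible (Polynomial.X ^ 2 - Polynomial.C (a : F)) := by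
    apply X_pow_sub_C_irreducible_of_prime Nat.prime_two
    intro b hb; exact ha b hb
  have hmon : (Polynomial.X ^ 2 - Polynomial.C (a : F)).Monic := Polynomial.monic_X_pow_sub_C _ two_ne_zero
  have : Fact (Irreducible (Polynomial.X ^ 2 - Polynomial.C (a : F))) := ⟨hirr⟩
  have : FiniteDimensional F (AdjoinRoot (Polynomial.X ^ 2 - Polynomial.C (a : F))) :=
    hmon.finite_adjoinRoot
  have : CharZero (AdjoinRoot (Polynomial.X ^ 2 - Polynomial.C (a : F))) :=
    charZero_of_injective_algebraMap (algebraMap F _).injective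
  have : FiniteDimensional ℚ (AdjoinRoot (Polynomial.X ^ 2 - Polynomial.C (a : F))) :=
    FiniteDimensional.trans ℚ F _
  have hroot : (AdjoinRoot.root (Polynomial.X ^ 2 - Polynomial.C (a : F))) ^ 2 = algebraMap F _ (a : F) := by
    have := AdjoinRoot.eval₂_root (Polynomial.X ^ 2 - Polynomial.C (a : F))
    simp only [Polynomial.eval₂_sub, Polynomial.eval₂_pow, Polynomial.eval₂_X, Polynomial.eval₂_C] at this
    exact sub_eq_zero.1 this
  let s : AdjoinRoot (Polynomial.X ^ 2 - Polynomial.C (a : F)) →ₐ[F] AdjoinRoot (Polynomial.X ^ 2 - Polynomial.C (a : F)) :=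
    AdjoinRoot.liftAlgHom _ (Algebra.ofId _ _) (-AdjoinRoot.root _) (by
      rw [Polynomial.eval₂_sub, Polynomial.eval₂_pow, Polynomial.eval₂_X, Polynomial.eval₂_C, neg_sq, hroot]
      exact sub_self _)
  have hs : s (AdjoinRoot.root _) = -AdjoinRoot.root _ := AdjoinRoot.liftAlgHom_root ..
  have hss : ∀ x, s (s x) = x := by
    intro x
    have : (s.comp s) = AlgHom.id F _ := by
      apply AdjoinRoot.algHom_ext
      simp [hs]
    exact DFunLike.congr_fun this x
  refine ⟨AdjoinRoot (Polynomial.X ^ 2 - Polynomial.C (a : F)), inferInstance, ⟨⟩, inferInstance,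
    ⟨a, AdjoinRoot.root _, AlgEquiv.ofAlgHom s s (AlgHom.ext hss) (AlgHom.ext hss), hroot, hs, ?_, ha⟩, rfl⟩
  intro z
  exact adjoin_span _ hmon Polynomial.natDegree_X_pow_sub_C z

namespace Quad
variable {F E : Type*} [Field F] [Field E] [Algebra F E] (Q : Quad F E)

theorem θ_ne : Q.θ ≠ 0 := by
  intro h
  have := Q.hθ
  rw [h] at this
  have h2 : algebraMap F E Q.a = 0 := by rw [← this]; simp
  exact Q.a.ne_zero ((map_eq_zero _).1 h2)

theorem σσ (z : E) : Q.σ (Q.σ z) = z := by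
  obtain ⟨p, q, rfl⟩ := Q.span z
  simp [Q.hσ]

theorem σ_span (p q : F) : Q.σ (algebraMap F E p + algebraMap F E q * Q.θ) = algebraMap F E p - algebraMap F E q * Q.θ := by
  simp [Q.hσ, sub_eq_add_neg]

theorem norm_span (p q : F) : (algebraMap F E p + algebraMap F E q * Q.θ) * Q.σ (algebraMap F E p + algebraMap F E q * Q.θ)
    = algebraMap F E (p ^ 2 - Q.a * q ^ 2) := by
  rw [σ_span, map_sub, map_mul, map_pow, map_pow, ← Q.hθ]; ring

theorem exists_norm (z : E) : ∃ f : F, algebraMap F E f = z * Q.σ z := by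
  obtain ⟨p, q, rfl⟩ := Q.span z
  exact ⟨_, (Q.norm_span p q).symm⟩

/-- norm map on units -/
noncomputable def N0 (z : Eˣ) : Fˣ := Units.mk0 (Q.exists_norm z).choose (by
    intro h
    have h2 := (Q.exists_norm z).choose_spec
    rw [h, map_zero] at h2
    rcases mul_eq_zero.1 h2.symm with h | h
    · exact z.ne_zero h
    · exact z.ne_zero ((map_eq_zero _).1 h))

theorem N0_apply (z : Eˣ) : algebraMap F E (Q.N0 z) = z * Q.σ z := (Q.exists_norm (z : E)).choose_spec

/-- norm map on units -/
noncomputable def N : Eˣ →* Fˣ where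
  toFun := Q.N0
  map_one' := by
    ext; apply (algebraMap F E).injective
    rw [N0_apply]; simp
  map_mul' x y := by
    ext; apply (algebraMap F E).injective
    rw [Units.val_mul, map_mul, N0_apply, N0_apply, N0_apply, Units.val_mul, map_mul]; ring

theorem N_apply (z : Eˣ) : algebraMap F E (Q.N z) = z * Q.σ z := (Q.exists_norm (z : E)).choose_spec

/-- inclusion on units -/
abbrev ι (_ : Quad F E) : Fˣ →* Eˣ := Units.map (algebraMap F E : F →* E)

theorem ι_apply (x : Fˣ) : (Q.ι x : E) = algebraMap F E x := rfl

theorem N_ι (x : Fˣ) : Q.N (Q.ι x) = x ^ 2 := by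
  ext; apply (algebraMap F E).injective
  rw [N_apply]; simp; ring

theorem ι_N (z : Eˣ) : (Q.ι (Q.N z) : E) = z * Q.σ z := Q.N_apply z

/-- σ on units -/
noncomputable abbrev σu : Eˣ →* Eˣ := Units.map (Q.σ : E →* E)

theorem N_σ (z : Eˣ) : Q.N (Q.σu z) = Q.N z := by
  ext; apply (algebraMap F E).injective
  rw [N_apply, N_apply]
  show Q.σ z * Q.σ (Q.σ z) = _
  rw [σσ, mul_comm]

/-- θ as unit -/
noncomputable def θu : Eˣ := Units.mk0 Q.θ Q.θ_ne

theorem θu_sq : Q.θu ^ 2 = Q.ι Q.a := by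
  ext; simp [θu, Q.hθ]

theorem fixed {z : E} (h2 : (2 : F) ≠ 0) (h : Q.σ z = z) : ∃ p : F, z = algebraMap F E p := by
  obtain ⟨p, q, rfl⟩ := Q.span z
  rw [σ_span] at h
  have h3 : algebraMap F E 2 * (algebraMap F E q * Q.θ) = 0 := by rw [map_ofNat]; linear_combination -h
  rcases mul_eq_zero.1 h3 with h | h
  · exact absurd ((map_eq_zero _).1 h) h2
  · exact ⟨p, by rw [h, add_zero]⟩

theorem ι_inj : Function.Injective Q.ι := Units.map_injective (algebraMap F E).injective

/-- squares of E lying in F -/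
theorem sq_of_ι (h2 : (2 : F) ≠ 0) {x : Fˣ} {z : Eˣ} (h : Q.ι x = z ^ 2) :
    ∃ y : Fˣ, (z = Q.ι y ∧ x = y ^ 2) ∨ (z = Q.ι y * Q.θu ∧ x = Q.a * y ^ 2) := by
  have h1 : (Q.σ z - z) * (Q.σ z + z) = 0 := by
    have e := congrArg (Units.val) h
    rw [ι_apply, Units.val_pow_eq_pow_val] at e
    have e2 := congrArg Q.σ e
    rw [AlgEquiv.commutes, map_pow] at e2
    linear_combination e - e2
  rcases mul_eq_zero.1 h1 with h3 | h3
  · obtain ⟨p, hp⟩ := Q.fixed h2 (sub_eq_zero.1 h3)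
    have hp0 : p ≠ 0 := by rintro rfl; rw [map_zero] at hp; exact z.ne_zero hp
    have hz : z = Q.ι (Units.mk0 p hp0) := by ext; exact hp
    refine ⟨Units.mk0 p hp0, Or.inl ⟨hz, ?_⟩⟩
    apply Q.ι_inj
    rw [h, hz, map_pow]
  · have h4 : Q.σ (z / Q.θ) = z / Q.θ := by
      rw [map_div₀, Q.hσ, eq_neg_of_add_eq_zero_left h3, neg_div_neg_eq]
    obtain ⟨p, hp⟩ := Q.fixed h2 h4
    have hθ := Q.θ_ne
    have hp0 : p ≠ 0 := by
      rintro rfl; rw [map_zero, div_eq_zero_iff] at hp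
      rcases hp with h | h
      · exact z.ne_zero h
      · exact hθ h
    have hz : z = Q.ι (Units.mk0 p hp0) * Q.θu := by
      ext
      show (z : E) = algebraMap F E p * Q.θ
      rw [← hp]; field_simp
    refine ⟨Units.mk0 p hp0, Or.inr ⟨hz, ?_⟩⟩
    apply Q.ι_inj
    rw [h, hz, map_mul, map_pow, mul_pow, Q.θu_sq, mul_comm]

/-- Hilbert 90 -/
theorem H90 {h : Eˣ} (hN : Q.N h = 1) : ∃ z : Eˣ, h * Q.σu z = z := by
  have h1 : (h : E) * Q.σ h = 1 := by rw [← N_apply, hN]; simp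
  by_cases hc : (1 : E) + h = 0
  · refine ⟨Q.θu, ?_⟩
    ext
    show (h : E) * Q.σ Q.θ = Q.θ
    rw [Q.hσ, eq_neg_of_add_eq_zero_right hc]; ring
  · refine ⟨Units.mk0 (1 + h) hc, ?_⟩
    ext
    show (h : E) * Q.σ (1 + h) = 1 + h
    rw [map_add, map_one]; linear_combination h1

theorem mul_σ (z : Eˣ) : z * Q.σu z = Q.ι (Q.N z) := by
  ext; exact (Q.ι_N z).symm

/-- the subgroup of norms -/
theorem mem_N_range {x : Fˣ} : x ∈ Q.N.range ↔ ∃ p q : F, (x : F) = p ^ 2 - Q.a * q ^ 2 := by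
  constructor
  · rintro ⟨z, rfl⟩
    obtain ⟨p, q, h⟩ := Q.span z
    refine ⟨p, q, ?_⟩
    apply (algebraMap F E).injective
    rw [N_apply, h, norm_span]
  · rintro ⟨p, q, h⟩
    have hne : algebraMap F E p + algebraMap F E q * Q.θ ≠ 0 := by
      intro h0
      have := Q.norm_span p q
      rw [h0, zero_mul, ← h] at this
      exact x.ne_zero ((map_eq_zero _).1 this.symm)
    refine ⟨Units.mk0 _ hne, ?_⟩
    ext; apply (algebraMap F E).injective
    rw [N_apply, Units.val_mk0, norm_span, h]

theorem rank_two (Q : Quad F E) : Module.finrank F E = 2 := by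
  have : Function.Bijective (fun x : Fin 2 → F => algebraMap F E (x 0) + algebraMap F E (x 1) * Q.θ) := by
    constructor
    · intro x y h
      have h' : algebraMap F E (x 0 - y 0) = algebraMap F E (y 1 - x 1) * Q.θ := by
        rw [map_sub, map_sub]; linear_combination h
      have h1 : x 1 = y 1 := by
        by_contra hne
        have hd : y 1 - x 1 ≠ 0 := sub_ne_zero.2 (Ne.symm hne)
        apply Q.nsq ((x 0 - y 0) / (y 1 - x 1))
        apply (algebraMap F E).injective
        rw [← Q.hθ, map_pow, map_div₀, h', mul_div_cancel_left₀ _ (fun h => hd ((map_eq_zero _).1 h))]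
      have h0 : x 0 = y 0 := by
        rw [h1, sub_self, map_zero, zero_mul] at h'
        exact sub_eq_zero.1 ((map_eq_zero _).1 h')
      ext i; fin_cases i
      · exact h0
      · exact h1
    · intro z
      obtain ⟨p, q, h⟩ := Q.span z
      exact ⟨![p, q], by simp [h]⟩
  let e : (Fin 2 → F) →ₗ[F] E :=
    { toFun := fun x => algebraMap F E (x 0) + algebraMap F E (x 1) * Q.θ
      map_add' := by intro x y; simp; ring
      map_smul' := by intro c x; simp [Algebra.smul_def]; ring }
  have := (LinearEquiv.ofBijective e this).finrank_eq
  rw [← this]; simp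
end Quad

/-- norm form group -/
def NE {F : Type*} [Field F] (a : Fˣ) : Subgroup Fˣ where
  carrier := {x | ∃ p q : F, (x : F) = p ^ 2 - a * q ^ 2}
  one_mem' := ⟨1, 0, by simp⟩
  mul_mem' := by
    rintro x y ⟨p, q, h⟩ ⟨r, s, h'⟩
    refine ⟨p * r + a * q * s, p * s + q * r, ?_⟩
    rw [Units.val_mul, h, h']; ring
  inv_mem' := by
    rintro x ⟨p, q, h⟩
    refine ⟨p * (x : F)⁻¹, q * (x : F)⁻¹, ?_⟩
    have : (x : F) ≠ 0 := x.ne_zero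
    rw [Units.val_inv_eq_inv_val]
    field_simp
    rw [← h]

theorem mem_NE {F : Type*} [Field F] {a x : Fˣ} : x ∈ NE a ↔ ∃ p q : F, (x : F) = p ^ 2 - a * q ^ 2 := Iff.rfl

theorem sq_mem_NE {F : Type*} [Field F] (a x : Fˣ) : x ^ 2 ∈ NE a := ⟨x, 0, by simp⟩

theorem Quad.N_range {F E : Type*} [Field F] [Field E] [Algebra F E] (Q : Quad F E) : Q.N.range = NE Q.a := by
  ext x; exact Q.mem_N_range

theorem neg_mem_NE {F : Type*} [Field F] (a : Fˣ) : -a ∈ NE a := ⟨0, 1, by simp⟩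

end BQ

namespace BQ
open WithZero NumberField IsDedekindDomain

section
variable {F E : Type*} [Field F] [NumberField F] [Field E] [NumberField E] [Algebra F E]

/-- prime below -/
noncomputable def un (F : Type*) {E : Type*} [Field F] [NumberField F] [Field E] [NumberField E] [Algebra F E]
  (P : FP E) : FP F := P.under (𝓞 F)

theorem un_liesOver (P : FP E) : P.asIdeal.LiesOver (un F P).asIdeal := ⟨rfl⟩

/-- ramification index -/
noncomputable def ri (F : Type*) {E : Type*} [Field F] [NumberField F] [Field E] [NumberField E] [Algebra F E]
  (P : FP E) : ℕ := (un F P).asIdeal.ramificationIdx' P.asIdeal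

theorem ri_ne (P : FP E) : ri F P ≠ 0 := by
  have := un_liesOver (F := F) P
  exact Ideal.IsDedekindDomain.ramificationIdx'_ne_zero_of_liesOver _ (un F P).ne_bot

theorem un_val (P : FP E) (x : F) : P.valuation E (algebraMap F E x) = (un F P).valuation F x ^ ri F P := by
  have := un_liesOver (F := F) P
  exact (HeightOneSpectrum.valuation_liesOver (K := F) E (un F P) P x).symm

theorem un_val_eq_one (P : FP E) (x : F) : P.valuation E (algebraMap F E x) = 1 ↔ (un F P).valuation F x = 1 := by
  rw [un_val, pow_eq_one_iff_of_nonneg zero_le (ri_ne P)]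

theorem un_val_lt (P : FP E) (x y : F) : P.valuation E (algebraMap F E x) < P.valuation E (algebraMap F E y) ↔
    (un F P).valuation F x < (un F P).valuation F y := by
  rw [un_val, un_val, pow_lt_pow_iff_left₀ zero_le zero_le (ri_ne P)]

theorem un_val_le (P : FP E) (x y : F) : P.valuation E (algebraMap F E x) ≤ P.valuation E (algebraMap F E y) ↔
    (un F P).valuation F x ≤ (un F P).valuation F y := by
  rw [un_val, un_val, pow_le_pow_iff_left₀ zero_le zero_le (ri_ne P)]

theorem un_surj (v : FP F) : ∃ P : FP E, un F P = v := by
  have := v.isPrime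
  obtain ⟨P, hP, h⟩ := Ideal.exists_ideal_over_prime_of_isIntegral_of_isDomain (S := 𝓞 E) v.asIdeal (by
    rw [(RingHom.injective_iff_ker_eq_bot _).1 (FaithfulSMul.algebraMap_injective (𝓞 F) (𝓞 E))]; exact bot_le)
  refine ⟨⟨P, hP, ?_⟩, HeightOneSpectrum.ext h⟩
  rintro rfl
  apply v.ne_bot
  rw [← h]
  exact Ideal.comap_bot_of_injective _ (FaithfulSMul.algebraMap_injective (𝓞 F) (𝓞 E))

theorem un_fin (v : FP F) : {P : FP E | un F P = v}.Finite := by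
  have hne : v.asIdeal.map (algebraMap (𝓞 F) (𝓞 E)) ≠ 0 := by
    intro h
    have := (Ideal.map_eq_bot_iff_of_injective (FaithfulSMul.algebraMap_injective (𝓞 F) (𝓞 E))).1 h
    exact v.ne_bot this
  refine (Ideal.finite_factors hne).subset ?_
  rintro P rfl
  show P.asIdeal ∣ _
  rw [Ideal.dvd_iff_le]
  exact Ideal.map_le_iff_le_comap.2 le_rfl

theorem val_ext {P P' : FP F} (h : ∀ z : 𝓞 F, P.valuation F (algebraMap (𝓞 F) F z) < 1 → P'.valuation F (algebraMap (𝓞 F) F z) < 1) : P = P' := by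
  apply Eq.symm
  apply asIdeal_dvd
  rw [Ideal.dvd_iff_le]
  intro z hz
  rw [← P'.valuation_lt_one_iff_mem (K := F)]
  exact h z ((P.valuation_lt_one_iff_mem (K := F) z).2 hz)

theorem exists_conj (s : E ≃+* E) (P : FP E) : ∃ P' : FP E, ∀ z, P'.valuation E z = P.valuation E (s z) := by
  let e := RingOfIntegers.mapRingEquiv s
  let P' : FP E := HeightOneSpectrum.comap e.toRingHom e.surjective P
  have hpow : ∀ n (r : 𝓞 E), r ∈ P'.asIdeal ^ n ↔ e r ∈ P.asIdeal ^ n := by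
    intro n r
    have h1 : P'.asIdeal = P.asIdeal.map e.symm := (Ideal.map_symm e).symm
    rw [h1, ← Ideal.map_pow]
    rw [Ideal.map_symm]; rfl
  have hiv : ∀ r : 𝓞 E, P'.intValuation r = P.intValuation (e r) := by
    intro r
    by_cases hr : r = 0
    · simp [hr]
    have hn : ∀ n : ℕ, P'.intValuation r ≤ exp (-(n : ℤ)) ↔ P.intValuation (e r) ≤ exp (-(n : ℤ)) := by
      intro n
      rw [P'.intValuation_le_pow_iff_mem, P.intValuation_le_pow_iff_mem, hpow]
    have her : e r ≠ 0 := by simpa using hr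
    apply le_antisymm
    · have := (hn _).2 (P.intValuation_if_neg her).le
      rw [P.intValuation_if_neg her]; exact this
    · have := (hn _).1 (P'.intValuation_if_neg hr).le
      rw [P'.intValuation_if_neg hr]; exact this
  refine ⟨P', fun z => ?_⟩
  obtain ⟨x, y, hy, rfl⟩ := IsFractionRing.div_surjective (A := 𝓞 E) z
  rw [map_div₀, map_div₀, map_div₀, P'.valuation_of_algebraMap, P'.valuation_of_algebraMap, hiv, hiv,
    ← P.valuation_of_algebraMap (K := E), ← P.valuation_of_algebraMap (K := E)]
  rfl

namespace Quad
variable (Q : Quad F E)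

/-- conjugate prime -/
noncomputable def cj (P : FP E) : FP E := (exists_conj (Q.σ : E ≃+* E) P).choose

theorem cj_val (P : FP E) (z : E) : (Q.cj P).valuation E z = P.valuation E (Q.σ z) :=
  (exists_conj (Q.σ : E ≃+* E) P).choose_spec z

theorem un_cj (P : FP E) : un F (Q.cj P) = un F P := by
  apply val_ext
  intro z hz
  have h1 : (Q.cj P).valuation E (algebraMap F E (algebraMap (𝓞 F) F z)) < 1 := by
    rw [un_val]; exact pow_lt_one₀ zero_le hz (ri_ne _)
  rw [cj_val, AlgEquiv.commutes, un_val] at h1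
  by_contra h
  rw [not_lt] at h
  exact absurd h1 (not_lt.2 (one_le_pow₀ h))

/-- if `a` is a local square, then primes above are not fixed -/
theorem cj_ne {P : FP E} (h : Q.a ∈ L (.inl (un F P))) : Q.cj P ≠ P := by
  intro hc
  have hv : ∀ z, P.valuation E (Q.σ z) = P.valuation E z := by intro z; rw [← cj_val, hc]
  have hpos : 0 < (un F P).valuation F (4 * Q.a) := by
    rw [zero_lt_iff]; simp
  obtain ⟨y, hy, -⟩ := newton' _ two_ne_zero h hpos
  have h1 := hv (Q.θ - algebraMap F E y)
  rw [map_sub, Q.hσ, AlgEquiv.commutes] at h1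
  have h2 : P.valuation E (algebraMap F E (y ^ 2 - Q.a)) = P.valuation E (Q.θ - algebraMap F E y) ^ 2 := by
    have : algebraMap F E (y ^ 2 - Q.a) = (-Q.θ - algebraMap F E y) * (Q.θ - algebraMap F E y) := by
      rw [map_sub, map_pow, ← Q.hθ]; ring
    rw [this, map_mul, h1, pow_two]
  have h3 := (un_val_lt P _ _).2 hy
  rw [h2] at h3
  have h4 : P.valuation E (2 * Q.θ) ≤ P.valuation E (Q.θ - algebraMap F E y) := by
    have : 2 * Q.θ = (Q.θ - algebraMap F E y) - (-Q.θ - algebraMap F E y) := by ring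
    rw [this]
    refine (Valuation.map_sub _ _ _).trans ?_
    rw [h1, max_self]
  have h5 : P.valuation E (algebraMap F E (4 * Q.a)) = P.valuation E (2 * Q.θ) ^ 2 := by
    rw [← map_pow, map_mul, ← Q.hθ]; congr 1; rw [map_ofNat]; ring
  rw [h5] at h3
  exact absurd h3 (not_lt.2 (pow_le_pow_left₀ zero_le h4 2))

theorem a_mem_of_cj_ne {P : FP E} (h : Q.cj P ≠ P) : Q.a ∈ L (.inl (un F P)) := by
  classical
  have hpos : 0 < P.valuation E 2 := by
    rw [zero_lt_iff]; simp
  obtain ⟨n, hn⟩ := exists_exp_lt hpos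
  obtain ⟨y, hy⟩ := int_approx {P, Q.cj P} (fun R => if R = P then 1 else 0) n
  have h1 := hy P (by simp)
  have h2 := hy (Q.cj P) (by simp)
  rw [if_pos rfl, map_one] at h1
  rw [if_neg h, map_zero, sub_zero, cj_val] at h2
  set t := algebraMap (𝓞 E) E y with ht
  have hfix : Q.σ (t * Q.θ + Q.σ (t * Q.θ)) = t * Q.θ + Q.σ (t * Q.θ) := by
    rw [map_add, σσ, add_comm]
  obtain ⟨x, hx⟩ := Q.fixed two_ne_zero hfix
  have hpθ : 0 < P.valuation E Q.θ := by rw [zero_lt_iff]; simp [Q.θ_ne]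
  have h3 : P.valuation E (algebraMap F E x - Q.θ) < P.valuation E (2 * Q.θ) := by
    have : algebraMap F E x - Q.θ = ((t - 1) - Q.σ t) * Q.θ := by
      rw [← hx, map_mul, Q.hσ]; ring
    rw [this, map_mul, map_mul]
    refine mul_lt_mul_of_pos_right ?_ hpθ
    exact lt_of_le_of_lt ((Valuation.map_sub _ _ _).trans (max_le h1 h2)) hn
  have hx0 : x ≠ 0 := by
    rintro rfl
    rw [map_zero, zero_sub, Valuation.map_neg, map_mul] at h3
    have := v_two_le (P.valuation E)
    exact absurd h3 (not_lt.2 (mul_le_of_le_one_left' this))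
  have h4 : P.valuation E (algebraMap F E x + Q.θ) = P.valuation E (2 * Q.θ) := by
    have : algebraMap F E x + Q.θ = (algebraMap F E x - Q.θ) + 2 * Q.θ := by ring
    rw [this]; exact Valuation.map_add_eq_of_lt_right _ h3
  have h5 : P.valuation E (algebraMap F E (x ^ 2 - Q.a)) < P.valuation E (algebraMap F E (4 * Q.a)) := by
    have e1 : algebraMap F E (x ^ 2 - Q.a) = (algebraMap F E x - Q.θ) * (algebraMap F E x + Q.θ) := by
      rw [map_sub, map_pow, ← Q.hθ]; ring
    have e2 : algebraMap F E (4 * Q.a) = (2 * Q.θ) * (2 * Q.θ) := by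
      rw [map_mul, map_ofNat, ← Q.hθ]; ring
    rw [e1, e2, map_mul, map_mul _ (2 * Q.θ) (2 * Q.θ), h4]
    refine mul_lt_mul_of_pos_right h3 ?_
    rw [zero_lt_iff]; simp [Q.θ_ne]
  rw [un_val_lt, map_mul] at h5
  have h6 := mem_LL_of_close (un F P |>.valuation F) two_ne_zero (x := Units.mk0 x hx0 ^ 2) (y := Q.a) (by simpa using h5)
  have h7 := (L (.inl (un F P))).div_mem (sq_mem_L (.inl (un F P)) (Units.mk0 x hx0)) h6
  simpa using h7

theorem cj_eq {P : FP E} (h : Q.a ∉ L (.inl (un F P))) : Q.cj P = P := by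
  by_contra hc
  exact h (Q.a_mem_of_cj_ne hc)

/-- uniqueness of the prime above a nonsplit prime -/
theorem unique_above {P P' : FP E} (h : Q.a ∉ L (.inl (un F P))) (hP : un F P' = un F P) : P' = P := by
  classical
  by_contra hne
  obtain ⟨y, hy⟩ := int_approx {P, P'} (fun R => if R = P then 0 else 1) 1
  have h1 := hy P (by simp)
  have h2 := hy P' (by simp)
  rw [if_pos rfl, map_zero, sub_zero] at h1
  rw [if_neg hne, map_one] at h2
  have hlt : exp (-((1 : ℕ) : ℤ)) < (1 : ℤᵐ⁰) := by rw [← exp_zero, exp_lt_exp]; norm_num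
  have h2' := v_eq_one_of (P'.valuation E) le_rfl (h2.trans_lt hlt)
  have h1' := h1.trans_lt hlt
  set t := algebraMap (𝓞 E) E y with ht
  obtain ⟨f, hf⟩ := Q.exists_norm t
  have hcj := Q.cj_eq h
  have hcj' := Q.cj_eq (P := P') (by rw [hP]; exact h)
  have h3 : P.valuation E (algebraMap F E f) < 1 := by
    rw [hf, map_mul, ← cj_val, hcj]; exact mul_lt_one' h1' h1'
  have h4 : P'.valuation E (algebraMap F E f) = 1 := by
    rw [hf, map_mul, ← cj_val, hcj', h2', one_mul]
  rw [un_val_eq_one, hP, ← un_val_eq_one (E := E)] at h4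
  exact h3.ne h4

theorem qe_eq {P : FP E} (h : Q.a ∉ L (.inl (un F P))) :
    qq (P.valuation E) ^ ee P = (qq ((un F P).valuation F) ^ ee (un F P)) ^ 2 := by
  have hL := un_liesOver (F := F) P
  have hmax : (un F P).asIdeal.IsMaximal := (un F P).isMaximal
  have hPp : P.asIdeal.IsPrime := P.isPrime
  have h1 := Ideal.absNorm_eq_pow_inertiaDeg'_of_liesOver P.asIdeal (un F P).asIdeal (un F P).isPrime (un F P).ne_bot
  rw [qq_eq, qq_eq, h1]
  have h2 : ee P = ee (un F P) * ri F P := by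
    have := un_val (F := F) P 2
    rw [map_ofNat, v_two, v_two, ← exp_nsmul, exp_inj] at this
    have h3 : ((ee P : ℕ) : ℤ) = ((ee (un F P) * ri F P : ℕ) : ℤ) := by
      push_cast
      rw [nsmul_eq_mul] at this
      linarith
    exact_mod_cast h3
  have h3 : ri F P * (un F P).asIdeal.inertiaDeg' P.asIdeal = 2 := by
    have h4 := Ideal.sum_ramification_inertia (𝓞 E) F E (un F P).ne_bot
    have h5 : IsDedekindDomain.primesOverFinset (un F P).asIdeal (𝓞 E) = {P.asIdeal} := by
      ext R
      rw [IsDedekindDomain.mem_primesOverFinset_iff (un F P).ne_bot, Finset.mem_singleton]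
      constructor
      · rintro ⟨hR1, hR2⟩
        have hR0 : R ≠ ⊥ := Ideal.ne_bot_of_mem_primesOver (un F P).ne_bot ⟨hR1, hR2⟩
        have := Q.unique_above (P' := ⟨R, hR1, hR0⟩) h (HeightOneSpectrum.ext hR2.over.symm)
        exact congrArg HeightOneSpectrum.asIdeal this
      · rintro rfl
        exact ⟨P.isPrime, hL⟩
    rw [h5, Finset.sum_singleton, Q.rank_two] at h4
    exact h4
  rw [h2, ← pow_mul, ← pow_mul, ← h3]
  congr 1; ring

end Quad
end
end BQ

namespace BQ
open WithZero NumberField IsDedekindDomain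

section
variable {F E : Type*} [Field F] [NumberField F] [Field E] [NumberField E] [Algebra F E]

/-- local norm group -/
noncomputable def Nloc (a : Fˣ) (v : Pl F) : Subgroup Fˣ := NE a ⊔ L v

theorem L_le_Nloc (a : Fˣ) (v : Pl F) : L v ≤ Nloc a v := le_sup_right
theorem NE_le_Nloc (a : Fˣ) (v : Pl F) : NE a ≤ Nloc a v := le_sup_left

theorem L_up (P : FP E) {x : Fˣ} (h : x ∈ L (.inl (un F P))) :
    Units.map (algebraMap F E : F →* E) x ∈ L (.inl P) := by
  obtain ⟨y, hy⟩ := h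
  refine ⟨Units.map (algebraMap F E : F →* E) y, ?_⟩
  have := (un_val_lt P _ _).2 hy
  rw [map_ofNat] at this
  simpa using this

theorem loc_aux {K : Type*} [Field K] (v : Valuation K ℤᵐ⁰) (h2 : (2 : K) ≠ 0) {b s t : K} (hb : b ≠ 0)
    (h1 : v ((s + t) ^ 2 - b) < v (16 * b)) (hw : v (s + t) ^ 2 = v b) (hst : v (4 * (s * t)) < v (16 * b))
    (hle : v t ≤ v s) : v (s ^ 2 - b) < v (4 * b) := by
  have h16 : v (16 * b) ≤ v (4 * b) := by
    have : (16 : K) * b = 4 * (4 * b) := by ring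
    rw [this, map_mul v 4 (4 * b)]; exact mul_le_of_le_one_left' (v_four_le v)
  have hp4 := v_four_pos v h2
  have hp2 := v_two_pos v h2
  have hs : v (s + t) ≤ v s := (v.map_add _ _).trans (max_le le_rfl hle)
  have hwpos : 0 < v (s + t) := by
    rw [zero_lt_iff]; intro h; rw [h] at hw; rw [zero_pow two_ne_zero] at hw; exact hb ((map_eq_zero v).1 hw.symm)
  have ht : v (4 * t) * v (s + t) < v (16 * b) := by
    refine lt_of_le_of_lt ?_ hst
    calc v (4 * t) * v (s + t) ≤ v (4 * t) * v s := mul_le_mul_right hs _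
      _ = _ := by rw [← map_mul]; congr 1; ring
  have e : s ^ 2 - b = ((s + t) ^ 2 - b) - 2 * (t * (s + t)) + t ^ 2 := by ring
  have c1 : v (2 * (t * (s + t))) < v (4 * b) := by
    have : v (4 * t) * v (s + t) = v 2 * v (2 * (t * (s + t))) := by
      rw [← map_mul, ← map_mul]; congr 1; ring
    rw [this] at ht
    have h3 : v (16 * b) ≤ v 2 * v (4 * b) := by
      have : (16 : K) * b = 2 * (2 * (4 * b)) := by ring
      rw [this, map_mul v 2 (2 * _)]
      refine mul_le_mul_right ?_ _
      rw [map_mul v 2]; exact mul_le_of_le_one_left' (v_two_le v)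
    exact lt_of_mul_lt_mul_left' (ht.trans_le h3)
  have c2 : v (t ^ 2) < v (4 * b) := by
    have h3 : v (4 * t) ^ 2 * v b < v (16 * b) ^ 2 := by
      rw [← hw, ← mul_pow]
      exact pow_lt_pow_left₀ ht zero_le two_ne_zero
    have h4 : v (4 * t) ^ 2 * v b = v (16 * b) * v (t ^ 2) := by
      rw [← map_pow, ← map_mul, ← map_mul]; congr 1; ring
    rw [h4, pow_two (v (16 * b))] at h3
    exact (lt_of_mul_lt_mul_left' h3).trans_le h16
  rw [e]
  exact v.map_add_lt (v.map_sub_lt (h1.trans_le h16) c1) c2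

theorem ne_of_close {K : Type*} [Field K] (v : Valuation K ℤᵐ⁰) {x b : K} (h : v (x - b) < v (4 * b)) : x ≠ 0 := by
  rintro rfl
  rw [zero_sub, Valuation.map_neg, map_mul] at h
  exact absurd h (not_lt.2 (mul_le_of_le_one_left' (v_four_le v)))

namespace Quad
variable (Q : Quad F E)

theorem loc_h2 {P : FP E} (h : Q.a ∉ L (.inl (un F P))) : L (.inl P) ≤ (L (.inl (un F P))).comap Q.N := by
  have hv : ∀ z, P.valuation E (Q.σ z) = P.valuation E z := by intro z; rw [← cj_val, Q.cj_eq h]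
  rintro z ⟨y, hy⟩
  refine ⟨Q.N y, ?_⟩
  have e : (Q.N z : F) * (Q.N y : F) ^ 2 - 1 = ((Q.N (z * y ^ 2) : Fˣ) : F) - 1 := by simp
  rw [e, ← un_val_lt P, map_sub, Q.N_apply, map_ofNat, map_one]
  refine mul_sub_one_lt _ ?_ ?_ ?_
  · simpa using v_eq_one_of _ (v_four_le _) hy
  · simpa using hy
  · rw [← map_one Q.σ, ← map_sub, hv]
    simpa using hy

theorem loc_h4a {P : FP E} (h : Q.a ∉ L (.inl (un F P))) {b : Fˣ} (hb : Q.ι b ∈ L (.inl P)) :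
    b ∈ L (.inl (un F P)) ∨ b * Q.a ∈ L (.inl (un F P)) := by
  have hv : ∀ z, P.valuation E (Q.σ z) = P.valuation E z := by intro z; rw [← cj_val, Q.cj_eq h]
  have hb0 : algebraMap F E b ≠ 0 := by simp
  obtain ⟨w, hw1, hw2⟩ := newton' (P.valuation E) two_ne_zero hb (γ := P.valuation E (16 * algebraMap F E b)) (by
    rw [zero_lt_iff]; simp)
  rw [ι_apply] at hw1 hw2
  obtain ⟨p, q, hpq⟩ := Q.span w
  have hst : P.valuation E (4 * (algebraMap F E p * (algebraMap F E q * Q.θ))) < P.valuation E (16 * algebraMap F E b) := by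
    have e : 4 * (algebraMap F E p * (algebraMap F E q * Q.θ)) = ((w : E) ^ 2 - algebraMap F E b) - Q.σ ((w : E) ^ 2 - algebraMap F E b) := by
      rw [hpq, map_sub, map_pow, σ_span, AlgEquiv.commutes]; ring
    rw [e]
    exact Valuation.map_sub_lt _ hw1 (by rw [hv]; exact hw1)
  rw [hpq] at hw1 hw2
  rcases le_total (P.valuation E (algebraMap F E q * Q.θ)) (P.valuation E (algebraMap F E p)) with hle | hle
  · left
    have := loc_aux (P.valuation E) two_ne_zero hb0 hw1 hw2 hst hle
    have e1 : algebraMap F E p ^ 2 - algebraMap F E b = algebraMap F E (p ^ 2 - b) := by simp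
    have e2 : 4 * algebraMap F E b = algebraMap F E (4 * b) := by rw [map_mul, map_ofNat]
    rw [e1, e2, un_val_lt] at this
    have hp : p ≠ 0 := by rintro rfl; exact ne_of_close _ this (by simp)
    rw [map_mul] at this
    have h6 := mem_LL_of_close (un F P |>.valuation F) two_ne_zero (x := Units.mk0 p hp ^ 2) (y := b) (by simpa using this)
    have h7 := (L (.inl (un F P))).div_mem (sq_mem_L (.inl (un F P)) (Units.mk0 p hp)) h6
    simpa using h7
  · right
    rw [add_comm] at hw1 hw2
    rw [mul_comm (algebraMap F E p)] at hst
    have := loc_aux (P.valuation E) two_ne_zero hb0 hw1 hw2 hst hle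
    have e1 : (algebraMap F E q * Q.θ) ^ 2 - algebraMap F E b = algebraMap F E (Q.a * q ^ 2 - b) := by
      rw [mul_pow, Q.hθ]; simp [mul_comm]
    have e2 : 4 * algebraMap F E b = algebraMap F E (4 * b) := by rw [map_mul, map_ofNat]
    rw [e1, e2, un_val_lt] at this
    have hp : q ≠ 0 := by rintro rfl; exact ne_of_close _ this (by simp)
    rw [map_mul] at this
    have h6 := mem_LL_of_close (un F P |>.valuation F) two_ne_zero (x := Q.a * Units.mk0 q hp ^ 2) (y := b) (by simpa using this)
    have h8 := (L (.inl (un F P))).mul_mem h6 (sq_mem_L (.inl (un F P)) (b * (Units.mk0 q hp)⁻¹))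
    have e3 : b * Q.a = Q.a * Units.mk0 q hp ^ 2 / b * (b * (Units.mk0 q hp)⁻¹) ^ 2 := by
      rw [mul_pow, div_eq_mul_inv, inv_pow, pow_two b]
      generalize Units.mk0 q hp ^ 2 = t
      have : Q.a * t * b⁻¹ * (b * b * t⁻¹) = b * Q.a * (b⁻¹ * b) * (t * t⁻¹) := by
        simp only [mul_assoc, mul_comm, mul_left_comm]
      rw [this]; simp
    rw [e3]; exact h8

theorem loc_h5 {P : FP E} (h : Q.a ∉ L (.inl (un F P))) {z : Eˣ} (hz : Q.N z ∈ L (.inl (un F P))) :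
    ∃ g : Fˣ, ∃ b ∈ L (.inl P), z = Q.ι g * b := by
  have hv : ∀ z, P.valuation E (Q.σ z) = P.valuation E z := by intro z; rw [← cj_val, Q.cj_eq h]
  obtain ⟨y, hy⟩ := newton _ two_ne_zero hz (γ := (un F P).valuation F 16) (by rw [zero_lt_iff]; simp)
  rw [← un_val_lt P, map_ofNat] at hy
  set z' : Eˣ := z * Q.ι y with hz'
  have e : algebraMap F E ((Q.N z : F) * (y : F) ^ 2 - 1) = (z' : E) * Q.σ z' - 1 := by
    rw [← N_apply, hz', map_mul, N_ι]; simp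
  rw [e] at hy
  have h164 : P.valuation E 16 = P.valuation E 4 * P.valuation E 4 := by
    rw [← map_mul]; norm_num
  by_cases hc : P.valuation E (1 + z') < P.valuation E 4
  · refine ⟨- y⁻¹, -z', ?_, ?_⟩
    · refine mem_LL_of_lt _ two_ne_zero ?_
      have : ((-z' : Eˣ) : E) - 1 = - (1 + z') := by push_cast; ring
      rw [this, Valuation.map_neg]; exact hc
    · ext; simp [hz']
  · have hc0 : (1 + z' : E) ≠ 0 := by
      intro h0; apply hc; rw [h0, map_zero]; exact v_four_pos _ two_ne_zero
    rw [not_lt] at hc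
    set c := Units.mk0 _ hc0 with hcdef
    set δ := (z' : E) * Q.σ z' - 1 with hδ
    have hlt : P.valuation E ((c : E) + δ - c) < P.valuation E 4 * P.valuation E c := by
      rw [add_sub_cancel_left]
      refine hy.trans_le ?_
      rw [h164]; exact mul_le_mul_right hc _
    have hne : (c : E) + δ ≠ 0 := by
      apply ne_of_close (P.valuation E) (b := (c : E)); rw [map_mul]; exact hlt
    have hm := mem_LL_of_close (P.valuation E) two_ne_zero (x := Units.mk0 _ hne) (y := c) hlt
    have hm2 := (L (.inl P)).mul_mem (sq_mem_L (.inl P) c) hm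
    refine ⟨(Q.N c)⁻¹ * y⁻¹, _, hm2, ?_⟩
    have k1 : z' * Q.σu c = Units.mk0 _ hne := by
      ext
      show (z' : E) * Q.σ (1 + z') = (1 + z') + δ
      rw [hδ, map_add, map_one]; ring
    rw [← k1, map_mul, map_inv, map_inv, ← mul_σ, hz']
    rw [pow_two, div_eq_mul_inv, mul_inv]
    generalize Q.σu c = d
    generalize Q.ι y = x
    have : c⁻¹ * d⁻¹ * x⁻¹ * (c * c * (z * x * d * c⁻¹)) = z * (c⁻¹ * c) * (d⁻¹ * d) * (x⁻¹ * x) * (c⁻¹ * c) := by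
      simp only [mul_assoc, mul_comm, mul_left_comm]
    rw [this]; simp

theorem loc_index {P : FP E} (h : Q.a ∉ L (.inl (un F P))) : (Nloc Q.a (.inl (un F P))).index = 2 := by
  have h4 : (L (.inl (un F P))).relIndex ((L (.inl P)).comap Q.ι) = 2 := by
    rw [Subgroup.relIndex_eq_two_iff]
    refine ⟨Q.a, ?_, ?_⟩
    · rw [Subgroup.mem_comap, ← θu_sq]; exact sq_mem_L _ _
    · intro b hb
      rcases Q.loc_h4a h hb with hb | hb
      · right; exact ⟨hb, fun h' => h ((Subgroup.mul_mem_cancel_left _ hb).1 h')⟩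
      · left; exact ⟨hb, fun h' => h ((Subgroup.mul_mem_cancel_left _ h').1 hb)⟩
  have key := norm_index (L (.inl (un F P))) (L (.inl P)) Q.ι Q.N (fun x hx => L_up P hx) (Q.loc_h2 h)
    (fun g => by rw [N_ι]; exact sq_mem_L _ _) h4 (fun z hz => Q.loc_h5 h hz)
  rw [Q.N_range, L_index, L_index, Q.qe_eq h] at key
  show (NE Q.a ⊔ L (.inl (un F P))).index = 2
  have hq : qq ((un F P).valuation F) ^ ee (un F P) ≠ 0 := pow_ne_zero _ (qq_ne _)
  generalize qq ((un F P).valuation F) ^ ee (un F P) = m at *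
  have : (NE Q.a ⊔ L (.inl (un F P))).index * (8 * m ^ 2) = 2 * (8 * m ^ 2) := by
    rw [← mul_assoc] at key ⊢; linarith
  exact Nat.eq_of_mul_eq_mul_right (by positivity) this

end Quad

theorem nsq_of_not_mem {a : Fˣ} {v : Pl F} (h : a ∉ L v) (x : F) : x ^ 2 ≠ a := by
  intro hx
  have h0 : x ≠ 0 := by rintro rfl; rw [zero_pow two_ne_zero] at hx; exact a.ne_zero hx.symm
  apply h
  have : a = Units.mk0 x h0 ^ 2 := by ext; simp [hx]
  rw [this]; exact sq_mem_L _ _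

theorem Nloc_index {a : Fˣ} {v : Pl F} (h : a ∉ L v) : (Nloc a v).index = 2 := by
  rcases v with v | s
  · obtain ⟨E, _, _, _, Q, rfl⟩ := exists_quad a (nsq_of_not_mem h)
    obtain ⟨P, rfl⟩ := un_surj (E := E) v
    exact Q.loc_index h
  · have : NE a ≤ L (.inr s) := by
      rintro x ⟨p, q, hx⟩
      rw [mem_L_inr] at h ⊢
      have hx0 : s x ≠ 0 := by simp
      rw [hx, map_sub, map_mul, map_pow, map_pow] at *
      rw [not_lt] at h
      have : 0 ≤ (s p) ^ 2 - s a * (s q) ^ 2 := by nlinarith [sq_nonneg (s p), sq_nonneg (s q)]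
      exact lt_of_le_of_ne this (Ne.symm hx0)
    rw [Nloc, sup_eq_right.2 this, posR_index]

theorem Nloc_top {a : Fˣ} {v : Pl F} (h : a ∈ L v) : Nloc a v = ⊤ := by
  rw [eq_top_iff]
  intro x _
  rcases v with v | s
  · set w := v.valuation F with hw
    by_cases hx1 : (x : F) = 1
    · have : x = 1 := by ext; exact hx1
      rw [this]; exact one_mem _
    have hx1' : (x : F) - 1 ≠ 0 := sub_ne_zero.2 hx1
    obtain ⟨y, hy⟩ := newton _ two_ne_zero h (γ := w (4 * x / (((x - 1) / 2) ^ 2))) (by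
      rw [zero_lt_iff]; simp [hx1'])
    set u : F := ((x + 1) / 2) ^ 2 - a * (y * ((x - 1) / 2)) ^ 2 with hu
    have e : u - x = - (((a : F) * y ^ 2 - 1) * ((x - 1) / 2) ^ 2) := by rw [hu]; ring
    have hc : w (u - x) < w (4 * x) := by
      rw [e, Valuation.map_neg, map_mul]
      rwa [map_div₀, lt_div_iff₀ (by rw [zero_lt_iff]; simp [hx1'])] at hy
    have hu0 := ne_of_close w hc
    rw [map_mul] at hc
    have h1 := mem_LL_of_close w two_ne_zero (x := Units.mk0 u hu0) (y := x) hc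
    have h2 : Units.mk0 u hu0 ∈ NE a := ⟨_, _, hu⟩
    have h3 := (Nloc a (.inl v)).div_mem (NE_le_Nloc a (.inl v) h2) (L_le_Nloc a (.inl v) h1)
    simpa using h3
  · by_cases hx : x ∈ L (.inr s)
    · exact L_le_Nloc _ _ hx
    · have h1 : x / -a ∈ L (.inr s) := by
        rw [mem_L_inr] at h hx ⊢
        have hx0 : s x ≠ 0 := by simp
        have : s x < 0 := lt_of_le_of_ne (not_lt.1 hx) hx0
        push_cast
        rw [map_div₀, map_neg]
        exact div_pos_of_neg_of_neg this (by linarith)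
      have := (Nloc a (.inr s)).mul_mem (L_le_Nloc a _ h1) (NE_le_Nloc a _ (neg_mem_NE a))
      rwa [div_mul_cancel] at this

theorem Nloc_unit {a b : Fˣ} {v : FP F} (h2 : v.valuation F 2 = 1) (ha : v.valuation F a = 1) (hb : v.valuation F b = 1) :
    b ∈ Nloc a (.inl v) := by
  have hmax := v.isMaximal
  letI : Field (𝓞 F ⧸ v.asIdeal) := Ideal.Quotient.field _
  haveI : Finite (𝓞 F ⧸ v.asIdeal) := Ideal.finiteQuotientOfFreeOfNeBot _ v.ne_bot
  letI : Fintype (𝓞 F ⧸ v.asIdeal) := Fintype.ofFinite _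
  have red : ∀ x : F, v.valuation F x = 1 → ∃ y : 𝓞 F, v.valuation F (algebraMap _ F y - x) < 1 := by
    intro x hx
    obtain ⟨y, hy⟩ := v.exists_valuation_sub_lt_of_integer (K := F) hx.le 1
    exact ⟨y, by simpa using hy⟩
  obtain ⟨a0, ha0⟩ := red a ha
  obtain ⟨b0, hb0⟩ := red b hb
  have hchar : ringChar (𝓞 F ⧸ v.asIdeal) ≠ 2 := by
    intro hc
    have : ((2 : ℕ) : 𝓞 F ⧸ v.asIdeal) = 0 := by rw [ringChar.spec, hc]
    have h3 : (2 : 𝓞 F) ∈ v.asIdeal := by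
      rw [← Ideal.Quotient.eq_zero_iff_mem, map_ofNat]; simpa using this
    rw [← v.valuation_lt_one_iff_mem (K := F)] at h3
    change v.valuation F (algebraMap (𝓞 F) F 2) < 1 at h3
    rw [map_ofNat, h2] at h3
    exact lt_irrefl _ h3
  have a0ne : (Ideal.Quotient.mk v.asIdeal a0) ≠ 0 := by
    rw [Ne, Ideal.Quotient.eq_zero_iff_mem, ← v.valuation_lt_one_iff_mem (K := F)]
    have : v.valuation F (algebraMap _ F a0) = 1 := by
      rw [← ha, ← sub_add_cancel (algebraMap _ F a0) (a : F)]
      exact Valuation.map_add_eq_of_lt_right _ (by rw [ha]; exact ha0)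
    rw [this]; exact lt_irrefl _
  obtain ⟨p, q, hpq⟩ := FiniteField.exists_root_sum_quadratic
    (f := Polynomial.X ^ 2 - Polynomial.C (Ideal.Quotient.mk v.asIdeal b0))
    (g := Polynomial.C (-Ideal.Quotient.mk v.asIdeal a0) * Polynomial.X ^ 2) (by
      rw [Polynomial.degree_X_pow_sub_C (by norm_num)]; rfl) (by
      rw [Polynomial.degree_C_mul_X_pow _ (neg_ne_zero.2 a0ne)]; rfl) (FiniteField.odd_card_of_char_ne_two hchar)
  obtain ⟨p, rfl⟩ := Ideal.Quotient.mk_surjective p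
  obtain ⟨q, rfl⟩ := Ideal.Quotient.mk_surjective q
  have hm : p ^ 2 - b0 - a0 * q ^ 2 ∈ v.asIdeal := by
    rw [← Ideal.Quotient.eq_zero_iff_mem]
    simp at hpq
    simp only [map_sub, map_mul, map_pow]
    linear_combination hpq
  rw [← v.valuation_lt_one_iff_mem (K := F)] at hm
  set P := algebraMap _ F p
  set R := algebraMap _ F q with hR
  set u : F := P ^ 2 - a * R ^ 2 with hu
  have hR1 : v.valuation F R ≤ 1 := v.valuation_le_one q
  have hc : v.valuation F (u - b) < 1 := by
    have e : u - b = (algebraMap _ F (p ^ 2 - b0 - a0 * q ^ 2) + (algebraMap _ F a0 - a) * (R ^ 2)) + (algebraMap _ F b0 - b) := by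
      rw [hu]; simp only [map_sub, map_mul, map_pow]; ring
    rw [e]
    refine Valuation.map_add_lt _ (Valuation.map_add_lt _ hm ?_) hb0
    rw [map_mul, map_pow]
    exact (mul_le_of_le_one_right' (pow_le_one₀ zero_le hR1)).trans_lt ha0
  have h41 : v.valuation F 4 = 1 := by rw [v_four, h2, one_mul]
  have hc' : v.valuation F (u - b) < v.valuation F (4 * b) := by rw [map_mul, h41, hb, one_mul]; exact hc
  have hu0 := ne_of_close _ hc'
  rw [map_mul] at hc'
  have h1 := mem_LL_of_close _ two_ne_zero (x := Units.mk0 u hu0) (y := b) hc'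
  have h2 : Units.mk0 u hu0 ∈ NE a := ⟨_, _, hu⟩
  have h3 := (Nloc a (.inl v)).div_mem (NE_le_Nloc a (.inl v) h2) (L_le_Nloc a (.inl v) h1)
  simpa using h3

end
end BQ

namespace BQ
open WithZero NumberField IsDedekindDomain

section
variable {F E : Type*} [Field F] [NumberField F] [Field E] [NumberField E] [Algebra F E]

open Classical in
theorem CG.exists_of_fin {S : Finset (FP F)} (hS : CG S) (m : FP F → ℤ) (T : Finset (FP F)) :
    ∃ f : Fˣ, ∀ v, v ∉ S → v.valuation F (f : F) = exp (if v ∈ T then m v else 0) := by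
  induction T using Finset.induction_on with
  | empty => exact ⟨1, fun v _ => by simp⟩
  | insert w T hw ih =>
    obtain ⟨f, hf⟩ := ih
    by_cases hwS : w ∈ S
    · refine ⟨f, fun v hv => ?_⟩
      rw [hf v hv]
      have : v ≠ w := fun h => hv (h ▸ hwS)
      simp [this]
    · obtain ⟨g, hg1, hg2⟩ := hS w hwS
      refine ⟨f * g ^ (- m w), fun v hv => ?_⟩
      rw [Units.val_mul, map_mul, hf v hv, Units.val_zpow_eq_zpow_val, map_zpow₀]
      by_cases h : v = w
      · subst h
        rw [if_neg hw, hg1, ← exp_zsmul]; simp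
      · rw [hg2 v hv h]; simp [h]

theorem finite_supp' {p : F} (hp : p ≠ 0) : {v : FP F | v.valuation F p ≠ 1}.Finite := by
  simpa using finite_supp (Units.mk0 p hp)

theorem CG.exists_max {S : Finset (FP F)} (hS : CG S) {p q : F} (h : p ≠ 0 ∨ q ≠ 0) :
    ∃ f : Fˣ, ∀ v, v ∉ S → v.valuation F (f : F) = max (v.valuation F p) (v.valuation F q) := by
  classical
  have hfin : {v : FP F | max (v.valuation F p) (v.valuation F q) ≠ 1}.Finite := by
    by_cases hp : p = 0
    · have hq : q ≠ 0 := h.resolve_left (not_not.2 hp)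
      refine (finite_supp' hq).subset ?_
      intro v hv; rw [hp] at hv; simpa using hv
    by_cases hq : q = 0
    · refine (finite_supp' hp).subset ?_
      intro v hv; rw [hq] at hv; simpa using hv
    refine ((finite_supp' hp).union (finite_supp' hq)).subset ?_
    intro v hv
    by_contra hc
    simp only [Set.mem_union, Set.mem_ofPred_eq, not_or, not_not] at hc
    apply hv; simp [hc.1, hc.2]
  obtain ⟨f, hf⟩ := hS.exists_of_fin (fun v => log (max (v.valuation F p) (v.valuation F q))) hfin.toFinset
  refine ⟨f, fun v hv => ?_⟩
  rw [hf v hv]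
  split_ifs with h1
  · have hne : max (v.valuation F p) (v.valuation F q) ≠ 0 := by
      rw [← zero_lt_iff, lt_max_iff, zero_lt_iff, zero_lt_iff]
      simpa using h
    exact exp_log hne
  · simp at h1; rw [h1, exp_zero]

/-- primes above S -/
noncomputable def above (E : Type*) [Field E] [NumberField E] [Algebra F E] (S : Finset (FP F)) : Finset (FP E) :=
  (Set.Finite.biUnion S.finite_toSet (fun v _ => un_fin (E := E) v)).toFinset

theorem mem_above {S : Finset (FP F)} {P : FP E} : P ∈ above E S ↔ un F P ∈ S := by
  simp [above]

theorem US_of_sq {S : Finset (FP F)} {y : Fˣ} (h : y ^ 2 ∈ US S) : y ∈ US S := by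
  intro v hv
  have := h v hv
  rw [Units.val_pow_eq_pow_val, map_pow] at this
  exact (pow_eq_one_iff_of_nonneg zero_le two_ne_zero).1 this

namespace Quad
variable (Q : Quad F E)

theorem coord_unique {p q p' q' : F} (h : algebraMap F E p + algebraMap F E q * Q.θ = algebraMap F E p' + algebraMap F E q' * Q.θ) :
    p = p' ∧ q = q' := by
  have h1 := congrArg Q.σ h
  rw [σ_span, σ_span] at h1
  have e1 : algebraMap F E (2 * p) = algebraMap F E (2 * p') := by
    rw [map_mul, map_mul, map_ofNat]; linear_combination h + h1
  have e2 : algebraMap F E (2 * q) = algebraMap F E (2 * q') := by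
    apply mul_right_cancel₀ Q.θ_ne
    rw [map_mul, map_mul, map_ofNat]; linear_combination h - h1
  exact ⟨mul_left_cancel₀ two_ne_zero ((algebraMap F E).injective e1), mul_left_cancel₀ two_ne_zero ((algebraMap F E).injective e2)⟩

theorem exists_lift {K : Type*} [Field K] (s : F →+* K) (r : K) (hr : r ^ 2 = s Q.a) :
    ∃ t : E →+* K, (∀ x, t (algebraMap F E x) = s x) ∧ t Q.θ = r := by
  choose p q hpq using Q.span
  have key : ∀ z a b, z = algebraMap F E a + algebraMap F E b * Q.θ → s (p z) + s (q z) * r = s a + s b * r := by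
    intro z a b h
    obtain ⟨h1, h2⟩ := Q.coord_unique ((hpq z).symm.trans h)
    rw [h1, h2]
  refine ⟨{ toFun := fun z => s (p z) + s (q z) * r, map_one' := ?_, map_zero' := ?_, map_mul' := ?_, map_add' := ?_ }, ?_, ?_⟩
  · rw [key 1 1 0 (by simp)]; simp
  · intro x y
    rw [key (x * y) (p x * p y + q x * q y * Q.a) (p x * q y + q x * p y) (by
      conv_lhs => rw [hpq x, hpq y]
      simp only [map_add, map_mul]; rw [← Q.hθ]; ring)]
    simp only [map_add, map_mul]; rw [← hr]; ring
  · rw [key 0 0 0 (by simp)]; simp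
  · intro x y
    rw [key (x + y) (p x + p y) (q x + q y) (by
      conv_lhs => rw [hpq x, hpq y]
      simp only [map_add]; ring)]
    simp only [map_add]; ring
  · intro x
    show s (p _) + s (q _) * r = _
    rw [key _ x 0 (by simp)]; simp
  · show s (p _) + s (q _) * r = _
    rw [key _ 0 1 (by simp)]; simp

theorem real_count [Fintype {s : F →+* ℝ // 0 < s Q.a}] :
    2 * Fintype.card {s : F →+* ℝ // 0 < s Q.a} ≤ Fintype.card (E →+* ℝ) := by
  classical
  have h : ∀ (s : {s : F →+* ℝ // 0 < s Q.a}) (b : Bool), ∃ t : E →+* ℝ, (∀ x, t (algebraMap F E x) = s.1 x) ∧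
      t Q.θ = if b then √(s.1 Q.a) else -√(s.1 Q.a) := by
    intro s b
    apply Q.exists_lift
    have := Real.sq_sqrt s.2.le
    split_ifs
    · exact this
    · rw [neg_sq]; exact this
  choose t ht1 ht2 using h
  have : Function.Injective (fun x : {s : F →+* ℝ // 0 < s Q.a} × Bool => t x.1 x.2) := by
    rintro ⟨s, b⟩ ⟨s', b'⟩ h
    simp only at h
    have hs : s = s' := by
      apply Subtype.ext
      ext x
      rw [← ht1 s b, ← ht1 s' b', h]
    subst hs
    have e1 := ht2 s b
    rw [h, ht2] at e1
    have hpos := Real.sqrt_pos.2 s.2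
    refine Prod.ext rfl ?_
    cases b <;> cases b' <;> simp at e1 ⊢ <;> linarith
  have h2 := Fintype.card_le_of_injective _ this
  rw [Fintype.card_prod, Fintype.card_bool] at h2
  linarith

theorem inf_count [Fintype {s : F →+* ℝ // 0 < s Q.a}] [Fintype {s : F →+* ℝ // ¬ 0 < s Q.a}] :
    2 * Fintype.card (InfinitePlace F) ≤ Fintype.card {s : F →+* ℝ // ¬ 0 < s Q.a} + Fintype.card (InfinitePlace E) := by
  classical
  have h1 := InfinitePlace.card_eq_nrRealPlaces_add_nrComplexPlaces F
  have h2 := InfinitePlace.card_eq_nrRealPlaces_add_nrComplexPlaces E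
  have h3 := InfinitePlace.card_add_two_mul_card_eq_rank F
  have h4 := InfinitePlace.card_add_two_mul_card_eq_rank E
  have h5 := Module.finrank_mul_finrank ℚ F E
  rw [Q.rank_two] at h5
  have h6 := Q.real_count
  have h7 := Fintype.card_subtype_compl (fun s : F →+* ℝ => 0 < s Q.a)
  have h7' := Fintype.card_subtype_le (fun s : F →+* ℝ => 0 < s Q.a)
  have h8 := card_real (F := F)
  have h9 := card_real (F := E)
  omega

theorem S_count [DecidablePred fun v : FP F => Q.a ∈ L (.inl v)] (S : Finset (FP F)) :
    S.card + (S.filter fun v => Q.a ∈ L (.inl v)).card ≤ (above E S).card := by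
  classical
  choose f hf using fun v : FP F => un_surj (E := E) v
  have hinj : Function.Injective f := fun v w h => by rw [← hf v, h, hf]
  have hcinj : Function.Injective (fun v => Q.cj (f v)) := fun v w h => by
    have := congrArg (un F) h
    simpa [un_cj, hf] using this
  rw [← Finset.card_image_of_injective S hinj, ← Finset.card_image_of_injective (S.filter _) hcinj,
    ← Finset.card_union_of_disjoint]
  · apply Finset.card_le_card
    intro P hP
    rw [Finset.mem_union, Finset.mem_image, Finset.mem_image] at hP
    rw [mem_above]
    rcases hP with ⟨v, hv, rfl⟩ | ⟨v, hv, rfl⟩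
    · rwa [hf]
    · rw [un_cj, hf]; exact (Finset.mem_filter.1 hv).1
  · rw [Finset.disjoint_left]
    intro P hP hP'
    obtain ⟨v, hv, rfl⟩ := Finset.mem_image.1 hP
    obtain ⟨w, hw, h⟩ := Finset.mem_image.1 hP'
    have h1 := congrArg (un F) h
    rw [un_cj, hf, hf] at h1
    subst h1
    refine Q.cj_ne ?_ h
    rw [hf]; exact (Finset.mem_filter.1 hw).2

theorem glob_index (S : Finset (FP F)) (h2 : ∀ v ∉ S, v.valuation F 2 = 1) (ha : Q.a ∈ US S) (hS : CG S) :
    ∃ d, d * 2 ^ ((above E S).card + Fintype.card (InfinitePlace E)) * 2 = (2 ^ (S.card + Fintype.card (InfinitePlace F))) ^ 2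
      ∧ (NE Q.a).relIndex (US S) ∣ d := by
  have hιU : ∀ x : Fˣ, Q.ι x ∈ US (above E S) ↔ x ∈ US S := by
    intro x
    constructor
    · intro h v hv
      obtain ⟨P, rfl⟩ := un_surj (E := E) v
      have := h P (by rwa [mem_above])
      rwa [ι_apply, un_val_eq_one] at this
    · intro h P hP
      rw [ι_apply, un_val_eq_one]
      exact h _ (by rwa [mem_above] at hP)
  have hσU : ∀ z : Eˣ, z ∈ US (above E S) → Q.σu z ∈ US (above E S) := by
    intro z h P hP
    show P.valuation E (Q.σ z) = 1
    rw [← cj_val]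
    exact h _ (by rw [mem_above, un_cj]; rwa [mem_above] at hP)
  have hNU : ∀ z : Eˣ, z ∈ US (above E S) → Q.N z ∈ US S := by
    intro z h
    rw [← hιU, ← mul_σ]
    exact mul_mem h (hσU z h)
  let i : US S →* US (above E S) := (Q.ι.comp (US S).subtype).codRestrict _ (fun x => (hιU x).2 x.2)
  let N : US (above E S) →* US S := (Q.N.comp (US (above E S)).subtype).codRestrict _ (fun x => hNU x x.2)
  have mA : ∀ (T : Subgroup Fˣ) (x : T), x ∈ (sq T).subgroupOf T ↔ ∃ y ∈ T, y ^ 2 = (x : Fˣ) := fun T x => Iff.rfl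
  have mB : ∀ (T : Subgroup Eˣ) (x : T), x ∈ (sq T).subgroupOf T ↔ ∃ y ∈ T, y ^ 2 = (x : Eˣ) := fun T x => Iff.rfl
  have key := norm_index ((sq (US S)).subgroupOf (US S)) ((sq (US (above E S))).subgroupOf (US (above E S))) i N
    (by
      rintro ⟨x, hx⟩ ⟨y, hy, rfl⟩
      exact ⟨Q.ι y, (hιU y).2 hy, (map_pow Q.ι y 2).symm⟩)
    (by
      rintro ⟨x, hx⟩ ⟨y, hy, rfl⟩
      exact ⟨Q.N y, hNU y hy, (map_pow Q.N y 2).symm⟩)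
    (by
      rintro ⟨x, hx⟩
      exact ⟨x, hx, (Q.N_ι x).symm⟩)
    (by
      rw [Subgroup.relIndex_eq_two_iff]
      refine ⟨⟨Q.a, ha⟩, ?_, ?_⟩
      · refine ⟨Q.θu, ?_, Q.θu_sq⟩
        apply US_of_sq
        rw [θu_sq]; exact (hιU _).2 ha
      · rintro ⟨b, hbU⟩ ⟨z, hz, hb⟩
        have hna : ∀ y : Fˣ, y ^ 2 ≠ Q.a := by
          intro y hy; apply Q.nsq y; rw [← hy]; simp
        have hb' : Q.ι b = z ^ 2 := hb.symm
        obtain ⟨y, ⟨-, rfl⟩ | ⟨-, rfl⟩⟩ := Q.sq_of_ι two_ne_zero hb'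
        · right
          refine ⟨⟨y, US_of_sq hbU, rfl⟩, ?_⟩
          rintro ⟨w, hw, h⟩
          apply hna (w / y)
          have h : w ^ 2 = y ^ 2 * Q.a := h
          rw [div_pow, h]; simp
        · left
          refine ⟨⟨Q.a * y, ?_, ?_⟩, ?_⟩
          · apply US_of_sq
            have : (Q.a * y) ^ 2 = (Q.a * y ^ 2) * Q.a := by rw [mul_pow, pow_two Q.a, mul_right_comm]
            rw [this]; exact mul_mem hbU ha
          · show (Q.a * y) ^ 2 = (Q.a * y ^ 2) * Q.a
            rw [mul_pow, pow_two Q.a, mul_right_comm]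
          · rintro ⟨w, hw, h⟩
            apply hna (w / y)
            have h : w ^ 2 = Q.a * y ^ 2 := h
            rw [div_pow, h]; simp)
    (by
      rintro ⟨h, hhU⟩ ⟨g, hg, hgN⟩
      have hgN : g ^ 2 = Q.N h := hgN
      obtain ⟨z, hz⟩ := Q.H90 (h := h * (Q.ι g)⁻¹) (by rw [map_mul, map_inv, N_ι, hgN]; simp)
      have hU' : h * (Q.ι g)⁻¹ ∈ US (above E S) := mul_mem hhU (inv_mem ((hιU g).2 hg))
      obtain ⟨p, q, hpq⟩ := Q.span z
      have hpq0 : p ≠ 0 ∨ q ≠ 0 := by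
        by_contra hc
        simp only [not_or, not_not] at hc
        rw [hc.1, hc.2] at hpq
        simp at hpq
      obtain ⟨f, hf⟩ := hS.exists_max hpq0
      have hPσ : ∀ P, P ∉ above E S → P.valuation E (Q.σ z) = P.valuation E z := by
        intro P hP
        have e := congrArg (fun u : Eˣ => P.valuation E u) hz
        have e2 : P.valuation E ((h * (Q.ι g)⁻¹ : Eˣ) : E) * P.valuation E (Q.σ z) = P.valuation E z := by
          rw [← map_mul]; exact e
        rw [hU' P hP, one_mul] at e2
        exact e2
      have hPf : ∀ P, P ∉ above E S → P.valuation E z = P.valuation E (Q.ι f) := by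
        intro P hP
        have hP2 : P.valuation E 2 = 1 := by
          rw [← map_ofNat (algebraMap F E), un_val_eq_one]; exact h2 _ (by rwa [mem_above] at hP)
        have hPθ : P.valuation E Q.θ = 1 := by
          have : P.valuation E (algebraMap F E Q.a) = 1 := by
            rw [un_val_eq_one]; exact ha _ (by rwa [mem_above] at hP)
          rw [← Q.hθ, map_pow] at this
          exact (pow_eq_one_iff_of_nonneg zero_le two_ne_zero).1 this
        have e1 : P.valuation E (Q.ι f) = max (P.valuation E (algebraMap F E p)) (P.valuation E (algebraMap F E q)) := by
          rw [ι_apply, un_val, hf _ (by rwa [mem_above] at hP), un_val, un_val]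
          exact (pow_left_mono (ri F P)).map_max
        rw [e1]
        apply le_antisymm
        · rw [hpq]
          refine (Valuation.map_add _ _ _).trans ?_
          rw [map_mul, hPθ, mul_one]
        · apply max_le
          · have : P.valuation E (algebraMap F E p) = P.valuation E (z + Q.σ z) := by
              rw [hpq, σ_span]
              have : algebraMap F E p + algebraMap F E q * Q.θ + (algebraMap F E p - algebraMap F E q * Q.θ) = 2 * algebraMap F E p := by ring
              rw [this, map_mul, hP2, one_mul]
            rw [this]
            exact (Valuation.map_add _ _ _).trans (by rw [hPσ P hP, max_self])
          · have : P.valuation E (algebraMap F E q) = P.valuation E (z - Q.σ z) := by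
              rw [hpq, σ_span]
              have : algebraMap F E p + algebraMap F E q * Q.θ - (algebraMap F E p - algebraMap F E q * Q.θ) = 2 * algebraMap F E q * Q.θ := by ring
              rw [this, map_mul, map_mul, hP2, one_mul, hPθ, mul_one]
            rw [this]
            exact (Valuation.map_sub _ _ _).trans (by rw [hPσ P hP, max_self])
      have hzf : z * (Q.ι f)⁻¹ ∈ US (above E S) := by
        intro P hP
        rw [Units.val_mul, map_mul, hPf P hP, ← map_mul, ← Units.val_mul]; simp
      have hidU : g * (f ^ 2 * (Q.N z)⁻¹) ∈ US S := by
        refine mul_mem hg ?_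
        have : f ^ 2 * (Q.N z)⁻¹ = (Q.N (z * (Q.ι f)⁻¹))⁻¹ := by
          rw [map_mul, map_inv, N_ι]; simp [mul_comm]
        rw [this]; exact inv_mem (hNU _ hzf)
      refine ⟨⟨_, hidU⟩, ⟨(z * (Q.ι f)⁻¹) ^ 2, pow_mem hzf 2⟩, ⟨_, hzf, rfl⟩, ?_⟩
      apply Subtype.ext
      show h = Q.ι (g * (f ^ 2 * (Q.N z)⁻¹)) * (z * (Q.ι f)⁻¹) ^ 2
      rw [map_mul, map_mul, map_inv, map_pow, ← mul_σ]
      have e : h = Q.ι g * (z * (Q.σu z)⁻¹) := by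
        rw [eq_comm, mul_comm, ← eq_mul_inv_iff_mul_eq, mul_inv_eq_iff_eq_mul, hz]
      rw [e, mul_assoc]
      congr 1
      generalize Q.σu z = w
      generalize Q.ι f = x
      rw [mul_pow, inv_pow, mul_inv, pow_two z]
      generalize x ^ 2 = y
      have : y * (z⁻¹ * w⁻¹) * (z * z * y⁻¹) = (y * y⁻¹) * (z⁻¹ * z) * (z * w⁻¹) := by
        simp only [mul_assoc, mul_comm, mul_left_comm]
      rw [this]; simp)
  have i1 : ((sq (US S)).subgroupOf (US S)).index = 2 ^ (S.card + Fintype.card (InfinitePlace F)) := US_card S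
  have i2 : ((sq (US (above E S))).subgroupOf (US (above E S))).index = 2 ^ ((above E S).card + Fintype.card (InfinitePlace E)) := US_card _
  rw [i1, i2] at key
  refine ⟨_, key, ?_⟩
  apply Subgroup.index_dvd_of_le
  rw [sup_le_iff]
  constructor
  · rintro _ ⟨z, rfl⟩
    rw [Subgroup.mem_subgroupOf, ← Q.N_range]
    exact ⟨z, rfl⟩
  · rintro ⟨x, hx⟩ ⟨y, hy, rfl⟩
    exact sq_mem_NE _ y

end Quad

/-- First inequality. -/
theorem FI {a : Fˣ} (hna : ∀ x : F, x ^ 2 ≠ a) (S : Finset (FP F)) (h2 : ∀ v ∉ S, v.valuation F 2 = 1)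
    (ha : a ∈ US S) (hS : CG S) (B : Finset (Pl F)) (hB1 : ∀ v ∈ S, a ∉ L (.inl v) → .inl v ∈ B)
    (hB2 : ∀ s, a ∉ L (.inr s) → .inr s ∈ B) :
    (NE a).relIndex (US S) ≠ 0 ∧ 2 * (NE a).relIndex (US S) ≤ 2 ^ B.card := by
  classical
  obtain ⟨E, _, _, _, Q, rfl⟩ := exists_quad a hna
  obtain ⟨d, hd, hdvd⟩ := Q.glob_index S h2 ha hS
  have hd0 : d ≠ 0 := by
    rintro rfl; rw [zero_mul, zero_mul] at hd
    exact absurd hd.symm (by positivity)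
  refine ⟨fun h => hd0 (by rw [h] at hdvd; exact zero_dvd_iff.1 hdvd), ?_⟩
  have h3 := Nat.le_of_dvd (Nat.pos_of_ne_zero hd0) hdvd
  have c1 := Q.S_count S
  have c2 := Q.inf_count
  have c3 : (S.filter fun v : FP F => ¬ (Q.a ∈ L (.inl v))).card + Fintype.card {s : F →+* ℝ // ¬ 0 < s Q.a} ≤ B.card := by
    have e : Fintype.card {s : F →+* ℝ // ¬ 0 < s Q.a} = (Finset.univ.filter fun s : F →+* ℝ => ¬ 0 < s Q.a).card :=
      Fintype.card_subtype _
    rw [e, ← Finset.card_disjSum]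
    apply Finset.card_le_card
    intro x hx
    rcases x with v | s
    · rw [Finset.inl_mem_disjSum, Finset.mem_filter] at hx
      exact hB1 v hx.1 hx.2
    · rw [Finset.inr_mem_disjSum, Finset.mem_filter] at hx
      exact hB2 s hx.2
  have c4 := Finset.card_filter_add_card_filter_not (s := S) (fun v : FP F => Q.a ∈ L (.inl v))
  set sE := (above E S).card + Fintype.card (InfinitePlace E) with hsE
  have hle : 2 * (S.card + Fintype.card (InfinitePlace F)) ≤ B.card + sE := by omega
  have h4 : d * 2 * 2 ^ sE ≤ 2 ^ B.card * 2 ^ sE := by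
    rw [← pow_add, mul_right_comm, hd, ← pow_mul, mul_comm _ 2]
    exact Nat.pow_le_pow_right (by norm_num) hle
  have h5 := Nat.le_of_mul_le_mul_right h4 (by positivity)
  omega

end
end BQ

namespace BQ
open WithZero NumberField IsDedekindDomain

section
variable {F : Type*} [Field F] [NumberField F]

theorem exists_signs (A : Set (F →+* ℝ)) : ∃ β : F, (∀ s ∈ A, s β < 0) ∧ ∀ s ∉ A, 0 < s β := by
  classical
  let W : (F →+* ℝ) → InfinitePlace F := fun s => InfinitePlace.mk (Complex.ofRealHom.comp s)
  have hW : ∀ s x, W s x = |s x| := by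
    intro s x
    show InfinitePlace.mk _ x = _
    rw [InfinitePlace.apply]
    simp
  have hinj : Function.Injective W := by
    intro s t h
    have h' := InfinitePlace.mk_eq_iff.1 h
    ext x
    rcases h' with h' | h'
    · have := RingHom.congr_fun h' x
      simpa using this
    · have := RingHom.congr_fun h' x
      simp [ComplexEmbedding.conjugate] at this
      exact this
  let c : InfinitePlace F → F := fun w => if ∃ s ∈ A, W s = w then -1 else 1
  let z : (w : InfinitePlace F) → WithAbs w.1 := fun w => WithAbs.toAbs w.1 (c w)
  obtain ⟨x, hx⟩ := Metric.denseRange_iff.1 (InfinitePlace.denseRange_algebraMap_pi F) z 1 one_pos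
  rw [dist_pi_lt_iff one_pos] at hx
  have key : ∀ s : F →+* ℝ, |s (c (W s) - x)| < 1 := by
    intro s
    have := hx (W s)
    rw [dist_eq_norm] at this
    rw [← hW]
    exact this
  refine ⟨x, ?_, ?_⟩
  · intro s hs
    have h1 : c (W s) = -1 := if_pos ⟨s, hs, rfl⟩
    have := key s
    rw [h1, map_sub, map_neg, map_one, abs_lt] at this
    linarith [this.1]
  · intro s hs
    have h1 : c (W s) = 1 := if_neg (by rintro ⟨t, ht, h⟩; exact hs (hinj h ▸ ht))
    have := key s
    rw [h1, map_sub, map_one, abs_lt] at this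
    linarith [this.2]

theorem exists_int_class (x : F) : ∃ (r d : 𝓞 F), d ≠ 0 ∧ algebraMap (𝓞 F) F r = x * (algebraMap (𝓞 F) F d) ^ 2 := by
  obtain ⟨n, d, hd, rfl⟩ := IsFractionRing.div_surjective (A := 𝓞 F) x
  have hd0 : d ≠ 0 := nonZeroDivisors.ne_zero hd
  have : algebraMap (𝓞 F) F d ≠ 0 := by simpa using hd0
  refine ⟨n * d, d, hd0, ?_⟩
  rw [map_mul]; field_simp

theorem exists_M (S : Finset (FP F)) (n : ℕ) : ∃ M : ℕ, M ≠ 0 ∧ ∀ v ∈ S, v.valuation F (M : F) ≤ exp (-(n : ℤ)) := by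
  refine ⟨(∏ v ∈ S, Ideal.absNorm v.asIdeal) ^ n, pow_ne_zero _ ?_, ?_⟩
  · rw [Finset.prod_ne_zero_iff]
    intro v _
    rw [← qq_eq]; exact qq_ne _
  · intro v hv
    have h1 : ((∏ v ∈ S, Ideal.absNorm v.asIdeal : ℕ) : 𝓞 F) ∈ v.asIdeal := by
      have h2 : ((Ideal.absNorm v.asIdeal : ℕ) : 𝓞 F) ∈ v.asIdeal := Ideal.absNorm_mem _
      obtain ⟨k, hk⟩ := Finset.dvd_prod_of_mem (fun v : FP F => Ideal.absNorm v.asIdeal) hv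
      rw [hk, Nat.cast_mul]
      exact Ideal.mul_mem_right _ _ h2
    have h3 := Ideal.pow_mem_pow h1 n
    have : (((∏ v ∈ S, Ideal.absNorm v.asIdeal) ^ n : ℕ) : F) = algebraMap (𝓞 F) F (((∏ v ∈ S, Ideal.absNorm v.asIdeal : ℕ) : 𝓞 F) ^ n) := by
      simp
    rw [this, v.valuation_of_algebraMap, v.intValuation_le_pow_iff_mem]
    exact h3

theorem WA (S : Finset (FP F)) (x : Pl F → Fˣ) :
    ∃ y : Fˣ, (∀ v ∈ S, y / x (.inl v) ∈ L (.inl v)) ∧ ∀ s, y / x (.inr s) ∈ L (.inr s) := by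
  classical
  choose r d hd hr using fun v : FP F => exists_int_class (x (.inl v) : F)
  have hd' : ∀ v, algebraMap (𝓞 F) F (d v) ≠ 0 := fun v => by simpa using hd v
  let x' : FP F → Fˣ := fun v => x (.inl v) * (Units.mk0 _ (hd' v)) ^ 2
  have hx' : ∀ v, (x' v : F) = algebraMap (𝓞 F) F (r v) := by
    intro v; rw [hr]; simp [x']
  have hn : ∃ n : ℕ, ∀ v ∈ S, exp (-(n : ℤ)) < v.valuation F 4 * v.valuation F (x' v) := by
    have : ∀ v : FP F, ∃ n : ℕ, exp (-(n : ℤ)) < v.valuation F 4 * v.valuation F (x' v) := by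
      intro v; apply exists_exp_lt
      rw [zero_lt_iff, ← map_mul]; simp
    choose n hn using this
    refine ⟨S.sup n, fun v hv => lt_of_le_of_lt ?_ (hn v)⟩
    rw [exp_le_exp]
    have := Finset.le_sup (f := n) hv
    omega
  obtain ⟨n, hn⟩ := hn
  obtain ⟨y0, hy0⟩ := int_approx S r n
  obtain ⟨M, hM0, hM⟩ := exists_M S n
  obtain ⟨β0, hβ1, hβ2⟩ := exists_signs {s : F →+* ℝ | s (x (.inr s)) < 0}
  obtain ⟨β, e, he, hβ⟩ := exists_int_class β0
  have hβs : ∀ s : F →+* ℝ, 0 < s (algebraMap (𝓞 F) F β) * s (x (.inr s)) := by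
    intro s
    have he' : s (algebraMap (𝓞 F) F e) ≠ 0 := by simpa using he
    have hxs : s (x (.inr s)) ≠ 0 := by simp
    have h0 : 0 < s β0 * s (x (.inr s)) := by
      by_cases h : s (x (.inr s)) < 0
      · exact mul_pos_of_neg_of_neg (hβ1 s h) h
      · exact mul_pos (hβ2 s h) (lt_of_le_of_ne (not_lt.1 h) (Ne.symm hxs))
    rw [hβ, map_mul, map_pow]
    have : 0 < (s (algebraMap (𝓞 F) F e)) ^ 2 := by positivity
    nlinarith
  have hk : ∃ k : ℕ, ∀ s : F →+* ℝ, 0 < s (algebraMap (𝓞 F) F y0 + k * M * algebraMap (𝓞 F) F β) * s (x (.inr s)) := by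
    have : ∀ s : F →+* ℝ, ∃ k : ℕ, ∀ k' : ℕ, k ≤ k' → 0 < s (algebraMap (𝓞 F) F y0 + k' * M * algebraMap (𝓞 F) F β) * s (x (.inr s)) := by
      intro s
      have hMp : (0 : ℝ) < M * (s (algebraMap (𝓞 F) F β) * s (x (.inr s))) := by
        have := hβs s; have : (0 : ℝ) < M := by positivity
        positivity
      obtain ⟨k, hk⟩ := exists_nat_gt (- (s (algebraMap (𝓞 F) F y0) * s (x (.inr s))) / (M * (s (algebraMap (𝓞 F) F β) * s (x (.inr s)))))
      refine ⟨k, fun k' hk' => ?_⟩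
      rw [div_lt_iff₀ hMp] at hk
      have h3 : (k : ℝ) ≤ k' := by exact_mod_cast hk'
      rw [map_add, map_mul, map_mul, map_natCast, map_natCast]
      nlinarith
    choose k hk using this
    exact ⟨Finset.univ.sup k, fun s => hk s _ (Finset.le_sup (Finset.mem_univ s))⟩
  obtain ⟨k, hk⟩ := hk
  set u : F := algebraMap (𝓞 F) F y0 + k * M * algebraMap (𝓞 F) F β with hu
  have hclose : ∀ v ∈ S, v.valuation F (u - x' v) < v.valuation F 4 * v.valuation F (x' v) := by
    intro v hv
    refine lt_of_le_of_lt ?_ (hn v hv)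
    have : u - x' v = (algebraMap (𝓞 F) F y0 - algebraMap (𝓞 F) F (r v)) + M * algebraMap (𝓞 F) F (k * β) := by
      rw [hu, hx', map_mul, map_natCast]; ring
    rw [this]
    refine (Valuation.map_add _ _ _).trans (max_le (hy0 v hv) ?_)
    rw [map_mul]
    exact (mul_le_of_le_one_right' (v.valuation_le_one _)).trans (hM v hv)
  by_cases hu0 : u = 0
  · -- only possible when there is nothing to do
    refine ⟨1, fun v hv => ?_, fun s => ?_⟩
    · exfalso
      have := hclose v hv
      rw [← map_mul] at this
      exact ne_of_close _ this hu0
    · exfalso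
      have := hk s
      rw [hu0] at this; simp at this
  · refine ⟨Units.mk0 u hu0, fun v hv => ?_, fun s => ?_⟩
    · have h1 := mem_LL_of_close _ two_ne_zero (x := Units.mk0 u hu0) (y := x' v) (hclose v hv)
      have h2 := (L (.inl v)).mul_mem h1 (sq_mem_L (.inl v) (Units.mk0 _ (hd' v)))
      have e : Units.mk0 u hu0 / x' v * Units.mk0 _ (hd' v) ^ 2 = Units.mk0 u hu0 / x (.inl v) := by
        simp only [x']
        rw [div_mul_eq_mul_div, mul_div_mul_right_eq_div]
      rwa [e] at h2
    · rw [mem_L_inr]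
      have hxs : s (x (.inr s)) ≠ 0 := by simp
      have := hk s
      push_cast
      rw [map_div₀, Units.val_mk0]
      have e : s u / s (x (.inr s)) = s u * s (x (.inr s)) / (s (x (.inr s))) ^ 2 := by field_simp
      rw [e]; positivity

end
end BQ

namespace BQ
open WithZero NumberField IsDedekindDomain

section
variable {F : Type*} [Field F] [NumberField F]

theorem WA' (B : Finset (Pl F)) (x : Pl F → Fˣ) : ∃ y : Fˣ, ∀ v ∈ B, y / x v ∈ L v := by
  classical
  obtain ⟨y, h1, h2⟩ := WA (B.preimage Sum.inl Sum.inl_injective.injOn) x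
  refine ⟨y, ?_⟩
  rintro (v | s) hv
  · exact h1 v (by simpa using hv)
  · exact h2 s

theorem exists_good (S0 : Finset (FP F)) (X : Finset Fˣ) : ∃ S : Finset (FP F), S0 ⊆ S ∧
    (∀ v ∉ S, v.valuation F 2 = 1) ∧ CG S ∧ ∀ x ∈ X, x ∈ US S := by
  classical
  obtain ⟨S1, hS1⟩ := exists_CG (F := F)
  let S := S0 ∪ (S1 ∪ ((finite_supp' (F := F) two_ne_zero).toFinset ∪ X.biUnion (fun x => (finite_supp x).toFinset)))
  refine ⟨S, Finset.subset_union_left, ?_, hS1.mono ?_, ?_⟩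
  · intro v hv
    by_contra h
    apply hv
    simp only [S, Finset.mem_union, Set.Finite.mem_toFinset]
    exact Or.inr (Or.inr (Or.inl h))
  · intro v hv
    simp only [S, Finset.mem_union]
    exact Or.inr (Or.inl hv)
  · intro x hx v hv
    by_contra h
    apply hv
    simp only [S, Finset.mem_union, Finset.mem_biUnion, Set.Finite.mem_toFinset]
    exact Or.inr (Or.inr (Or.inr ⟨x, hx, h⟩))

theorem mem_iff_of_div {G : Type*} [CommGroup G] {H : Subgroup G} {x y : G} (h : y / x ∈ H) : y ∈ H ↔ x ∈ H := by
  have : y = y / x * x := by simp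
  rw [this]; exact H.mul_mem_cancel_left h

theorem exists_pattern {a : Fˣ} (B : Finset (Pl F)) (hB : ∀ v ∈ B, a ∉ L v) (A : Finset (Pl F)) :
    ∃ y : Fˣ, ∀ v ∈ B, (y ∈ Nloc a v ↔ v ∈ A) := by
  classical
  have : ∀ v : Pl F, ∃ x : Fˣ, v ∈ B → (x ∈ Nloc a v ↔ v ∈ A) := by
    intro v
    by_cases hA : v ∈ A
    · exact ⟨1, fun _ => by simp [hA]⟩
    · by_cases hv : v ∈ B
      · have h := Nloc_index (hB v hv)
        have : Nloc a v ≠ ⊤ := by rintro h'; rw [h'] at h; simp at h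
        obtain ⟨x, hx⟩ := SetLike.exists_not_mem_of_ne_top _ this rfl
        exact ⟨x, fun _ => by simp [hA, hx]⟩
      · exact ⟨1, fun h => absurd h hv⟩
  choose x hx using this
  obtain ⟨y, hy⟩ := WA' B x
  exact ⟨y, fun v hv => (mem_iff_of_div (L_le_Nloc _ _ (hy v hv))).trans (hx v hv)⟩

theorem NS {u : Fˣ} (hu : ∀ x : F, x ^ 2 ≠ u) (S : Finset (FP F)) : ∃ w, w ∉ S ∧ u ∉ L (.inl w) := by
  classical
  by_contra! hcon
  let B : Finset (Pl F) := (S.disjSum Finset.univ).filter (fun v => u ∉ L v)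
  have hB : ∀ v ∈ B, u ∉ L v := fun v hv => (Finset.mem_filter.1 hv).2
  choose y hy using exists_pattern B hB
  obtain ⟨S', h0, h2, hC, hX⟩ := exists_good S (insert u (B.powerset.image y))
  obtain ⟨h3, h4⟩ := FI hu S' h2 (hX u (Finset.mem_insert_self _ _)) hC B
    (by
      intro v _ hv
      by_cases hvS : v ∈ S
      · simp [B, hvS, hv]
      · exact absurd (hcon v hvS) hv)
    (by intro s hs; simp [B, hs])
  have := count_le (US S') (NE u) B (Nloc u) (fun v _ => NE_le_Nloc _ _) h3
    (fun A hA => ⟨y A, hX _ (Finset.mem_insert_of_mem (Finset.mem_image_of_mem _ (Finset.mem_powerset.2 hA))), hy A⟩)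
  have : 0 < 2 ^ B.card := by positivity
  omega

end
end BQ

namespace BQ
open WithZero NumberField IsDedekindDomain

section
variable {F : Type*} [Field F] [NumberField F]

/-- elements of even valuation -/
def evenV (v : FP F) : Subgroup Fˣ where
  carrier := {x | ∃ y : Fˣ, v.valuation F (y : F) ^ 2 = v.valuation F (x : F)}
  mul_mem' := by
    rintro a b ⟨y, hy⟩ ⟨z, hz⟩
    exact ⟨y * z, by push_cast; rw [map_mul, map_mul, mul_pow, hy, hz]⟩
  one_mem' := ⟨1, by simp⟩
  inv_mem' := by
    rintro a ⟨y, hy⟩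
    exact ⟨y⁻¹, by push_cast; rw [map_inv₀, map_inv₀, inv_pow, hy]⟩

theorem L_le_evenV (v : FP F) : L (.inl v) ≤ evenV v := by
  intro x hx
  obtain ⟨y, -, hy⟩ := newton' (v.valuation F) two_ne_zero hx (γ := 1) zero_lt_one
  exact ⟨y, hy⟩

theorem evenV_ne_top (v : FP F) : evenV v ≠ ⊤ := by
  intro h
  obtain ⟨p, hp⟩ := exists_unif v
  have hp0 : p ≠ 0 := by rintro rfl; rw [map_zero] at hp; exact exp_ne_zero hp.symm
  have : Units.mk0 p hp0 ∈ evenV v := h ▸ Subgroup.mem_top _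
  obtain ⟨y, hy⟩ := this
  rw [Units.val_mk0, hp] at hy
  have h0 : v.valuation F (y : F) ≠ 0 := by simp
  rw [← exp_log h0, ← exp_nsmul, exp_inj] at hy
  simp at hy; omega

theorem unit_class {v : FP F} (h2 : v.valuation F 2 = 1) {a b : Fˣ} (ha : v.valuation F a = 1)
    (hb : v.valuation F b = 1) (haL : a ∉ L (.inl v)) (hbL : b ∉ L (.inl v)) : a * b ∈ L (.inl v) := by
  have hee : ee v = 0 := by
    have := v_two v
    rw [h2, ← exp_zero, exp_inj] at this
    omega
  have hidx : (L (.inl v)).index = 4 := by rw [L_index, hee]; simp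
  have h1 := Subgroup.relIndex_mul_index (L_le_evenV v)
  rw [hidx] at h1
  have h3 : (evenV v).index ≠ 1 := fun h => evenV_ne_top v (Subgroup.index_eq_one.1 h)
  have ha' : a ∈ evenV v := ⟨1, by simp [ha]⟩
  have hb' : b ∈ evenV v := ⟨1, by simp [hb]⟩
  have h4 : (L (.inl v)).relIndex (evenV v) ≠ 1 := fun h => haL (Subgroup.relIndex_eq_one.1 h ha')
  have h5 : (L (.inl v)).relIndex (evenV v) = 2 := by
    have : (L (.inl v)).relIndex (evenV v) ∣ 4 := ⟨_, h1.symm⟩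
    have hle := Nat.le_of_dvd (by norm_num) this
    interval_cases (L (.inl v)).relIndex (evenV v) <;> omega
  have := Subgroup.mul_mem_iff_of_index_two (H := (L (.inl v)).subgroupOf (evenV v)) h5
    (a := ⟨a, ha'⟩) (b := ⟨b, hb'⟩)
  simp only [Subgroup.mem_subgroupOf] at this
  exact this.2 ⟨fun h => absurd h haL, fun h => absurd h hbL⟩

theorem L_relIndex_le {S : Finset (FP F)} {w : FP F} (hw : w ∉ S) (h2 : w.valuation F 2 = 1) :
    (L (.inl w)).relIndex (US S) ≤ 2 ∧ (L (.inl w)).relIndex (US S) ≠ 0 := by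
  by_cases h : US S ≤ L (.inl w)
  · rw [Subgroup.relIndex_eq_one.2 h]; simp
  · obtain ⟨u, hu, hu'⟩ := SetLike.not_le_iff_exists.1 h
    have : (L (.inl w)).relIndex (US S) = 2 := by
      rw [Subgroup.relIndex_eq_two_iff]
      refine ⟨u, hu, fun b hb => ?_⟩
      by_cases hbL : b ∈ L (.inl w)
      · right; exact ⟨hbL, fun h => hu' ((Subgroup.mul_mem_cancel_left _ hbL).1 h)⟩
      · left; exact ⟨unit_class h2 (hb w hw) (hu w hw) hbL hu', hbL⟩
    rw [this]; simp

theorem exists_sep {a u : Fˣ} (hna : ∀ x : F, x ^ 2 ≠ a) {S : Finset (FP F)} (h2 : ∀ v ∉ S, v.valuation F 2 = 1)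
    (ha : a ∈ US S) (hu : u ∈ US S) (h1 : u ∉ sq (US S)) (h1' : a * u ∉ sq (US S)) :
    ∃ w, w ∉ S ∧ a ∈ L (.inl w) ∧ u ∉ L (.inl w) := by
  obtain ⟨E, _, _, _, Q, rfl⟩ := exists_quad a hna
  have hsq : ∀ x : Fˣ, x ∈ US S → ∀ y : Fˣ, x = y ^ 2 → x ∈ sq (US S) := by
    intro x hx y hy
    refine mem_sq.2 ⟨y, fun v hv => ?_, hy.symm⟩
    have := hx v hv
    rw [hy] at this
    push_cast at this
    rw [map_pow] at this
    exact (pow_eq_one_iff_of_nonneg zero_le two_ne_zero).1 this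
  have hns : ∀ x : E, x ^ 2 ≠ Q.ι u := by
    intro x hx
    have hx0 : x ≠ 0 := by rintro rfl; simp at hx; exact u.ne_zero ((map_eq_zero (algebraMap F E)).1 hx.symm)
    obtain ⟨y, h | h⟩ := Q.sq_of_ι two_ne_zero (x := u) (z := Units.mk0 x hx0) (by ext; simpa using hx.symm)
    · exact h1 (hsq u hu y h.2)
    · refine h1' (hsq _ (mul_mem ha hu) (Q.a * y) ?_)
      rw [h.2]; ext; push_cast; ring
  obtain ⟨W, hW, hW'⟩ := NS hns (above E S)
  refine ⟨un F W, by rwa [mem_above] at hW, ?_, ?_⟩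
  · by_contra haL
    rw [mem_above] at hW
    have huL : u ∉ L (.inl (un F W)) := fun h => hW' (L_up W h)
    have := L_up W (unit_class (h2 _ hW) (ha _ hW) (hu _ hW) haL huL)
    rw [map_mul] at this
    have e : Units.map (algebraMap F E : F →* E) Q.a = Q.θu ^ 2 := Q.θu_sq.symm
    rw [e] at this
    exact hW' ((Subgroup.mul_mem_cancel_left _ (sq_mem_L _ _)).1 this)
  · exact fun h => hW' (L_up W h)

theorem exists_T {a : Fˣ} (hna : ∀ x : F, x ^ 2 ≠ a) {S : Finset (FP F)} (h2 : ∀ v ∉ S, v.valuation F 2 = 1)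
    (ha : a ∈ US S) (k : ℕ) (hk : k + 1 ≤ S.card + Fintype.card (InfinitePlace F)) :
    ∃ (T : Finset (FP F)) (u : FP F → Fˣ) (R : Subgroup Fˣ), T.card = k ∧ Disjoint S T ∧ (∀ w ∈ T, a ∈ L (.inl w)) ∧
      (∀ w ∈ T, u w ∈ US S ∧ u w ∉ L (.inl w) ∧ ∀ w' ∈ T, w' ≠ w → u w ∈ L (.inl w')) ∧
      (∀ w ∈ T, R ≤ L (.inl w)) ∧ R.relIndex (US S) ≤ 2 ^ k ∧ R.relIndex (US S) ≠ 0 := by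
  classical
  induction k with
  | zero => exact ⟨∅, 1, ⊤, by simp⟩
  | succ k ih =>
    obtain ⟨T, u, R, hT, hST, haT, hu, hR, hR1, hR0⟩ := ih (by omega)
    let A : Subgroup Fˣ :=
      { carrier := {x | x ∈ sq (US S) ∨ a * x ∈ sq (US S)}
        mul_mem' := by
          have haa : a * a ∈ sq (US S) := mem_sq.2 ⟨a, ha, pow_two a⟩
          rintro x y (hx | hx) (hy | hy)
          · exact Or.inl (mul_mem hx hy)
          · right; have := mul_mem hx hy; rwa [show x * (a * y) = a * (x * y) by ext; push_cast; ring] at this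
          · right; have := mul_mem hx hy; rwa [show a * x * y = a * (x * y) by ext; push_cast; ring] at this
          · left; have := mul_mem hx hy
            rw [show a * x * (a * y) = (a * a) * (x * y) by ext; push_cast; ring] at this
            exact (Subgroup.mul_mem_cancel_left _ haa).1 this
        one_mem' := Or.inl (one_mem _)
        inv_mem' := by
          have haa : a * a ∈ sq (US S) := mem_sq.2 ⟨a, ha, pow_two a⟩
          rintro x (hx | hx)
          · exact Or.inl (inv_mem hx)
          · right; have := mul_mem haa (inv_mem hx)
            rwa [show a * a * (a * x)⁻¹ = a * x⁻¹ by ext; push_cast; field_simp] at this }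
    have hns : a ∉ sq (US S) := by
      intro h; obtain ⟨y, -, h⟩ := mem_sq.1 h
      exact hna y (by rw [← h]; simp)
    have haa : a * a ∈ sq (US S) := mem_sq.2 ⟨a, ha, pow_two a⟩
    have hA2 : (sq (US S)).relIndex A = 2 := by
      rw [Subgroup.relIndex_eq_two_iff]
      refine ⟨a, Or.inr haa, fun b hb => ?_⟩
      by_cases hbs : b ∈ sq (US S)
      · right; exact ⟨hbs, fun h => hns ((Subgroup.mul_mem_cancel_left _ hbs).1 h)⟩
      · left; refine ⟨?_, hbs⟩
        rcases hb with hb | hb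
        · exact absurd hb hbs
        · rwa [mul_comm]
    have hAU : A ≤ US S := by
      rintro x (hx | hx)
      · exact sq_le _ hx
      · exact (Subgroup.mul_mem_cancel_left _ ha).1 (sq_le _ hx)
    have hmul := Subgroup.relIndex_mul_relIndex (sq (US S)) A (US S) (fun x hx => Or.inl hx) hAU
    rw [hA2, US_card] at hmul
    have hnot : ¬ (US S ⊓ R ≤ A) := by
      intro h
      have h3 := Subgroup.relIndex_le_of_le_left (L := US S) h (by rw [inf_comm, Subgroup.inf_relIndex_right]; exact hR0)
      rw [inf_comm, Subgroup.inf_relIndex_right] at h3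
      have h4 : 2 ^ (k + 2) ≤ 2 ^ (S.card + Fintype.card (InfinitePlace F)) := Nat.pow_le_pow_right (by norm_num) (by omega)
      have : 2 ^ (k + 2) = 4 * 2 ^ k := by ring
      have : 0 < 2 ^ k := by positivity
      omega
    obtain ⟨x, ⟨hxU, hxR⟩, hxA⟩ := SetLike.not_le_iff_exists.1 hnot
    obtain ⟨w, hwS, haw, hxw⟩ := exists_sep hna h2 ha hxU (fun h => hxA (Or.inl h)) (fun h => hxA (Or.inr h))
    have hwT : w ∉ T := fun h => hxw (hR w h hxR)
    have hrel := L_relIndex_le hwS (h2 w hwS)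
    refine ⟨insert w T, fun w' => if w' = w then x else if u w' ∈ L (.inl w) then u w' else u w' * x, R ⊓ L (.inl w),
      by rw [Finset.card_insert_of_notMem hwT, hT], ?_, ?_, ?_, ?_, ?_, ?_⟩
    · rw [Finset.disjoint_insert_right]; exact ⟨hwS, hST⟩
    · intro w' hw'
      rcases Finset.mem_insert.1 hw' with rfl | hw'
      · exact haw
      · exact haT w' hw'
    · intro w' hw'
      rcases Finset.mem_insert.1 hw' with rfl | hw'
      · simp only [if_true]
        refine ⟨hxU, hxw, fun w'' hw'' hne => ?_⟩
        exact hR w'' (Finset.mem_of_mem_insert_of_ne hw'' hne) hxR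
      · have hne : w' ≠ w := fun h => hwT (h ▸ hw')
        obtain ⟨g1, g2, g3⟩ := hu w' hw'
        simp only [if_neg hne]
        split_ifs with hc
        · refine ⟨g1, g2, fun w'' hw'' hne' => ?_⟩
          rcases Finset.mem_insert.1 hw'' with rfl | hw''
          · exact hc
          · exact g3 w'' hw'' hne'
        · refine ⟨mul_mem g1 hxU, fun h => g2 ((Subgroup.mul_mem_cancel_right _ (hR w' hw' hxR)).1 h), fun w'' hw'' hne' => ?_⟩
          rcases Finset.mem_insert.1 hw'' with rfl | hw''
          · exact unit_class (h2 _ hwS) (g1 _ hwS) (hxU _ hwS) hc hxw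
          · exact mul_mem (g3 w'' hw'' hne') (hR _ hw'' hxR)
    · intro w' hw'
      rcases Finset.mem_insert.1 hw' with rfl | hw'
      · exact inf_le_right
      · exact inf_le_left.trans (hR w' hw')
    · refine Subgroup.relIndex_inf_le.trans ?_
      rw [pow_succ]
      exact Nat.mul_le_mul hR1 hrel.1
    · exact Subgroup.relIndex_inf_ne_zero hR0 hrel.2

end
end BQ

namespace BQ
open WithZero NumberField IsDedekindDomain

theorem pattern_of_dual {G ι : Type*} [CommGroup G] [DecidableEq ι] (B : Finset ι) (H : ι → Subgroup G) (g : ι → G)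
    (h1 : ∀ v ∈ B, g v ∉ H v) (h2 : ∀ v ∈ B, ∀ v' ∈ B, v' ≠ v → g v ∈ H v') (A : Finset ι) :
    ∀ v ∈ B, ((∏ v ∈ B \ A, g v) ∈ H v ↔ v ∈ A) := by
  intro v hv
  by_cases hA : v ∈ A
  · simp only [hA, iff_true]
    apply Subgroup.prod_mem
    intro w hw
    rw [Finset.mem_sdiff] at hw
    exact h2 w hw.1 v hv (by rintro rfl; exact hw.2 hA)
  · simp only [hA, iff_false]
    rw [← Finset.mul_prod_erase _ _ (Finset.mem_sdiff.2 ⟨hv, hA⟩)]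
    rw [Subgroup.mul_mem_cancel_right]
    · exact h1 v hv
    · apply Subgroup.prod_mem
      intro w hw
      rw [Finset.mem_erase, Finset.mem_sdiff] at hw
      exact h2 w hw.2.1 v hv hw.1.symm

section
variable {F : Type*} [Field F] [NumberField F]

theorem adjust {S T : Finset (FP F)} (h2 : ∀ v ∉ S, v.valuation F 2 = 1) (hST : Disjoint S T) {u : FP F → Fˣ}
    (hu : ∀ w ∈ T, u w ∈ US S ∧ u w ∉ L (.inl w) ∧ ∀ w' ∈ T, w' ≠ w → u w ∈ L (.inl w'))
    (f : Fˣ) (T' : Finset (FP F)) (hT' : T' ⊆ T) (hf : ∀ w ∈ T', w.valuation F (f : F) = 1) :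
    ∃ e ∈ US S, ∀ w ∈ T', f * e ∈ L (.inl w) := by
  classical
  induction T' using Finset.induction_on with
  | empty => exact ⟨1, one_mem _, by simp⟩
  | insert w T' hw ih =>
    obtain ⟨e, he, h⟩ := ih (fun x hx => hT' (Finset.mem_insert_of_mem hx)) (fun x hx => hf x (Finset.mem_insert_of_mem hx))
    have hwT := hT' (Finset.mem_insert_self w T')
    have hwS : w ∉ S := fun h => Finset.disjoint_left.1 hST h hwT
    obtain ⟨g1, g2, g3⟩ := hu w hwT
    by_cases hc : f * e ∈ L (.inl w)
    · refine ⟨e, he, fun w' hw' => ?_⟩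
      rcases Finset.mem_insert.1 hw' with rfl | hw'
      · exact hc
      · exact h w' hw'
    · refine ⟨e * u w, mul_mem he g1, fun w' hw' => ?_⟩
      rw [← mul_assoc]
      rcases Finset.mem_insert.1 hw' with rfl | hw''
      · refine unit_class (h2 _ hwS) ?_ (g1 _ hwS) hc g2
        push_cast; rw [map_mul, hf _ hw', he _ hwS, one_mul]
      · exact mul_mem (h w' hw'') (g3 w' (hT' hw') (by rintro rfl; exact hw hw''))

theorem exists_gen {S T : Finset (FP F)} (h2 : ∀ v ∉ S, v.valuation F 2 = 1) (hC : CG S) (hST : Disjoint S T) {u : FP F → Fˣ}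
    (hu : ∀ w ∈ T, u w ∈ US S ∧ u w ∉ L (.inl w) ∧ ∀ w' ∈ T, w' ≠ w → u w ∈ L (.inl w'))
    {w : FP F} (hw : w ∈ T) (H : Subgroup Fˣ) (hLH : L (.inl w) ≤ H) (hH : H ≠ ⊤) :
    ∃ g : Fˣ, (∀ v, v ∉ S → v ∉ T → v.valuation F (g : F) = 1) ∧ g ∉ H ∧ ∀ w' ∈ T, w' ≠ w → g ∈ L (.inl w') := by
  classical
  obtain ⟨g1, g2, g3⟩ := hu w hw
  have hwS : w ∉ S := fun h => Finset.disjoint_left.1 hST h hw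
  by_cases hc : u w ∈ H
  · obtain ⟨f, hf1, hf2⟩ := hC w hwS
    have hTS : ∀ w' ∈ T, w' ∉ S := fun w' hw' h => Finset.disjoint_left.1 hST h hw'
    obtain ⟨e, he, hfe⟩ := adjust h2 hST hu f (T.erase w) (Finset.erase_subset _ _) (by
      intro w' hw'
      rw [Finset.mem_erase] at hw'
      exact hf2 w' (hTS w' hw'.2) hw'.1)
    refine ⟨f * e, ?_, ?_, fun w' hw' hne => hfe w' (Finset.mem_erase.2 ⟨hne, hw'⟩)⟩
    · intro v hv hvT
      push_cast; rw [map_mul, hf2 v hv (by rintro rfl; exact hvT hw), he v hv, one_mul]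
    · intro hmem
      apply hH
      rw [eq_top_iff]
      intro x _
      have hx0 : w.valuation F (x : F) ≠ 0 := by simp
      set k := log (w.valuation F (x : F)) with hk
      have hunit : w.valuation F ((x * (f * e) ^ k : Fˣ) : F) = 1 := by
        push_cast
        rw [map_mul, map_zpow₀, map_mul, hf1, he w hwS, mul_one, ← exp_log hx0, ← hk, ← exp_zsmul, ← exp_add]
        simp
      have hxk : x * (f * e) ^ k ∈ H := by
        by_cases hxL : x * (f * e) ^ k ∈ L (.inl w)
        · exact hLH hxL
        · have := hLH (unit_class (h2 w hwS) hunit (g1 w hwS) hxL g2)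
          exact (Subgroup.mul_mem_cancel_right _ hc).1 this
      exact (Subgroup.mul_mem_cancel_right _ (zpow_mem hmem k)).1 hxk
  · exact ⟨u w, fun v hv _ => g1 v hv, hc, g3⟩

theorem claim {S T : Finset (FP F)} (h2 : ∀ v ∉ S, v.valuation F 2 = 1) (hC : CG S) (hST : Disjoint S T) {u : FP F → Fˣ}
    (hu : ∀ w ∈ T, u w ∈ US S ∧ u w ∉ L (.inl w) ∧ ∀ w' ∈ T, w' ≠ w → u w ∈ L (.inl w'))
    [DecidableEq (FP F)] {b : Fˣ} (hb : b ∈ US (S ∪ T)) (hb1 : ∀ v ∈ S, b ∈ L (.inl v)) (hb2 : ∀ s, b ∈ L (.inr s)) :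
    b ∈ sq (US (S ∪ T)) := by
  classical
  by_contra hcon
  have hnb : ∀ x : F, x ^ 2 ≠ b := by
    intro x hx
    have hx0 : x ≠ 0 := by rintro rfl; simp at hx; exact b.ne_zero hx.symm
    refine hcon (mem_sq.2 ⟨Units.mk0 x hx0, fun v hv => ?_, by ext; simpa using hx⟩)
    have := hb v hv
    rw [← hx, map_pow] at this
    exact (pow_eq_one_iff_of_nonneg zero_le two_ne_zero).1 this
  let B : Finset (Pl F) := (T.filter (fun w => b ∉ L (.inl w))).image Sum.inl
  have hB : ∀ v ∈ B, ∃ w, v = .inl w ∧ w ∈ T ∧ b ∉ L (.inl w) := by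
    intro v hv
    simp only [B, Finset.mem_image, Finset.mem_filter] at hv
    obtain ⟨w, ⟨h1, h2⟩, rfl⟩ := hv
    exact ⟨w, rfl, h1, h2⟩
  obtain ⟨h3, h4⟩ := FI hnb (S ∪ T) (fun v hv => h2 v (fun h => hv (Finset.mem_union_left _ h))) hb
    (hC.mono Finset.subset_union_left) B
    (by
      intro v hv hvL
      rcases Finset.mem_union.1 hv with hv | hv
      · exact absurd (hb1 v hv) hvL
      · simp only [B, Finset.mem_image, Finset.mem_filter]
        exact ⟨v, ⟨hv, hvL⟩, rfl⟩)
    (fun s hs => absurd (hb2 s) hs)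
  have hg : ∀ v : Pl F, ∃ g : Fˣ, v ∈ B → g ∈ US (S ∪ T) ∧ g ∉ Nloc b v ∧ ∀ v' ∈ B, v' ≠ v → g ∈ Nloc b v' := by
    intro v
    by_cases hv : v ∈ B
    · obtain ⟨w, rfl, hwT, hbw⟩ := hB v hv
      have hidx := Nloc_index hbw
      have hne : Nloc b (.inl w) ≠ ⊤ := by rintro h'; rw [h'] at hidx; simp at hidx
      obtain ⟨g, k1, k2, k3⟩ := exists_gen h2 hC hST hu hwT _ (L_le_Nloc b (.inl w)) hne
      refine ⟨g, fun _ => ⟨fun v hv => ?_, k2, ?_⟩⟩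
      · rw [Finset.mem_union, not_or] at hv
        exact k1 v hv.1 hv.2
      · intro v' hv' hne'
        obtain ⟨w', rfl, hwT', -⟩ := hB v' hv'
        exact L_le_Nloc _ _ (k3 w' hwT' (fun h => hne' (by rw [h])))
    · exact ⟨1, fun h => absurd h hv⟩
  choose g hg using hg
  have := count_le (US (S ∪ T)) (NE b) B (Nloc b) (fun v _ => NE_le_Nloc _ _) h3
    (fun A _ => ⟨∏ v ∈ B \ A, g v, Subgroup.prod_mem _ (fun v hv => (hg v (Finset.mem_sdiff.1 hv).1).1),
      pattern_of_dual B (Nloc b) g (fun v hv => (hg v hv).2.1) (fun v hv => (hg v hv).2.2) A⟩)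
  have : 0 < 2 ^ B.card := by positivity
  omega

end
end BQ

namespace BQ
open WithZero NumberField IsDedekindDomain

section
variable {F : Type*} [Field F] [NumberField F]

theorem Hasse {a b : Fˣ} (h : ∀ v, b ∈ Nloc a v) : b ∈ NE a := by
  classical
  by_cases hna : ∃ x : F, x ^ 2 = a
  · obtain ⟨x, hx⟩ := hna
    have hx0 : x ≠ 0 := by rintro rfl; simp at hx; exact a.ne_zero hx.symm
    refine mem_NE.2 ⟨(b + 1) / 2, (b - 1) / (2 * x), ?_⟩
    rw [← hx]; field_simp; ring
  push Not at hna
  obtain ⟨S, -, h2, hC, hX⟩ := exists_good (F := F) ∅ {a, b}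
  have ha : a ∈ US S := hX a (by simp)
  have hb : b ∈ US S := hX b (by simp)
  have hpos : 0 < Fintype.card (InfinitePlace F) := Fintype.card_pos
  obtain ⟨T, u, -, hT, hST, haT, hu, -⟩ := exists_T hna h2 ha (S.card + Fintype.card (InfinitePlace F) - 1) (by omega)
  set s := S.card + Fintype.card (InfinitePlace F) with hs
  set U := US (S ∪ T) with hU
  let Λ : Subgroup Fˣ := (⨅ v : S, L (.inl v.1)) ⊓ ⨅ t : F →+* ℝ, L (.inr t)
  have hΛ1 : ∀ v ∈ S, Λ ≤ L (.inl v) := fun v hv => inf_le_left.trans (iInf_le _ (⟨v, hv⟩ : S))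
  have hΛ2 : ∀ t, Λ ≤ L (.inr t) := fun t => inf_le_right.trans (iInf_le _ t)
  have hΛle : Λ.index ≤ 4 ^ s := by
    rw [← prod_index S (fun v hv => by by_contra h'; exact hv (h2 v h'))]
    refine Subgroup.index_inf_le.trans (Nat.mul_le_mul ?_ (Subgroup.index_iInf_le _))
    refine (Subgroup.index_iInf_le _).trans (le_of_eq ?_)
    exact Finset.prod_coe_sort S (fun v => (L (.inl v)).index)
  have hΛ0 : Λ.index ≠ 0 := Subgroup.index_inf_ne_zero (Subgroup.index_iInf_ne_zero fun _ => L_index_ne _)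
    (Subgroup.index_iInf_ne_zero fun _ => L_index_ne _)
  have hΛU : Λ ⊓ U = sq U := by
    apply le_antisymm
    · rintro x ⟨hx, hxU⟩
      exact claim h2 hC hST hu hxU (fun v hv => hΛ1 v hv hx) (fun t => hΛ2 t hx)
    · refine le_inf ?_ (sq_le _)
      rintro x hx
      obtain ⟨y, -, rfl⟩ := mem_sq.1 hx
      exact Subgroup.mem_inf.2 ⟨Subgroup.mem_iInf.2 fun _ => sq_mem_L _ _, Subgroup.mem_iInf.2 fun _ => sq_mem_L _ _⟩
  have hrel : Λ.relIndex U = 2 ^ (2 * s - 1) := by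
    rw [← Subgroup.inf_relIndex_right, hΛU, hU, US_card, Finset.card_union_of_disjoint hST, hT]
    congr 1; omega
  have h3 := Subgroup.relIndex_mul_index (le_sup_right : Λ ≤ U ⊔ Λ)
  rw [Subgroup.relIndex_sup_right, hrel] at h3
  have h4 : (U ⊔ Λ).index ≤ 2 := by
    have e : 4 ^ s = 2 ^ (2 * s - 1) * 2 := by
      rw [← pow_succ, show 2 * s - 1 + 1 = 2 * s by omega, pow_mul]; norm_num
    rw [e, ← h3] at hΛle
    exact Nat.le_of_mul_le_mul_left hΛle (by positivity)
  let B : Finset (Pl F) := (S.disjSum Finset.univ).filter (fun v => a ∉ L v)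
  have hB : ∀ v ∈ B, a ∉ L v := fun v hv => (Finset.mem_filter.1 hv).2
  let 𝒩 : Subgroup Fˣ := ⨅ v : B, Nloc a v.1
  have hΛN : Λ ≤ 𝒩 := by
    refine le_iInf fun ⟨v, hv⟩ => ?_
    refine le_trans ?_ (L_le_Nloc a v)
    rcases v with v | t
    · exact hΛ1 v (by simp [B] at hv; exact hv.1)
    · exact hΛ2 t
  have hN0 : 𝒩.index ≠ 0 := fun h' => hΛ0 (by
    have := Subgroup.index_dvd_of_le hΛN
    rw [h'] at this; exact zero_dvd_iff.1 this)
  have h5 : 2 ^ B.card ≤ 𝒩.index := by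
    rw [← Subgroup.relIndex_top_right]
    apply count_le ⊤ 𝒩 B (Nloc a) (fun v hv => iInf_le _ (⟨v, hv⟩ : B))
    · rwa [Subgroup.relIndex_top_right]
    · intro A _
      obtain ⟨y, hy⟩ := exists_pattern B hB A
      exact ⟨y, Subgroup.mem_top _, hy⟩
  have h6 : (U ⊔ 𝒩).index ≤ 2 := by
    refine le_trans (Nat.le_of_dvd ?_ (Subgroup.index_dvd_of_le (sup_le_sup_left hΛN U))) h4
    refine Nat.pos_of_ne_zero fun h' => hΛ0 ?_
    rw [← h3, h', mul_zero]
  have h7 := Subgroup.relIndex_mul_index (le_sup_right : 𝒩 ≤ U ⊔ 𝒩)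
  rw [Subgroup.relIndex_sup_right] at h7
  have hbU : b ∈ U := US_mono Finset.subset_union_left hb
  obtain ⟨h8, h9⟩ := FI hna (S ∪ T) (fun v hv => h2 v (fun h => hv (Finset.mem_union_left _ h)))
    (US_mono Finset.subset_union_left ha) (hC.mono Finset.subset_union_left) B
    (by
      intro v hv hvL
      rcases Finset.mem_union.1 hv with hv | hv
      · simp [B, hv, hvL]
      · exact absurd (haT v hv) hvL)
    (by intro t ht; simp [B, ht])
  have hNEN : NE a ≤ 𝒩 := le_iInf fun v => NE_le_Nloc _ _
  have h10 := Subgroup.relIndex_inf_mul_relIndex (NE a) 𝒩 U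
  rw [inf_eq_left.2 hNEN] at h10
  have h11 : 𝒩.index ≤ 𝒩.relIndex U * 2 := by
    rw [← h7]; exact Nat.mul_le_mul le_rfl h6
  have h12 : (NE a).relIndex U ≤ 𝒩.relIndex U := by rw [← hU] at h9; omega
  have h13 : (NE a).relIndex (𝒩 ⊓ U) = 1 := by
    rw [← hU, ← h10] at h8
    rw [← h10] at h12
    have hp : 0 < 𝒩.relIndex U := Nat.pos_of_ne_zero (fun h' => h8 (by rw [h', mul_zero]))
    have hq : (NE a).relIndex (𝒩 ⊓ U) ≠ 0 := fun h' => h8 (by rw [h', zero_mul])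
    have : (NE a).relIndex (𝒩 ⊓ U) ≤ 1 := by
      by_contra hc
      push Not at hc
      nlinarith
    omega
  refine Subgroup.relIndex_eq_one.1 h13 ⟨?_, hbU⟩
  simp only [SetLike.mem_coe]
  exact Subgroup.mem_iInf.2 fun v => h v.1

end
end BQ

namespace BQ
open WithZero NumberField IsDedekindDomain

section
variable {F : Type*} [Field F] [NumberField F]

theorem loc_choice (a b c d : Fˣ) (v : Pl F) : ∃ t : Fˣ, (b ∈ Nloc a v ∨ t / b ∈ Nloc a v) ∧
    (d ∈ Nloc c v ∨ t / d ∈ Nloc c v) := by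
  have key : ∀ a x y : Fˣ, x ∉ Nloc a v → y ∉ Nloc a v → x / y ∈ Nloc a v := by
    intro a x y hx hy
    have ha : a ∉ L v := fun h => hx (by rw [Nloc_top h]; trivial)
    rw [div_eq_mul_inv, Subgroup.mul_mem_iff_of_index_two (Nloc_index ha), inv_mem_iff]
    simp [hx, hy]
  by_cases hb : b ∈ Nloc a v
  · exact ⟨d, Or.inl hb, Or.inr (by simp)⟩
  by_cases hd : d ∈ Nloc c v
  · exact ⟨b, Or.inr (by simp), Or.inl hd⟩
  by_cases hbc : b ∈ Nloc c v
  · by_cases hda : d ∈ Nloc a v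
    · exact ⟨b * d, Or.inr (by simpa using hda), Or.inr (by simpa using hbc)⟩
    · exact ⟨d, Or.inr (key _ _ _ hda hb), Or.inr (by simp)⟩
  · exact ⟨b, Or.inr (by simp), Or.inr (key _ _ _ hbc hd)⟩

theorem exists_t (a b c d : Fˣ) : ∃ t : Fˣ, ∀ v, (b ∈ Nloc a v ∨ t / b ∈ Nloc a v) ∧
    (d ∈ Nloc c v ∨ t / d ∈ Nloc c v) := by
  classical
  obtain ⟨S, -, h2, -, hX⟩ := exists_good (F := F) ∅ {a, b, c, d}
  choose t ht using loc_choice a b c d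
  obtain ⟨y, hy1, hy2⟩ := WA S t
  refine ⟨y, fun v => ?_⟩
  have key : ∀ v, y / t v ∈ L v → (b ∈ Nloc a v ∨ y / b ∈ Nloc a v) ∧ (d ∈ Nloc c v ∨ y / d ∈ Nloc c v) := by
    intro v hv
    refine ⟨(ht v).1.imp_right fun h => ?_, (ht v).2.imp_right fun h => ?_⟩
    · rw [show y / b = y / t v * (t v / b) by simp]; exact mul_mem (L_le_Nloc _ _ hv) h
    · rw [show y / d = y / t v * (t v / d) by simp]; exact mul_mem (L_le_Nloc _ _ hv) h
  rcases v with v | s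
  · by_cases hv : v ∈ S
    · exact key _ (hy1 v hv)
    · exact ⟨Or.inl (Nloc_unit (h2 v hv) (hX a (by simp) v hv) (hX b (by simp) v hv)),
        Or.inl (Nloc_unit (h2 v hv) (hX c (by simp) v hv) (hX d (by simp) v hv))⟩
  · exact key _ (hy2 s)

/-- restriction of places -/
noncomputable def resPl (F : Type*) {E : Type*} [Field F] [NumberField F] [Field E] [NumberField E] [Algebra F E] : Pl E → Pl F
  | .inl P => .inl (un F P)
  | .inr s => .inr (s.comp (algebraMap F E))

theorem Nloc_up {E : Type*} [Field E] [NumberField E] [Algebra F E] {a x : Fˣ} (P : Pl E) (h : x ∈ Nloc a (resPl F P)) :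
    Units.map (algebraMap F E : F →* E) x ∈ Nloc (Units.map (algebraMap F E : F →* E) a) P := by
  obtain ⟨y, hy, z, hz, rfl⟩ := Subgroup.mem_sup.1 h
  rw [map_mul]
  refine mul_mem (NE_le_Nloc _ _ ?_) (L_le_Nloc _ _ ?_)
  · obtain ⟨p, q, h⟩ := mem_NE.1 hy
    refine mem_NE.2 ⟨algebraMap F E p, algebraMap F E q, ?_⟩
    simp [h]
  · rcases P with P | s
    · exact L_up P hz
    · exact hz

/-- ternary form represents c nontrivially -/
def Rep (a b c : F) : Prop := ∃ x y z : F, (x ≠ 0 ∨ y ≠ 0 ∨ z ≠ 0) ∧ a * x ^ 2 + b * y ^ 2 - a * b * z ^ 2 = c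

theorem rep_of_NE {a b : Fˣ} (h : b ∈ NE a) : Rep (a : F) b 0 := by
  obtain ⟨p, q, h⟩ := mem_NE.1 h
  exact ⟨b, a * q, p, Or.inl b.ne_zero, by linear_combination (a * b : F) * h⟩

theorem rep_down {E : Type*} [Field E] [NumberField E] [Algebra F E] (Q : Quad F E) {a b : Fˣ}
    (h : Rep (algebraMap F E a) (algebraMap F E b) 0) : Rep (a : F) b 0 ∨ Rep (a : F) b Q.a := by
  obtain ⟨x, y, z, h0, h⟩ := h
  obtain ⟨x1, y1, rfl⟩ := Q.span x
  obtain ⟨x2, y2, rfl⟩ := Q.span y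
  obtain ⟨x3, y3, rfl⟩ := Q.span z
  have hθ := Q.hθ
  have e : algebraMap F E ((a * x1 ^ 2 + b * x2 ^ 2 - a * b * x3 ^ 2) + Q.a * (a * y1 ^ 2 + b * y2 ^ 2 - a * b * y3 ^ 2))
     + algebraMap F E (2 * (a * x1 * y1 + b * x2 * y2 - a * b * x3 * y3)) * Q.θ = algebraMap F E 0 + algebraMap F E 0 * Q.θ := by
    simp only [map_add, map_sub, map_mul, map_pow, map_zero, map_ofNat]
    rw [← hθ]
    linear_combination h
  obtain ⟨e1, e2⟩ := Q.coord_unique e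
  have e2' : a * x1 * y1 + b * x2 * y2 - a * b * x3 * y3 = (0 : F) := by
    simpa using e2
  by_cases hy : a * y1 ^ 2 + b * y2 ^ 2 - a * b * y3 ^ 2 = (0 : F)
  · left
    by_cases hy0 : y1 = 0 ∧ y2 = 0 ∧ y3 = 0
    · obtain ⟨rfl, rfl, rfl⟩ := hy0
      refine ⟨x1, x2, x3, ?_, by linear_combination e1 - Q.a * hy⟩
      by_contra hc
      push Not at hc
      obtain ⟨rfl, rfl, rfl⟩ := hc
      simp at h0
    · refine ⟨y1, y2, y3, ?_, hy⟩
      tauto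
  · right
    set q := a * y1 ^ 2 + b * y2 ^ 2 - a * b * y3 ^ 2 with hq
    have key : a * ((b * (x3 * y2 - x2 * y3)) / q) ^ 2 + b * ((a * (x1 * y3 - x3 * y1)) / q) ^ 2 - a * b * ((x1 * y2 - x2 * y1) / q) ^ 2 = (Q.a : F) := by
      field_simp
      rw [hq] at e1 ⊢
      linear_combination (a * x1 * y1 + b * x2 * y2 - a * b * x3 * y3 : F) * e2' - (a * y1 ^ 2 + b * y2 ^ 2 - a * b * y3 ^ 2 : F) * e1
    refine ⟨_, _, _, ?_, key⟩
    by_contra hc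
    push Not at hc
    rw [hc.1, hc.2.1, hc.2.2] at key
    apply Q.a.ne_zero
    rw [← key]; ring

theorem inputT (a b c d : Fˣ) : ∃ x y z x' y' z' : F, (x ≠ 0 ∨ y ≠ 0 ∨ z ≠ 0 ∨ x' ≠ 0 ∨ y' ≠ 0 ∨ z' ≠ 0) ∧
    (a : F) * x ^ 2 + b * y ^ 2 - a * b * z ^ 2 = c * x' ^ 2 + d * y' ^ 2 - c * d * z' ^ 2 := by
  obtain ⟨t, ht⟩ := exists_t a b c d
  have fin0 : Rep (a : F) b 0 → ∃ x y z x' y' z' : F, (x ≠ 0 ∨ y ≠ 0 ∨ z ≠ 0 ∨ x' ≠ 0 ∨ y' ≠ 0 ∨ z' ≠ 0) ∧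
    (a : F) * x ^ 2 + b * y ^ 2 - a * b * z ^ 2 = c * x' ^ 2 + d * y' ^ 2 - c * d * z' ^ 2 := by
    rintro ⟨x, y, z, h0, h⟩
    exact ⟨x, y, z, 0, 0, 0, by tauto, by rw [h]; ring⟩
  by_cases hsq : ∃ x : F, x ^ 2 = t
  · obtain ⟨x, hx⟩ := hsq
    have hx0 : x ≠ 0 := by rintro rfl; simp at hx; exact t.ne_zero hx.symm
    have ht2 : t = (Units.mk0 x hx0) ^ 2 := by ext; simpa using hx.symm
    refine fin0 (rep_of_NE (Hasse fun v => ?_))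
    rcases (ht v).1 with h | h
    · exact h
    · have := (Subgroup.div_mem_comm_iff _).1 h
      have h' := mul_mem this (L_le_Nloc a v (by rw [ht2]; exact sq_mem_L _ _ : t ∈ L v))
      simpa using h'
  · push Not at hsq
    obtain ⟨E, _, _, _, Q, rfl⟩ := exists_quad t hsq
    have key : ∀ a b : Fˣ, (∀ v, (b ∈ Nloc a v ∨ Q.a / b ∈ Nloc a v)) → Rep (a : F) b 0 ∨ Rep (a : F) b Q.a := by
      intro a b h
      apply rep_down Q
      have : Q.ι b ∈ NE (Q.ι a) := by
        apply Hasse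
        intro P
        rcases h (resPl F P) with h | h
        · exact Nloc_up P h
        · have h1 := Nloc_up P ((Subgroup.div_mem_comm_iff _).1 h)
          have h2 : Q.ι Q.a ∈ Nloc (Q.ι a) P := by
            rw [← Q.θu_sq]; exact L_le_Nloc _ _ (sq_mem_L _ _)
          have := mul_mem h1 h2
          rw [← map_mul] at this
          simpa using this
      exact rep_of_NE this
    rcases key a b (fun v => (ht v).1) with h | ⟨x, y, z, h0, h⟩
    · exact fin0 h
    · rcases key c d (fun v => (ht v).2) with ⟨x', y', z', h0', h'⟩ | ⟨x', y', z', h0', h'⟩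
      · exact ⟨0, 0, 0, x', y', z', by tauto, by rw [h']; ring⟩
      · exact ⟨x, y, z, x', y', z', by tauto, by rw [h, h']⟩
end
end BQ

namespace BQ
open Module

section
set_option linter.unusedSectionVars false
variable {K D : Type*} [Field K] [CharZero K] [DivisionRing D] [Algebra K D]

theorem mem_cen {s : Set D} {z : D} : z ∈ Subalgebra.centralizer K s ↔ ∀ g ∈ s, g * z = z * g :=
  Subalgebra.mem_centralizer_iff K

theorem inv_mem_cen {s : Set D} {z : D} (h : z ∈ Subalgebra.centralizer K s) : z⁻¹ ∈ Subalgebra.centralizer K s := by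
  rw [mem_cen] at h ⊢
  intro g hg
  by_cases hz : z = 0
  · simp [hz]
  · exact (Commute.inv_right₀ (show Commute g z from h g hg))

theorem two_nz' (K : Type*) {D : Type*} [Field K] [CharZero K] [DivisionRing D] [Algebra K D] : (2 : D) ≠ 0 := by
  have h : (algebraMap K D 2) ≠ 0 := by
    rw [Ne, map_eq_zero]; exact two_ne_zero
  rwa [map_ofNat] at h

/-- decomposition with respect to conjugation by e -/
theorem decomp (K : Type*) {D : Type*} [Field K] [CharZero K] [DivisionRing D] [Algebra K D]
    {s : Set D} {e : D} (he0 : e ≠ 0) (he : e ∈ Subalgebra.centralizer K s) {x : D} (hx : x ∈ Subalgebra.centralizer K s)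
    (hex : e ^ 2 * x = x * e ^ 2) : ∃ m n, x = m + n ∧ m ∈ Subalgebra.centralizer K s ∧ n ∈ Subalgebra.centralizer K s ∧
      e * m = m * e ∧ e * n = - (n * e) := by
  have h2 := two_nz' K (D := D)
  have hin : (2⁻¹ : D) = algebraMap K D 2⁻¹ := by rw [map_inv₀, map_ofNat]
  have hc : ∀ z : D, (2⁻¹ : D) * z = z * 2⁻¹ := fun z => by rw [hin]; exact Algebra.commutes _ _
  have hmem : (2⁻¹ : D) ∈ Subalgebra.centralizer K s := by rw [hin]; exact Subalgebra.algebraMap_mem _ _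
  have e1 : e * (e * x * e⁻¹) = x * e := by
    have : e * (e * x * e⁻¹) = e ^ 2 * x * e⁻¹ := by rw [pow_two]; simp only [mul_assoc]
    rw [this, hex, pow_two, mul_assoc, mul_assoc, mul_inv_cancel₀ he0, mul_one]
  have e2 : (e * x * e⁻¹) * e = e * x := by rw [mul_assoc, inv_mul_cancel₀ he0, mul_one]
  have hcx := mul_mem (mul_mem he hx) (inv_mem_cen he)
  refine ⟨2⁻¹ * (x + e * x * e⁻¹), 2⁻¹ * (x - e * x * e⁻¹), ?_, mul_mem hmem (add_mem hx hcx), mul_mem hmem (sub_mem hx hcx), ?_, ?_⟩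
  · rw [← mul_add, add_add_sub_cancel, ← two_mul, inv_mul_cancel_left₀ h2]
  · rw [← mul_assoc, ← hc, mul_assoc, mul_add, e1, mul_assoc, add_mul, e2, add_comm]
  · rw [← mul_assoc, ← hc, mul_assoc, mul_sub, e1, mul_assoc, sub_mul, e2, ← mul_neg, neg_sub]

theorem half [FiniteDimensional K D] (s : Set D) {e y : D} (he0 : e ≠ 0) (he : e ∈ Subalgebra.centralizer K s) (hy : y ∈ Subalgebra.centralizer K s)
    (hy0 : y ≠ 0) (hye : e * y = -(y * e)) (hec : ∀ x ∈ Subalgebra.centralizer K s, e ^ 2 * x = x * e ^ 2) :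
    finrank K (Subalgebra.centralizer K s) = 2 * finrank K (Subalgebra.centralizer K (insert e s)) := by
  have hle : Subalgebra.centralizer K (insert e s) ≤ Subalgebra.centralizer K s :=
    Subalgebra.centralizer_le K _ _ (Set.subset_insert _ _)
  let φ : (Subalgebra.centralizer K (insert e s) × Subalgebra.centralizer K (insert e s)) →ₗ[K] Subalgebra.centralizer K s :=
    { toFun := fun p => ⟨p.1 + p.2 * y, add_mem (hle p.1.2) (mul_mem (hle p.2.2) hy)⟩
      map_add' := fun p q => by ext; simp [add_mul]; abel
      map_smul' := fun c p => by ext; simp }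
  have hce : ∀ m ∈ Subalgebra.centralizer K (insert e s), e * m = m * e := fun m hm => mem_cen.1 hm e (Set.mem_insert _ _)
  have hbij : Function.Bijective φ := by
    constructor
    · rw [← LinearMap.ker_eq_bot, LinearMap.ker_eq_bot']
      rintro ⟨⟨m, hm⟩, ⟨n, hn⟩⟩ h
      have h1 : m + n * y = 0 := congrArg Subtype.val h
      have h2 : (m - n * y) * e = 0 := by
        have := congrArg (fun z => e * z) h1
        simp only [mul_add, mul_zero] at this
        rw [← mul_assoc, hce m hm, hce n hn, mul_assoc, hye] at this
        rw [← this, sub_mul, mul_neg, sub_eq_add_neg, mul_assoc]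
      have h3 : m - n * y = 0 := (mul_eq_zero.1 h2).resolve_right he0
      have h4 : (2 : D) * m = 0 := by rw [two_mul]; calc m + m = (m + n * y) + (m - n * y) := by abel
        _ = 0 := by rw [h1, h3, add_zero]
      have hm0 : m = 0 := (mul_eq_zero.1 h4).resolve_left (two_nz' K)
      have hn0 : n = 0 := by
        rw [hm0, zero_add] at h1
        exact (mul_eq_zero.1 h1).resolve_right hy0
      subst hm0; subst hn0; rfl
    · rintro ⟨x, hx⟩
      obtain ⟨m, n, rfl, hm, hn, h1, h2⟩ := decomp K he0 he hx (hec x hx)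
      refine ⟨⟨⟨m, ?_⟩, ⟨n * y⁻¹, ?_⟩⟩, ?_⟩
      · rw [mem_cen]
        intro g hg
        rcases Set.mem_insert_iff.1 hg with rfl | hg
        · exact h1
        · exact mem_cen.1 hm g hg
      · rw [mem_cen]
        intro g hg
        rcases Set.mem_insert_iff.1 hg with rfl | hg
        · rw [← mul_assoc, h2]
          have : g * y⁻¹ = -(y⁻¹ * g) := by
            have h := congrArg (fun z => y⁻¹ * z * y⁻¹) hye
            simp only [mul_neg, neg_mul] at h
            rw [← mul_assoc, mul_assoc _ y, mul_inv_cancel₀ hy0, mul_one, ← mul_assoc, inv_mul_cancel₀ hy0, one_mul] at h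
            rw [h, neg_neg]
          rw [mul_assoc n, neg_mul, mul_assoc, this, mul_neg, neg_neg]
        · exact mem_cen.1 (mul_mem hn (inv_mem_cen hy)) g hg
      · ext
        simp [φ, hy0]
  rw [← (LinearEquiv.ofBijective φ hbij).finrank_eq, finrank_prod, two_mul]

end
end BQ

namespace BQ
open Module

section
set_option linter.unusedSectionVars false
variable {D : Type*} [DivisionRing D]

/-- commuting with i -/
def Cm (i x : D) : Prop := i * x = x * i
/-- anticommuting with i -/
def Wm (i x : D) : Prop := i * x = -(x * i)

variable {i x y : D}
theorem Cm.mul (hx : Cm i x) (hy : Cm i y) : Cm i (x * y) := by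
  unfold Cm at *; rw [← mul_assoc, hx, mul_assoc, hy, mul_assoc]
theorem Cm.mulW (hx : Cm i x) (hy : Wm i y) : Wm i (x * y) := by
  unfold Cm Wm at *; rw [← mul_assoc, hx, mul_assoc, hy, mul_neg, mul_assoc]
theorem Wm.mulC (hx : Wm i x) (hy : Cm i y) : Wm i (x * y) := by
  unfold Cm Wm at *; rw [← mul_assoc, hx, neg_mul, mul_assoc, hy, mul_assoc]
theorem Wm.mul (hx : Wm i x) (hy : Wm i y) : Cm i (x * y) := by
  unfold Cm Wm at *; rw [← mul_assoc, hx, neg_mul, mul_assoc, hy, mul_neg, neg_neg, mul_assoc]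
theorem Cm.inv (hx : Cm i x) : Cm i x⁻¹ := by
  by_cases h : x = 0
  · simp [h, Cm]
  · exact Commute.inv_right₀ (show Commute i x from hx)
theorem Wm.inv (hx : Wm i x) : Wm i x⁻¹ := by
  by_cases h0 : x = 0
  · simp [h0, Wm]
  · unfold Wm at *
    have h := congrArg (fun z => x⁻¹ * z * x⁻¹) hx
    simp only [mul_neg, neg_mul] at h
    rw [← mul_assoc, mul_assoc _ x, mul_inv_cancel₀ h0, mul_one, ← mul_assoc, inv_mul_cancel₀ h0, one_mul] at h
    rw [h, neg_neg]
theorem Cm.add (hx : Cm i x) (hy : Cm i y) : Cm i (x + y) := by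
  unfold Cm at *; rw [mul_add, add_mul, hx, hy]
theorem Cm.sub (hx : Cm i x) (hy : Cm i y) : Cm i (x - y) := by
  unfold Cm at *; rw [mul_sub, sub_mul, hx, hy]
theorem Cm.neg (hx : Cm i x) : Cm i (-x) := by
  unfold Cm at *; rw [mul_neg, neg_mul, hx]
theorem Wm.add (hx : Wm i x) (hy : Wm i y) : Wm i (x + y) := by
  unfold Wm at *; rw [mul_add, add_mul, hx, hy, neg_add]
theorem Wm.neg (hx : Wm i x) : Wm i (-x) := by
  unfold Wm at *; rw [mul_neg, neg_mul, hx]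
theorem Cm.refl (i : D) : Cm i i := rfl
theorem Cm.symm (h : Cm x y) : Cm y x := Eq.symm h
theorem Wm.symm (h : Wm x y) : Wm y x := by unfold Wm at *; rw [h, neg_neg]
/-- conjugation -/
def cj (y x : D) : D := y * x * y⁻¹
theorem cj_mul_self (hy : y ≠ 0) : cj y x * y = y * x := by
  unfold cj; rw [mul_assoc, inv_mul_cancel₀ hy, mul_one]
theorem Wm.cj (hy : Wm i y) (hx : Cm i x) : Cm i (cj y x) := (hy.mulC hx).mul hy.inv
theorem Cm.cj (hy : Cm i y) (hx : Cm i x) : Cm i (cj y x) := (hy.mul hx).mul hy.inv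
theorem cj_add (y x z : D) : cj y (x + z) = cj y x + cj y z := by unfold cj; rw [mul_add, add_mul]
theorem cj_neg (y x : D) : cj y (-x) = -cj y x := by unfold cj; rw [mul_neg, neg_mul]
theorem cj_mul (hy : y ≠ 0) (x z : D) : cj y (x * z) = cj y x * cj y z := by
  unfold cj; simp only [mul_assoc, inv_mul_cancel_left₀ hy]
theorem cj_cj (y z x : D) : cj y (cj z x) = cj (y * z) x := by
  unfold cj; rw [mul_inv_rev]; simp only [mul_assoc]
theorem cj_of_comm (hy : y ≠ 0) (h : Cm y x) : cj y x = x := by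
  unfold cj Cm at *; rw [h, mul_assoc, mul_inv_cancel₀ hy, mul_one]
theorem cj_of_anti (hy : y ≠ 0) (h : Wm y x) : cj y x = -x := by
  unfold cj Wm at *; rw [h, neg_mul, mul_assoc, mul_inv_cancel₀ hy, mul_one]
theorem comm_of_cj (hy : y ≠ 0) (h : cj y x = x) : Cm y x := by
  unfold Cm; rw [← cj_mul_self hy, h]
theorem anti_of_cj (hy : y ≠ 0) (h : cj y x = -x) : Wm y x := by
  unfold Wm; rw [← cj_mul_self hy, h, neg_mul]
theorem cj_inj (hy : y ≠ 0) {x z : D} (h : cj y x = cj y z) : x = z := by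
  unfold cj at h
  exact mul_left_cancel₀ hy (mul_right_cancel₀ (inv_ne_zero hy) h)

/-- center of the centralizer of i -/
def Zc (i z : D) : Prop := ∀ x, Cm i x → z * x = x * z

variable {z w : D}
theorem Zc.comm (hz : Zc i z) : Cm i z := (hz i (Cm.refl i)).symm
theorem Zc.add (hz : Zc i z) (hw : Zc i w) : Zc i (z + w) := fun x hx => by rw [add_mul, mul_add, hz x hx, hw x hx]
theorem Zc.sub (hz : Zc i z) (hw : Zc i w) : Zc i (z - w) := fun x hx => by rw [sub_mul, mul_sub, hz x hx, hw x hx]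
theorem Zc.neg (hz : Zc i z) : Zc i (-z) := fun x hx => by rw [neg_mul, mul_neg, hz x hx]
theorem Zc.mul (hz : Zc i z) (hw : Zc i w) : Zc i (z * w) := fun x hx => by
  rw [mul_assoc, hw x hx, ← mul_assoc, hz x hx, mul_assoc]
theorem Zc.inv (hz : Zc i z) : Zc i z⁻¹ := fun x hx => by
  exact (Cm.inv (i := x) (hz x hx).symm).symm
theorem Zc.self (i : D) : Zc i i := fun _ hx => hx
theorem Zc.cjW (hz : Zc i z) (hy : Wm i y) (hy0 : y ≠ 0) : Zc i (BQ.cj y z) := by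
  intro x hx
  have h := hz (BQ.cj y⁻¹ x) (hy.inv.cj hx)
  have h' := congrArg (BQ.cj y) h
  rw [cj_mul hy0, cj_mul hy0, cj_cj, mul_inv_cancel₀ hy0] at h'
  simpa [BQ.cj] using h'

variable {K : Type*} [Field K] [CharZero K] [Algebra K D]

theorem Zc.alg (c : K) : Zc i (algebraMap K D c) := fun _ _ => Algebra.commutes _ _
theorem alg_Cm (c : K) : Cm i (algebraMap K D c) := (Algebra.commutes _ _).symm
theorem alg_Cm' (c : K) : Cm (algebraMap K D c) i := (Algebra.commutes _ _)

theorem split_CW (K : Type*) [Field K] [CharZero K] [Algebra K D] (hi0 : i ≠ 0) (hi : ∀ x : D, i ^ 2 * x = x * i ^ 2) (x : D) : ∃ m n, x = m + n ∧ Cm i m ∧ Wm i n := by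
  obtain ⟨m, n, h, -, -, h1, h2⟩ := decomp K (s := (∅ : Set D)) hi0 (mem_cen.2 fun g hg => hg.elim) (x := x) (mem_cen.2 fun g hg => hg.elim) (hi x)
  exact ⟨m, n, h, h1, h2⟩

theorem Zc.central (K : Type*) [Field K] [CharZero K] [Algebra K D] (hi0 : i ≠ 0) (hi : ∀ x : D, i ^ 2 * x = x * i ^ 2) (hz : Zc i z) (hy : Wm i y) (hy0 : y ≠ 0)
    (hc : Cm y z) (x : D) : z * x = x * z := by
  obtain ⟨m, n, rfl, hm, hn⟩ := split_CW K hi0 hi x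
  have h1 := hz m hm
  have h2 := hz (n * y⁻¹) (hn.mul hy.inv)
  have h3 : z * n = n * z := by
    have := congrArg (fun t => t * y) h2
    rw [← mul_assoc, mul_assoc (z * n), inv_mul_cancel₀ hy0, mul_one, mul_assoc, ← hc, mul_assoc, inv_mul_cancel_left₀ hy0] at this
    exact this
  rw [mul_add, add_mul, h1, h3]

theorem Zc.coord {a : K} (hcen : ∀ z : D, (∀ x, z * x = x * z) → ∃ k : K, z = algebraMap K D k)
    (hi0 : i ≠ 0) (hi : i ^ 2 = algebraMap K D a) (hy : Wm i y) (hy0 : y ≠ 0) (hz : Zc i z) :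
    ∃ p q : K, z = algebraMap K D p + algebraMap K D q * i := by
  have hi' : ∀ x : D, i ^ 2 * x = x * i ^ 2 := fun x => by rw [hi]; exact Algebra.commutes _ _
  have h2 := two_nz' K (D := D)
  have hzy := hz.cjW hy hy0
  have hyy : BQ.cj y (BQ.cj y z) = z := by
    rw [cj_cj]
    exact cj_of_comm (mul_ne_zero hy0 hy0) (hz _ (hy.mul hy)).symm
  obtain ⟨p, hp⟩ := hcen _ ((hz.add hzy).central K hi0 hi' hy hy0 (comm_of_cj hy0 (by rw [cj_add, hyy, add_comm])))
  obtain ⟨q, hq⟩ := hcen _ (((Zc.self i).mul (hz.sub hzy)).central K hi0 hi' hy hy0 (comm_of_cj hy0 (by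
    rw [cj_mul hy0, cj_of_anti hy0 hy.symm, sub_eq_add_neg, cj_add, cj_neg, hyy, neg_mul, ← mul_neg]
    congr 1; abel)))
  have ha0 : a ≠ 0 := by
    rintro rfl; rw [map_zero] at hi; exact hi0 (by simpa using hi)
  have h3 : z - BQ.cj y z = algebraMap K D (q / a) * i := by
    have : i * (i * (z - BQ.cj y z)) = i * algebraMap K D q := by rw [hq]
    rw [← mul_assoc, ← pow_two, hi, ← Algebra.commutes] at this
    rw [div_eq_inv_mul, map_mul, mul_assoc, ← this, ← mul_assoc, ← map_mul, inv_mul_cancel₀ ha0, map_one, one_mul]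
  refine ⟨p / 2, q / a / 2, ?_⟩
  have h4 : (2 : D) * z = algebraMap K D p + algebraMap K D (q / a) * i := by
    rw [← h3, ← hp, two_mul]; abel
  rw [div_eq_inv_mul, div_eq_inv_mul _ (2 : K), map_mul, map_mul, mul_assoc, ← mul_add, ← h4, map_inv₀, map_ofNat, inv_mul_cancel_left₀ h2]

end
end BQ

namespace BQ
open Module

section
set_option linter.unusedSectionVars false

theorem finrank_dvd {K D : Type*} [Field K] [DivisionRing D] [Algebra K D] [FiniteDimensional K D] (E : Subalgebra K D) :
    finrank K E ∣ finrank K D := by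
  let _ : DivisionRing E := divisionRingOfFiniteDimensional K E
  exact ⟨_, (Module.finrank_mul_finrank K E D).symm⟩

/-- basic context: degree four, with a quadratic element -/
structure Ctx {K D : Type*} [Field K] [DivisionRing D] [Algebra K D] (i : D) (a : K) : Prop where
  cen : ∀ z : D, (∀ x, z * x = x * z) → ∃ k : K, z = algebraMap K D k
  dim : finrank K D = 16
  sq : i ^ 2 = algebraMap K D a
  nk : ∀ k : K, i ≠ algebraMap K D k

variable {K D : Type*} [Field K] [CharZero K] [DivisionRing D] [Algebra K D] {i : D} {a : K}

theorem comm_anti {p x : D} (h : p ^ 2 * x = x * p ^ 2) : Wm p (x * p - p * x) := by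
  unfold Wm
  rw [pow_two] at h
  simp only [mul_sub, sub_mul, neg_sub, ← mul_assoc]
  rw [h]; simp only [← mul_assoc]

theorem Ctx.i0 (h : Ctx i a) : i ≠ 0 := fun h0 => h.nk 0 (by rw [h0, map_zero])
theorem Ctx.sqc (h : Ctx i a) (x : D) : i ^ 2 * x = x * i ^ 2 := by rw [h.sq]; exact Algebra.commutes _ _
theorem Ctx.ex_y (h : Ctx i a) : ∃ y, y ≠ 0 ∧ Wm i y := by
  have : ¬ ∀ x, i * x = x * i := fun hh => by
    obtain ⟨k, hk⟩ := h.cen i hh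
    exact h.nk k hk
  push Not at this
  obtain ⟨x, hx⟩ := this
  exact ⟨x * i - i * x, fun hh => hx (sub_eq_zero.1 hh).symm, comm_anti (h.sqc x)⟩
theorem Ctx.coord (h : Ctx i a) {z : D} (hz : Zc i z) : ∃ p q : K, z = algebraMap K D p + algebraMap K D q * i := by
  obtain ⟨y, hy0, hy⟩ := h.ex_y
  exact Zc.coord h.cen h.i0 h.sq hy hy0 hz
theorem Ctx.scal (h : Ctx i a) {z y : D} (hz : Zc i z) (hy : Wm i y) (hy0 : y ≠ 0) (hc : Cm y z) : ∃ k : K, z = algebraMap K D k :=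
  h.cen z (hz.central K h.i0 h.sqc hy hy0 hc)
theorem mem_cen1 {i x : D} : x ∈ Subalgebra.centralizer K (insert i (∅ : Set D)) ↔ Cm i x := by
  rw [mem_cen]; simp [Cm]
theorem mem_cen2 {i u x : D} : x ∈ Subalgebra.centralizer K (insert u (insert i (∅ : Set D))) ↔ Cm u x ∧ Cm i x := by
  rw [mem_cen]; simp [Cm]

theorem Ctx.dimC [FiniteDimensional K D] (h : Ctx i a) : finrank K (Subalgebra.centralizer K (insert i (∅ : Set D))) = 8 := by
  obtain ⟨y, hy0, hy⟩ := h.ex_y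
  have := half (K := K) (∅ : Set D) h.i0 (mem_cen.2 fun g hg => hg.elim) (mem_cen.2 fun g hg => hg.elim) hy0 hy (fun x _ => h.sqc x)
  have e : Subalgebra.centralizer K (∅ : Set D) = ⊤ := by
    rw [eq_top_iff]; intro x _; exact mem_cen.2 fun g hg => hg.elim
  rw [e, Subalgebra.topEquiv.toLinearEquiv.finrank_eq, h.dim] at this
  omega

theorem Ctx.span4 [FiniteDimensional K D] (h : Ctx i a) {S : Subalgebra K D} (hi : i ∈ S) {x : D} (hx : x ∈ S)
    (hxz : ¬ Zc i x) : LinearIndependent K ![1, i, x, i * x] ∧ (finrank K S = 4 → ∀ z ∈ S, ∃ α β, Zc i α ∧ Zc i β ∧ z = α + β * x) := by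
  have hz : ∀ p q : K, Zc i (algebraMap K D p + algebraMap K D q * i) := fun p q => (Zc.alg p).add ((Zc.alg q).mul (Zc.self i))
  have h0 : ∀ p q : K, algebraMap K D p + algebraMap K D q * i = 0 → p = 0 ∧ q = 0 := by
    intro p q hpq
    by_cases hq : q = 0
    · subst hq
      simp only [map_zero, zero_mul, add_zero] at hpq
      exact ⟨(map_eq_zero _).1 hpq, rfl⟩
    · exfalso
      apply h.nk (q⁻¹ * -p)
      have : algebraMap K D q * i = - algebraMap K D p := by rw [eq_neg_iff_add_eq_zero, add_comm]; exact hpq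
      rw [map_mul, map_neg, ← this, ← mul_assoc, ← map_mul, inv_mul_cancel₀ hq, map_one, one_mul]
  have li : LinearIndependent K ![1, i, x, i * x] := by
    rw [Fintype.linearIndependent_iff]
    intro g hg
    simp only [Fin.sum_univ_four, Algebra.smul_def, Matrix.cons_val] at hg
    have e : (algebraMap K D (g 0) + algebraMap K D (g 1) * i) + (algebraMap K D (g 2) + algebraMap K D (g 3) * i) * x = 0 := by
      rw [← hg, add_mul]; simp only [mul_one, mul_assoc, add_assoc]
    have e2 : algebraMap K D (g 2) + algebraMap K D (g 3) * i = 0 := by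
      by_contra hne
      apply hxz
      have : x = (algebraMap K D (g 2) + algebraMap K D (g 3) * i)⁻¹ * -(algebraMap K D (g 0) + algebraMap K D (g 1) * i) := by
        rw [eq_inv_mul_iff_mul_eq₀ hne, eq_neg_iff_add_eq_zero, add_comm]; exact e
      rw [this]
      exact (hz _ _).inv.mul (hz _ _).neg
    rw [e2, zero_mul, add_zero] at e
    obtain ⟨a1, a2⟩ := h0 _ _ e
    obtain ⟨a3, a4⟩ := h0 _ _ e2
    intro j; fin_cases j <;> assumption
  refine ⟨li, fun h4 z hzS => ?_⟩
  have hle : Submodule.span K (Set.range ![1, i, x, i * x]) ≤ Subalgebra.toSubmodule S := by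
    rw [Submodule.span_le]
    rintro _ ⟨j, rfl⟩
    fin_cases j
    · exact one_mem S
    · exact hi
    · exact hx
    · exact S.mul_mem hi hx
  have heq := Submodule.eq_of_le_of_finrank_eq hle (by
    rw [finrank_span_eq_card li]; exact h4.symm)
  have hzz : z ∈ Submodule.span K (Set.range ![1, i, x, i * x]) := by rw [heq]; exact hzS
  obtain ⟨g, hg⟩ := (Submodule.mem_span_range_iff_exists_fun K).1 hzz
  simp only [Fin.sum_univ_four, Algebra.smul_def, Matrix.cons_val] at hg
  exact ⟨_, _, hz (g 0) (g 1), hz (g 2) (g 3), by rw [← hg, add_mul]; simp only [mul_one, mul_assoc, add_assoc]⟩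

theorem Ctx.ex_nz [FiniteDimensional K D] (h : Ctx i a) : ∃ x, Cm i x ∧ ¬ Zc i x := by
  by_contra hh
  push Not at hh
  have hle : Subalgebra.toSubmodule (Subalgebra.centralizer K (insert i (∅ : Set D))) ≤ Submodule.span K (Set.range ![1, i]) := by
    intro x hx
    obtain ⟨p, q, rfl⟩ := h.coord (hh x ((mem_cen1 (K := K)).1 hx))
    rw [Submodule.mem_span_range_iff_exists_fun]
    exact ⟨![p, q], by simp [Algebra.smul_def]⟩
  have h1 := Submodule.finrank_mono hle
  have h2 := finrank_range_le_card (R := K) ![(1 : D), i]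
  have h3 := h.dimC
  rw [Set.finrank] at h2
  change finrank K (Subalgebra.centralizer K (insert i (∅ : Set D))) ≤ _ at h1
  simp at h2
  omega

theorem Ctx.ex_u [FiniteDimensional K D] (h : Ctx i a) : ∃ u, Cm i u ∧ ¬ Zc i u ∧ Zc i (u ^ 2) := by
  obtain ⟨x, hx, hxz⟩ := h.ex_nz
  let E := Algebra.adjoin K ({i, x} : Set D)
  have hiE : i ∈ E := Algebra.subset_adjoin (by simp)
  have hxE : x ∈ E := Algebra.subset_adjoin (by simp)
  have hEC : E ≤ Subalgebra.centralizer K (insert i (∅ : Set D)) := by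
    apply Algebra.adjoin_le
    rintro z (rfl | rfl)
    · exact mem_cen1.2 (Cm.refl _)
    · exact mem_cen1.2 hx
  have hEx : E ≤ Subalgebra.centralizer K (insert x (∅ : Set D)) := by
    apply Algebra.adjoin_le
    rintro z (rfl | rfl)
    · exact mem_cen1.2 hx.symm
    · exact mem_cen1.2 (Cm.refl _)
  obtain ⟨li, h4⟩ := h.span4 hiE hxE hxz
  have hge : 4 ≤ finrank K E := by
    have hle : Submodule.span K (Set.range ![1, i, x, i * x]) ≤ Subalgebra.toSubmodule E := by
      rw [Submodule.span_le]
      rintro _ ⟨j, rfl⟩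
      fin_cases j
      · exact one_mem E
      · exact hiE
      · exact hxE
      · exact E.mul_mem hiE hxE
    have := Submodule.finrank_mono hle
    rw [finrank_span_eq_card li] at this
    exact this
  have hle8 : finrank K E ≤ 8 := by
    rw [← h.dimC]; exact Submodule.finrank_mono (s := Subalgebra.toSubmodule E) (t := Subalgebra.toSubmodule (Subalgebra.centralizer K (insert i (∅ : Set D)))) hEC
  have hdvd : finrank K E ∣ 16 := by rw [← h.dim]; exact finrank_dvd E
  have hne8 : finrank K E ≠ 8 := by
    intro h8
    apply hxz
    have heq := Submodule.eq_of_le_of_finrank_eq (S₁ := Subalgebra.toSubmodule E) (S₂ := Subalgebra.toSubmodule (Subalgebra.centralizer K (insert i (∅ : Set D)))) hEC (h8.trans h.dimC.symm)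
    intro z hz
    have : z ∈ Subalgebra.toSubmodule E := by rw [heq]; exact (mem_cen1 (K := K)).2 hz
    exact mem_cen1.1 (hEx this)
  have hE4 : finrank K E = 4 := by
    generalize finrank K E = N at *
    interval_cases N <;> first | rfl | omega
  obtain ⟨α, β, hα, hβ, hsq⟩ := h4 hE4 (x ^ 2) (pow_mem hxE 2)
  have h2 := two_nz' K (D := D)
  have hz2 : Zc i (2⁻¹ : D) := by
    have : (2⁻¹ : D) = algebraMap K D 2⁻¹ := by rw [map_inv₀, map_ofNat]
    rw [this]; exact Zc.alg _
  have hγ := hz2.mul hβ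
  set γ := 2⁻¹ * β with hγd
  have hβγ : β = γ + γ := by rw [hγd, ← two_mul, mul_inv_cancel_left₀ h2]
  refine ⟨x - γ, hx.sub hγ.comm, fun hh => hxz (by simpa using hh.add hγ), ?_⟩
  have : (x - γ) ^ 2 = α + γ * γ := by
    rw [pow_two, sub_mul, mul_sub, mul_sub, ← pow_two, hsq, hβγ, add_mul, ← hγ x hx]; abel
  rw [this]
  exact hα.add (hγ.mul hγ)

theorem Zc.cenS {u x : D} (h : Zc i (u ^ 2)) (hx : x ∈ Subalgebra.centralizer K (insert i (∅ : Set D))) : u ^ 2 * x = x * u ^ 2 :=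
  h x (mem_cen1.1 hx)

theorem ex_v {u : D} (hu : Cm i u) (hnu : ¬ Zc i u) (hu2 : Zc i (u ^ 2)) : ∃ v, v ≠ 0 ∧ Cm i v ∧ Wm u v := by
  unfold Zc at hnu
  push Not at hnu
  obtain ⟨x, hx, hux⟩ := hnu
  exact ⟨x * u - u * x, fun hh => hux (sub_eq_zero.1 hh).symm, (hx.mul hu).sub (hu.mul hx), comm_anti (hu2 x hx)⟩

theorem Ctx.M [FiniteDimensional K D] (h : Ctx i a) {u v : D} (hu : Cm i u) (hnu : ¬ Zc i u) (hu2 : Zc i (u ^ 2))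
    (hv0 : v ≠ 0) (hv : Cm i v) (huv : Wm u v) {z : D} (hz : Cm i z) (hz' : Cm u z) : ∃ α β, Zc i α ∧ Zc i β ∧ z = α + β * u := by
  have hu0 : u ≠ 0 := by rintro rfl; exact hnu (fun x _ => by simp)
  have := half (K := K) (insert i (∅ : Set D)) hu0 (mem_cen1.2 hu) (mem_cen1.2 hv) hv0 huv (fun x hx => hu2.cenS hx)
  rw [h.dimC] at this
  exact (h.span4 (mem_cen2.2 ⟨hu.symm, Cm.refl i⟩) (mem_cen2.2 ⟨Cm.refl u, hu⟩) hnu).2 (by omega) z (mem_cen2.2 ⟨hz', hz⟩)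

/-- a central quadratic coefficient with respect to u commuting with v has no u part -/
theorem Ctx.Mv [FiniteDimensional K D] (h : Ctx i a) {u v : D} (hu : Cm i u) (hnu : ¬ Zc i u) (hu2 : Zc i (u ^ 2))
    (hv0 : v ≠ 0) (hv : Cm i v) (huv : Wm u v) {z : D} (hz : Cm i z) (hz' : Cm u z) (hz'' : Cm v z) : Zc i z := by
  have hu0 : u ≠ 0 := by rintro rfl; exact hnu (fun x _ => by simp)
  obtain ⟨α, β, hα, hβ, rfl⟩ := h.M hu hnu hu2 hv0 hv huv hz hz'
  have e := cj_of_comm hv0 hz''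
  rw [cj_add, cj_mul hv0, cj_of_comm hv0 (hα v hv).symm, cj_of_comm hv0 (hβ v hv).symm, cj_of_anti hv0 huv.symm, add_right_inj, mul_neg, neg_eq_iff_add_eq_zero, ← two_mul] at e
  have := (mul_eq_zero.1 e).resolve_left (two_nz' K)
  rw [this, add_zero]; exact hα

theorem splitC (K : Type*) [Field K] [CharZero K] [Algebra K D] {u v x : D} (hu : Cm i u) (hu0 : u ≠ 0) (hu2 : Zc i (u ^ 2))
    (hv0 : v ≠ 0) (hv : Cm i v) (huv : Wm u v) (hx : Cm i x) : ∃ m n, Cm i m ∧ Cm u m ∧ Cm i n ∧ Cm u n ∧ x = m + n * v := by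
  obtain ⟨m, n, h, h1, h2, h3, h4⟩ := decomp K (s := insert i (∅ : Set D)) hu0 (mem_cen1.2 hu) (mem_cen1.2 hx) (hu2 x hx)
  refine ⟨m, n * v⁻¹, mem_cen1.1 h1, h3, (mem_cen1.1 h2).mul hv.inv, Wm.mul h4 huv.inv, ?_⟩
  rw [mul_assoc, inv_mul_cancel₀ hv0, mul_one, h]

end
end BQ

namespace BQ
open Module

section
set_option linter.unusedSectionVars false
variable {K D : Type*} [Field K] [CharZero K] [DivisionRing D] [Algebra K D] {i : D} {a : K}

/-- unital linear antihomomorphism -/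
structure Anti (f : D →ₗ[K] D) : Prop where
  one : f 1 = 1
  mul : ∀ x y, f (x * y) = f y * f x

variable {f : D →ₗ[K] D}
theorem Anti.alg (h : Anti f) (c : K) : f (algebraMap K D c) = algebraMap K D c := by
  rw [Algebra.algebraMap_eq_smul_one, map_smul, h.one]
theorem Anti.ne (h : Anti f) {x : D} (hx : x ≠ 0) : f x ≠ 0 := fun h0 => by
  have := h.mul x⁻¹ x
  rw [inv_mul_cancel₀ hx, h.one, h0, zero_mul] at this
  exact one_ne_zero this
theorem Anti.inv (h : Anti f) (x : D) : f x⁻¹ = (f x)⁻¹ := by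
  by_cases hx : x = 0
  · simp [hx]
  · have := h.mul x x⁻¹
    rw [mul_inv_cancel₀ hx, h.one] at this
    exact eq_inv_of_mul_eq_one_left this.symm
theorem Anti.inj (h : Anti f) {x y : D} (hxy : f x = f y) : x = y := by
  by_contra hne
  exact h.ne (sub_ne_zero.2 hne) (by rw [map_sub, hxy, sub_self])
theorem Anti.sq (h : Anti f) (x : D) : f (x ^ 2) = (f x) ^ 2 := by rw [pow_two, h.mul, pow_two]

theorem Anti.twist (h : Anti f) {w : D} (hw : w ≠ 0) : ∃ f' : D →ₗ[K] D, Anti f' ∧ ∀ x, f' x = w⁻¹ * f x * w := by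
  refine ⟨(LinearMap.mulRight K w ∘ₗ LinearMap.mulLeft K w⁻¹) ∘ₗ f, ⟨?_, ?_⟩, ?_⟩
  · simp [h.one, hw]
  · intro x y
    simp only [LinearMap.comp_apply, LinearMap.mulRight_apply, LinearMap.mulLeft_apply, h.mul, mul_assoc, mul_inv_cancel_left₀ hw]
  · intro x; simp

theorem Anti.Cm (h : Anti f) {x y : D} (hc : Cm x y) : Cm (f x) (f y) := by
  unfold BQ.Cm at *; rw [← h.mul, ← h.mul, hc]
theorem Anti.Wm (h : Anti f) {x y : D} (hc : Wm x y) : Wm (f x) (f y) := by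
  unfold BQ.Wm at *; rw [← h.mul, ← h.mul, hc, map_neg, neg_neg]

theorem ex_conj {p q x : D} (hpq : p ^ 2 = q ^ 2) (hc : p ^ 2 * x = x * p ^ 2) (hx : p * x ≠ x * p) :
    ∃ w, w ≠ 0 ∧ w * p = q * w ∧ (w = p + q ∨ w = x * p - p * x) := by
  by_cases h : p + q = 0
  · refine ⟨x * p - p * x, fun hh => hx (sub_eq_zero.1 hh).symm, ?_, Or.inr rfl⟩
    rw [← neg_eq_of_add_eq_zero_right h]
    have := comm_anti hc
    unfold Wm at this
    rw [neg_mul, this, neg_neg]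
  · refine ⟨p + q, h, ?_, Or.inl rfl⟩
    rw [add_mul, mul_add, ← pow_two, ← pow_two, hpq, add_comm]

/-- step 1 -/
theorem Ctx.adj_i (h : Ctx i a) (hf : Anti f) : ∃ f' : D →ₗ[K] D, Anti f' ∧ f' i = i := by
  obtain ⟨y, hy0, hy⟩ := h.ex_y
  have h2 := two_nz' K (D := D)
  obtain ⟨w, hw0, hw, -⟩ := ex_conj (p := i) (q := f i) (x := y) (by rw [← hf.sq, h.sq, hf.alg]) (h.sqc y) (fun hh => by
    unfold Wm at hy
    rw [hy, neg_eq_iff_add_eq_zero, ← two_mul] at hh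
    exact (mul_ne_zero h2 (mul_ne_zero hy0 h.i0)) hh)
  obtain ⟨f', hf', he⟩ := hf.twist hw0
  exact ⟨f', hf', by rw [he, mul_assoc, ← hw, inv_mul_cancel_left₀ hw0]⟩

theorem Ctx.fixZ (h : Ctx i a) (hf : Anti f) (hi : f i = i) {z : D} (hz : Zc i z) : f z = z := by
  obtain ⟨p, q, rfl⟩ := h.coord hz
  rw [map_add, hf.mul, hf.alg, hf.alg, hi]
  congr 1; exact (Algebra.commutes _ _).symm

theorem Ctx.fC (_h : Ctx i a) (hf : Anti f) (hi : f i = i) {x : D} (hx : Cm i x) : Cm i (f x) := by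
  have := hf.Cm hx; rwa [hi] at this
theorem Ctx.fW (_h : Ctx i a) (hf : Anti f) (hi : f i = i) {x : D} (hx : Wm i x) : Wm i (f x) := by
  have := hf.Wm hx; rwa [hi] at this

/-- step 5: f i = i, f u = -u, f v = -v -/
theorem Ctx.adj_uv [FiniteDimensional K D] (h : Ctx i a) (hf : Anti f) (hi : f i = i) : ∃ (f' : D →ₗ[K] D) (u v : D), Anti f' ∧ f' i = i ∧
    Cm i u ∧ ¬ Zc i u ∧ Zc i (u ^ 2) ∧ v ≠ 0 ∧ Cm i v ∧ Wm u v ∧ f' u = -u ∧ f' v = -v := by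
  have h2 := two_nz' K (D := D)
  obtain ⟨u, hu, hnu, hu2⟩ := h.ex_u
  obtain ⟨v, hv0, hv, huv⟩ := ex_v hu hnu hu2
  have hu0 : u ≠ 0 := by rintro rfl; exact hnu (fun x _ => by simp)
  obtain ⟨w, hw0, hw, hw'⟩ := ex_conj (p := u) (q := - f u) (x := v) (by rw [neg_sq, ← hf.sq, h.fixZ hf hi hu2]) (hu2 v hv) (fun hh => by
    unfold Wm at huv
    rw [huv, neg_eq_iff_add_eq_zero, ← two_mul] at hh
    exact (mul_ne_zero h2 (mul_ne_zero hv0 hu0)) hh)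
  have hwi : Cm i w := by
    rcases hw' with rfl | rfl
    · exact hu.add (h.fC hf hi hu).neg
    · exact (hv.mul hu).sub (hu.mul hv)
  obtain ⟨f1, hf1, he1⟩ := hf.twist hw0
  have hi1 : f1 i = i := by rw [he1, hi, mul_assoc, hwi, inv_mul_cancel_left₀ hw0]
  have hu1 : f1 u = -u := by
    rw [he1, mul_assoc, ← neg_eq_iff_eq_neg, ← mul_neg, ← neg_mul, ← hw, inv_mul_cancel_left₀ hw0]
  clear he1 hw hw' hwi hi
  clear hf
  have hfv : Cm i (f1 v) := h.fC hf1 hi1 hv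
  have hfv' : Wm u (f1 v) := by
    have := hf1.Wm huv
    rw [hu1] at this
    unfold Wm at *
    simp only [neg_mul, mul_neg, neg_neg] at this
    rw [← this, neg_neg]
  have hv2 : Zc i (v ^ 2) := by
    rw [pow_two]
    exact h.Mv hu hnu hu2 hv0 hv huv (hv.mul hv) (huv.mul huv) ((Cm.refl v).mul (Cm.refl v))
  obtain ⟨l, hl⟩ : ∃ l, l = f1 v * v⁻¹ := ⟨_, rfl⟩
  have hli : Cm i l := hl ▸ hfv.mul hv.inv
  have hlu : Cm u l := hl ▸ hfv'.mul huv.inv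
  have hlv : f1 v = l * v := by rw [hl, mul_assoc, inv_mul_cancel₀ hv0, mul_one]
  have hll : l * cj v l = 1 := by
    have e : f1 (v ^ 2) = v ^ 2 := h.fixZ hf1 hi1 hv2
    rw [hf1.sq, hlv, pow_two, pow_two, mul_assoc, ← mul_assoc v l, ← cj_mul_self hv0, mul_assoc, ← mul_assoc] at e
    exact mul_right_cancel₀ (mul_ne_zero hv0 hv0) (e.trans (one_mul _).symm)
  obtain ⟨g, hg0, hgi, hgu, hg⟩ : ∃ g, g ≠ 0 ∧ Cm i g ∧ Cm u g ∧ l * cj v g = -g := by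
    by_cases h1 : l = 1
    · exact ⟨u, hu0, hu, Cm.refl u, by rw [h1, one_mul, cj_of_anti hv0 huv.symm]⟩
    · have c1 : cj v 1 = 1 := cj_of_comm hv0 (by simp [Cm])
      refine ⟨1 - l, sub_ne_zero.2 (Ne.symm h1), Cm.sub (by simp [Cm]) hli, Cm.sub (by simp [Cm]) hlu, ?_⟩
      rw [sub_eq_add_neg, cj_add, cj_neg, c1, mul_add, mul_neg, hll, mul_one]; abel
  obtain ⟨f2, hf2, he2⟩ := hf1.twist hg0
  refine ⟨f2, u, v, hf2, ?_, hu, hnu, hu2, hv0, hv, huv, ?_, ?_⟩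
  · rw [he2, hi1, mul_assoc, hgi, inv_mul_cancel_left₀ hg0]
  · rw [he2, hu1, mul_assoc, neg_mul, hgu, mul_neg, inv_mul_cancel_left₀ hg0]
  · rw [he2, hlv, mul_assoc, mul_assoc, ← cj_mul_self hv0, ← mul_assoc l, hg, neg_mul, mul_neg, inv_mul_cancel_left₀ hg0]

/-- the adjusted context -/
structure Ctx2 {K D : Type*} [Field K] [DivisionRing D] [Algebra K D] (i : D) (a : K) (f : D →ₗ[K] D) (u v : D) : Prop where
  h : Ctx i a
  hf : Anti f
  hi : f i = i
  hu : Cm i u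
  hnu : ¬ Zc i u
  hu2 : Zc i (u ^ 2)
  hv0 : v ≠ 0
  hv : Cm i v
  huv : Wm u v
  fu : f u = -u
  fv : f v = -v

variable {u v : D}

theorem Ctx2.u0 (c : Ctx2 i a f u v) : u ≠ 0 := by
  have := c.hnu
  rintro rfl; exact this (fun x _ => by simp)

/-- step 6 -/
theorem Ctx2.P [FiniteDimensional K D] (c : Ctx2 i a f u v) {x : D} (hx : Cm i x) : Zc i (x + f x) ∧ f (f x) = x := by
  have fz : ∀ z, Zc i z → f z = z := fun z hz => c.h.fixZ c.hf c.hi hz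
  have key : ∀ m, Cm i m → Cm u m → ∃ α β, Zc i α ∧ Zc i β ∧ m = α + β * u ∧ f m = α - β * u := by
    intro m h1 h2
    obtain ⟨α, β, hα, hβ, rfl⟩ := c.h.M c.hu c.hnu c.hu2 c.hv0 c.hv c.huv h1 h2
    refine ⟨α, β, hα, hβ, rfl, ?_⟩
    rw [map_add, c.hf.mul, fz α hα, fz β hβ, c.fu, neg_mul, ← hβ u c.hu, sub_eq_add_neg]
  obtain ⟨m, n, hm, hm', hn, hn', rfl⟩ := splitC K c.hu c.u0 c.hu2 c.hv0 c.hv c.huv hx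
  obtain ⟨α, β, hα, hβ, rfl, e1⟩ := key m hm hm'
  obtain ⟨γ, δ, hγ, hδ, rfl, e2⟩ := key n hn hn'
  have hvu := c.huv.symm
  unfold Wm at hvu
  have e3 : f ((γ + δ * u) * v) = - ((γ + δ * u) * v) := by
    rw [c.hf.mul, e2, c.fv, neg_mul, mul_sub, add_mul, ← hγ v c.hv, ← mul_assoc v, ← hδ v c.hv, mul_assoc δ v, hvu, mul_neg, sub_neg_eq_add, mul_assoc]
  have e4 : f (α + β * u + (γ + δ * u) * v) = α - β * u - (γ + δ * u) * v := by
    rw [map_add, e1, e3, ← sub_eq_add_neg]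
  constructor
  · rw [e4]
    have : α + β * u + (γ + δ * u) * v + (α - β * u - (γ + δ * u) * v) = α + α := by abel
    rw [this]; exact hα.add hα
  · rw [e4, map_sub, e3, map_sub, fz α hα, c.hf.mul, fz β hβ, c.fu, neg_mul, ← hβ u c.hu]; abel

theorem Ctx2.fixed [FiniteDimensional K D] (c : Ctx2 i a f u v) {x : D} (hx : Cm i x) (hfx : f x = x) : Zc i x := by
  have h2 := two_nz' K (D := D)
  have := (c.P hx).1
  rw [hfx, ← two_mul] at this
  have hz2 : Zc i (2⁻¹ : D) := by
    have : (2⁻¹ : D) = algebraMap K D 2⁻¹ := by rw [map_inv₀, map_ofNat]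
    rw [this]; exact Zc.alg _
  have := hz2.mul this
  rwa [inv_mul_cancel_left₀ h2] at this

theorem Ctx2.nrm [FiniteDimensional K D] (c : Ctx2 i a f u v) {x : D} (hx : Cm i x) : Zc i (x * f x) :=
  c.fixed (hx.mul (c.h.fC c.hf c.hi hx)) (by rw [c.hf.mul, (c.P hx).2])

theorem Ctx2.xfx [FiniteDimensional K D] (c : Ctx2 i a f u v) {x : D} (hx : Cm i x) : f x * x = x * f x := by
  have h1 := (c.P hx).1 x hx
  rw [add_mul, mul_add, add_right_inj] at h1
  exact h1

end
end BQ

namespace BQ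
open Module

section
set_option linter.unusedSectionVars false
variable {K D : Type*} [Field K] [CharZero K] [DivisionRing D] [Algebra K D] {i : D} {a : K}
variable {f : D →ₗ[K] D} {u v : D}

theorem self_neg (K : Type*) [Field K] [CharZero K] [Algebra K D] {x : D} (h : x = -x) : x = 0 := by
  rw [eq_neg_iff_add_eq_zero, ← two_mul] at h
  exact (mul_eq_zero.1 h).resolve_left (two_nz' K)

theorem Ctx2.cjf [FiniteDimensional K D] (c : Ctx2 i a f u v) {x y : D} (hx : Cm i x) (hy : Wm i y) (hy0 : y ≠ 0) :
    f (cj y x) = cj y (f x) := by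
  have fz : ∀ z, Zc i z → f z = z := fun z hz => c.h.fixZ c.hf c.hi hz
  have hx' := hy.cj hx
  have h1 := (c.P hx').1
  have h2 := (c.P hx).1.cjW hy hy0
  have h3 := c.nrm hx'
  have h4 := (c.nrm hx).cjW hy hy0
  rw [cj_add] at h2
  rw [cj_mul hy0] at h4
  by_contra hne
  have hk := h1.sub h2
  rw [add_sub_add_left_eq_sub] at hk
  have hxk := h3.sub h4
  rw [← mul_sub] at hxk
  have hz := hxk.mul hk.inv
  rw [mul_assoc, mul_inv_cancel₀ (sub_ne_zero.2 hne), mul_one] at hz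
  apply hne
  have hz' := hz.cjW hy.inv (inv_ne_zero hy0)
  rw [cj_cj, inv_mul_cancel₀ hy0] at hz'
  have e : cj 1 x = x := by simp [cj]
  rw [e] at hz'
  rw [fz _ hz, fz _ hz']

theorem Ctx2.fyy [FiniteDimensional K D] (c : Ctx2 i a f u v) {y : D} (hy : Wm i y) (hy0 : y ≠ 0) : Zc i (f y * y) := by
  intro x hx
  have hfx := c.h.fC c.hf c.hi hx
  have h := c.cjf hfx hy hy0
  rw [(c.P hx).2] at h
  unfold cj at h
  rw [c.hf.mul, c.hf.mul, c.hf.inv, (c.P hx).2] at h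
  have h' := congrArg (fun t => f y * t * y) h
  have hfy := c.hf.ne hy0
  simp only [mul_assoc, mul_inv_cancel_left₀ hfy, inv_mul_cancel₀ hy0, mul_one] at h'
  rw [mul_assoc, ← h']

theorem Ctx2.ex_j [FiniteDimensional K D] (c : Ctx2 i a f u v) : ∃ (j : D) (b : K), j ≠ 0 ∧ Wm i j ∧ j ^ 2 = algebraMap K D b := by
  obtain ⟨y, hy0, hy⟩ := c.h.ex_y
  have hz := c.fyy hy hy0
  have e := c.h.fixZ c.hf c.hi hz
  rw [c.hf.mul] at e
  -- f y * f (f y) = f y * y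
  have e2 : f (f y) = y := by
    have := c.hf.mul (f y) y
    rw [c.h.fixZ c.hf c.hi hz] at this
    exact (mul_left_cancel₀ (c.hf.ne hy0) this).symm
  have fin : ∀ j, j ≠ 0 → Wm i j → (f j = j ∨ f j = -j) → ∃ (j : D) (b : K), j ≠ 0 ∧ Wm i j ∧ j ^ 2 = algebraMap K D b := by
    intro j hj0 hj hfj
    have hjz := c.fyy hj hj0
    have hj2 : Zc i (j ^ 2) := by
      rcases hfj with hfj | hfj
      · rw [hfj] at hjz; rwa [pow_two]
      · rw [hfj, neg_mul] at hjz; rw [pow_two, ← neg_neg (j * j)]; exact hjz.neg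
    obtain ⟨b, hb⟩ := c.h.scal hj2 hj hj0 (by rw [pow_two]; exact (Cm.refl j).mul (Cm.refl j))
    exact ⟨j, b, hj0, hj, hb⟩
  by_cases h0 : y + f y = 0
  · exact fin y hy0 hy (Or.inr (neg_eq_of_add_eq_zero_right h0).symm)
  · exact fin (y + f y) h0 (hy.add (c.h.fW c.hf c.hi hy)) (Or.inl (by rw [map_add, e2, add_comm]))

theorem cj_sq {j x : D} {b : K} (hj0 : j ≠ 0) (hj : j ^ 2 = algebraMap K D b) : cj j (cj j x) = x := by
  rw [cj_cj, ← pow_two]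
  exact cj_of_comm (pow_ne_zero 2 hj0) (by rw [hj]; exact alg_Cm' b)

theorem Ctx2.ex_all [FiniteDimensional K D] (c : Ctx2 i a f u v) : ∃ (j u0 v0 : D) (b c d : K), j ≠ 0 ∧ u0 ≠ 0 ∧ v0 ≠ 0 ∧ Wm i j ∧ Wm u0 v0 ∧
    Cm i u0 ∧ Cm i v0 ∧ Cm j u0 ∧ Cm j v0 ∧ j ^ 2 = algebraMap K D b ∧ u0 ^ 2 = algebraMap K D c ∧ v0 ^ 2 = algebraMap K D d := by
  obtain ⟨j, b, hj0, hj, hb⟩ := c.ex_j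
  have hi0 := c.h.i0
  have fin : ∀ x, Cm i x → Cm j x → f x = -x → ∃ k : K, x ^ 2 = algebraMap K D k := by
    intro x hx hjx hfx
    have h1 := c.nrm hx
    rw [hfx, mul_neg, ← pow_two] at h1
    have h2 := h1.neg
    rw [neg_neg] at h2
    exact c.h.scal h2 hj hj0 (by rw [pow_two]; exact hjx.mul hjx)
  have cji : cj j i = -i := cj_of_anti hj0 hj.symm
  obtain ⟨u0, hu00, hu0i, hu0j, hfu0⟩ : ∃ u0, u0 ≠ 0 ∧ Cm i u0 ∧ Cm j u0 ∧ f u0 = -u0 := by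
    by_cases h0 : u + cj j u = 0
    · refine ⟨i * u, mul_ne_zero hi0 c.u0, (Cm.refl i).mul c.hu, comm_of_cj hj0 ?_, ?_⟩
      · rw [cj_mul hj0, cji, ← neg_eq_of_add_eq_zero_right h0, neg_mul_neg]
      · rw [c.hf.mul, c.fu, c.hi, neg_mul, ← c.hu]
    · refine ⟨u + cj j u, h0, c.hu.add (hj.cj c.hu), comm_of_cj hj0 ?_, ?_⟩
      · rw [cj_add, cj_sq hj0 hb, add_comm]
      · rw [map_add, c.cjf c.hu hj hj0, c.fu, cj_neg, neg_add]
  have hu0n : ¬ Zc i u0 := by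
    intro hz
    have := c.h.fixZ c.hf c.hi hz
    rw [hfu0] at this
    exact hu00 (self_neg K this.symm)
  obtain ⟨k, hk⟩ := fin u0 hu0i hu0j hfu0
  obtain ⟨v1, hv10, hv1i, hv1u⟩ := ex_v hu0i hu0n (by rw [hk]; exact Zc.alg k)
  obtain ⟨v0, hv00, hv0i, hv0j, hv0u⟩ : ∃ v0, v0 ≠ 0 ∧ Cm i v0 ∧ Cm j v0 ∧ Wm u0 v0 := by
    by_cases h0 : v1 + cj j v1 = 0
    · refine ⟨i * v1, mul_ne_zero hi0 hv10, (Cm.refl i).mul hv1i, comm_of_cj hj0 ?_, hu0i.symm.mulW hv1u⟩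
      rw [cj_mul hj0, cji, ← neg_eq_of_add_eq_zero_right h0, neg_mul_neg]
    · refine ⟨v1 + cj j v1, h0, hv1i.add (hj.cj hv1i), comm_of_cj hj0 ?_, hv1u.add ?_⟩
      · rw [cj_add, cj_sq hj0 hb, add_comm]
      · exact (hu0j.symm.mulW hv1u).mulC hu0j.symm.inv
  have hfv0 : f v0 = -v0 := by
    have ht := (c.P hv0i).1
    have h1 : Wm u0 (f v0) := by
      have := c.hf.Wm hv0u
      rw [hfu0] at this
      unfold Wm at *
      simp only [neg_mul, mul_neg, neg_neg] at this
      rw [← this, neg_neg]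
    have h2 := hv0u.add h1
    have h3 := ht u0 hu0i
    unfold Wm at h2
    rw [← h3] at h2
    have h4 := (mul_eq_zero.1 (self_neg K h2)).resolve_right hu00
    exact (neg_eq_of_add_eq_zero_right h4).symm
  obtain ⟨l, hl⟩ := fin v0 hv0i hv0j hfv0
  exact ⟨j, u0, v0, b, k, l, hj0, hu00, hv00, hj, hv0u, hu0i, hv0i, hu0j, hv0j, hb, hk, hl⟩

theorem sqform {i j : D} {a b : K} (h : Wm i j) (hi : i ^ 2 = algebraMap K D a) (hj : j ^ 2 = algebraMap K D b) (x y z : K) :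
    (x • i + y • j + z • (i * j)) ^ 2 = algebraMap K D (a * x ^ 2 + b * y ^ 2 - a * b * z ^ 2) := by
  have hji : j * i = -(i * j) := h.symm
  rw [pow_two] at hi hj
  have e1 : i * (i * j) = a • j := by rw [← mul_assoc, hi, Algebra.smul_def]
  have e2 : (i * j) * i = -(a • j) := by rw [mul_assoc, hji, mul_neg, e1]
  have e3 : (i * j) * j = b • i := by rw [mul_assoc, hj, ← Algebra.commutes, Algebra.smul_def]
  have e4 : j * (i * j) = -(b • i) := by rw [← mul_assoc, hji, neg_mul, e3]
  have e5 : (i * j) * (i * j) = -((a * b) • (1 : D)) := by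
    rw [← mul_assoc, e2, neg_mul, smul_mul_assoc, hj, Algebra.algebraMap_eq_smul_one, smul_smul]
  rw [Algebra.algebraMap_eq_smul_one] at *
  rw [pow_two]
  simp only [mul_add, add_mul, smul_mul_assoc, mul_smul_comm, hi, hj, e1, e2, e3, e4, e5, hji]
  module

theorem cen0 {i j : D} (h : Wm i j) (hi0 : i ≠ 0) (hj0 : j ≠ 0) {x y z : K} (h1 : Cm i (x • i + y • j + z • (i * j)))
    (h2 : Cm j (x • i + y • j + z • (i * j))) : x = 0 ∧ y = 0 ∧ z = 0 := by
  have e1 := cj_of_comm hi0 h1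
  have cs : ∀ (w t : D) (k : K), cj w (k • t) = k • cj w t := fun w t k => by unfold cj; rw [mul_smul_comm, smul_mul_assoc]
  have cii : ∀ w : D, w ≠ 0 → cj w w = w := fun w hw => cj_of_comm hw (Cm.refl w)
  rw [cj_add, cj_add, cs, cs, cs, cj_mul hi0, cii i hi0, cj_of_anti hi0 h] at e1
  have e2 : (y • 1 + z • i) * j = 0 := by
    apply self_neg K
    have : (y • 1 + z • i) * j = y • j + z • (i * j) := by rw [add_mul, smul_mul_assoc, smul_mul_assoc, one_mul]
    rw [this]
    rw [add_assoc, add_assoc, add_right_inj] at e1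
    rw [← e1, neg_add, smul_neg, mul_neg, smul_neg, neg_neg, neg_neg]
    rw [smul_neg, mul_neg, smul_neg] at e1
    rw [e1]
  have e3 := (mul_eq_zero.1 e2).resolve_right hj0
  have e4 : cj j (y • 1 + z • i) = 0 := by rw [e3]; simp [cj]
  rw [cj_add, cs, cs, cj_of_anti hj0 h.symm, cj_of_comm hj0 (by simp [Cm])] at e4
  have hy1 : y • (1 : D) = 0 := by
    apply self_neg K
    rw [smul_neg, ← sub_eq_add_neg, sub_eq_zero] at e4
    rw [← e4, ← eq_neg_iff_add_eq_zero] at e3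
    exact e3
  have hz1 : z • i = 0 := by rw [hy1, zero_add] at e3; exact e3
  have hy : y = 0 := (smul_eq_zero.1 hy1).resolve_right one_ne_zero
  have hz : z = 0 := (smul_eq_zero.1 hz1).resolve_right hi0
  subst hy; subst hz
  simp only [zero_smul, add_zero] at h2
  have e5 := cj_of_comm hj0 h2
  rw [cs, cj_of_anti hj0 h.symm, smul_neg] at e5
  exact ⟨(smul_eq_zero.1 (self_neg K e5.symm)).resolve_right hi0, rfl, rfl⟩

theorem form_Cm {w i j : D} (hi : Cm w i) (hj : Cm w j) (x y z : K) : Cm w (x • i + y • j + z • (i * j)) := by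
  simp only [Algebra.smul_def]
  exact (((alg_Cm x).mul hi).add ((alg_Cm y).mul hj)).add ((alg_Cm z).mul (hi.mul hj))

/-- Part B: degree four is impossible -/
theorem partB {K D : Type*} [Field K] [NumberField K] [DivisionRing D] [Algebra K D] [FiniteDimensional K D] {i : D} {a : K} (h : Ctx i a)
    (f : D →ₗ[K] D) (hf : Anti f) : False := by
  obtain ⟨f, hf, hi⟩ := h.adj_i hf
  obtain ⟨f, u, v, hf, hi, hu, hnu, hu2, hv0, hv, huv, fu, fv⟩ := h.adj_uv hf hi
  have c : Ctx2 i a f u v := ⟨h, hf, hi, hu, hnu, hu2, hv0, hv, huv, fu, fv⟩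
  obtain ⟨j, u0, v0, b, c, d, hj0, hu0, hv00, hij, huv0, hiu, hiv, hju, hjv, hb, hc, hd⟩ := c.ex_all
  have nz : ∀ (t : D) (k : K), t ≠ 0 → t ^ 2 = algebraMap K D k → k ≠ 0 := by
    rintro t k ht h1 rfl
    rw [map_zero] at h1
    exact ht (by simpa using h1)
  obtain ⟨x, y, z, x', y', z', hne, heq⟩ := inputT (Units.mk0 a (nz i a h.i0 h.sq)) (Units.mk0 b (nz j b hj0 hb)) (Units.mk0 c (nz u0 c hu0 hc)) (Units.mk0 d (nz v0 d hv00 hd))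
  simp only [Units.val_mk0] at heq
  have s1 := sqform hij h.sq hb x y z
  have s2 := sqform huv0 hc hd x' y' z'
  rw [heq, ← s2] at s1
  have fX : ∀ w, Cm w i → Cm w j → Cm w (x • i + y • j + z • (i * j)) := fun w h1 h2 => form_Cm h1 h2 _ _ _
  have fY : ∀ w, Cm w u0 → Cm w v0 → Cm w (x' • u0 + y' • v0 + z' • (u0 * v0)) := fun w h1 h2 => form_Cm h1 h2 _ _ _
  have cX := cen0 (x := x) (y := y) (z := z) hij h.i0 hj0
  have cY := cen0 (x := x') (y := y') (z := z') huv0 hu0 hv00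
  generalize x • i + y • j + z • (i * j) = X at *
  generalize x' • u0 + y' • v0 + z' • (u0 * v0) = Y at *
  have hXY : Commute X Y := fY X (fX u0 hiu.symm hju.symm).symm (fX v0 hiv.symm hjv.symm).symm
  have hY : Cm u0 Y ∧ Cm v0 Y ∧ Cm i X ∧ Cm j X := by
    rcases (hXY.sq_eq_sq_iff_eq_or_eq_neg).1 s1 with h1 | h1
    · subst h1
      exact ⟨fX _ hiu.symm hju.symm, fX _ hiv.symm hjv.symm, fY _ hiu hiv, fY _ hju hjv⟩
    · have h2 : Y = -X := by rw [h1, neg_neg]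
      refine ⟨?_, ?_, ?_, ?_⟩
      · rw [h2]; exact (fX _ hiu.symm hju.symm).neg
      · rw [h2]; exact (fX _ hiv.symm hjv.symm).neg
      · rw [h1]; exact (fY _ hiu hiv).neg
      · rw [h1]; exact (fY _ hju hjv).neg
  obtain ⟨r1, r2, r3⟩ := cX hY.2.2.1 hY.2.2.2
  obtain ⟨r4, r5, r6⟩ := cY hY.1 hY.2.1
  simp [r1, r2, r3, r4, r5, r6] at hne

end
end BQ

namespace BQ
open Module Polynomial

section
set_option linter.unusedSectionVars false
variable {K D : Type*} [Field K] [DivisionRing D] [Algebra K D]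

theorem indepLR (hcen : ∀ z : D, (∀ x, z * x = x * z) → ∃ k : K, z = algebraMap K D k) {ι : Type*} [DecidableEq ι] (b : ι → D) (hb : LinearIndependent K b)
    (s : Finset ι) : ∀ a : ι → D, (∀ y, ∑ j ∈ s, a j * y * b j = 0) → ∀ j ∈ s, a j = 0 := by
  induction s using Finset.induction_on with
  | empty => simp
  | insert t s ht ih =>
    intro a ha
    by_cases h0 : a t = 0
    · have := ih a (fun y => by
        have := ha y
        rw [Finset.sum_insert ht, h0] at this
        simpa using this)
      intro j hj
      rcases Finset.mem_insert.1 hj with rfl | hj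
      · exact h0
      · exact this j hj
    · exfalso
      have ha' : ∀ y, ∑ j ∈ insert t s, ((a t)⁻¹ * a j) * y * b j = 0 := by
        intro y
        simp only [mul_assoc] at ha ⊢
        rw [← Finset.mul_sum, ha y, mul_zero]
      have h1 : (a t)⁻¹ * a t = 1 := inv_mul_cancel₀ h0
      generalize hc : (fun j => (a t)⁻¹ * a j) = c at *
      have hc' : ∀ j, (a t)⁻¹ * a j = c j := fun j => congrFun hc j
      simp only [hc'] at ha' h1
      have hcomm : ∀ x, ∀ j ∈ s, x * c j - c j * x = 0 := by
        intro x
        apply ih (fun j => x * c j - c j * x)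
        intro y
        have e1 : ∑ j ∈ insert t s, (x * c j - c j * x) * y * b j = 0 := by
          have : ∀ j, (x * c j - c j * x) * y * b j = x * (c j * y * b j) - c j * (x * y) * b j := fun j => by
            simp only [sub_mul, mul_assoc]
          simp only [this]
          rw [Finset.sum_sub_distrib, ← Finset.mul_sum, ha', ha', mul_zero, sub_zero]
        rw [Finset.sum_insert ht, h1] at e1
        simpa using e1
      have hk : ∀ j ∈ insert t s, ∃ k : K, c j = algebraMap K D k := by
        intro j hj
        rcases Finset.mem_insert.1 hj with rfl | hj
        · exact ⟨1, by rw [h1, map_one]⟩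
        · exact hcen _ fun x => (sub_eq_zero.1 (hcomm x j hj)).symm
      choose! k hk using hk
      have e2 : ∑ j ∈ insert t s, k j • b j = 0 := by
        rw [← ha' 1]
        apply Finset.sum_congr rfl
        intro j hj
        rw [hk j hj, mul_one, Algebra.smul_def]
      have e3 := linearIndependent_iff'.1 hb _ _ e2 t (Finset.mem_insert_self _ _)
      have e4 := hk t (Finset.mem_insert_self _ _)
      rw [h1, e3, map_zero] at e4
      exact one_ne_zero e4

/-- Skolem-Noether for a separable subfield -/
theorem skolem (hcen : ∀ z : D, (∀ x, z * x = x * z) → ∃ k : K, z = algebraMap K D k)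
    {L : Type*} [Field L] [Algebra K L] [FiniteDimensional K L] [Algebra.IsSeparable K L] (g1 g2 : L →ₐ[K] D) :
    ∃ w : D, w ≠ 0 ∧ ∀ x, w * g1 x = g2 x * w := by
  classical
  obtain ⟨θ, hθ⟩ := Field.exists_primitive_element K L
  have hiv : IsIntegral K θ := IsIntegral.of_finite K θ
  let P := (minpoly K θ).map (algebraMap K L)
  have hroot : P.IsRoot θ := by
    simp [P, Polynomial.IsRoot, eval_map_algebraMap]
  obtain ⟨q, hq⟩ := dvd_iff_isRoot.2 hroot
  have hPm : P.Monic := (minpoly.monic hiv).map _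
  have hqm : q.Monic := by
    have := hPm; rw [hq] at this
    exact (monic_X_sub_C θ).of_mul_monic_left this
  have hqd : q.natDegree < (minpoly K θ).natDegree := by
    have h1 : P.natDegree = (minpoly K θ).natDegree := natDegree_map _
    rw [hq, (monic_X_sub_C θ).natDegree_mul hqm, natDegree_X_sub_C] at h1
    omega
  -- T r z = sum of g2 (coeff) z g1(θ)^j
  let R : Module.End K D := LinearMap.mulRight K (g1 θ)
  let Lm : L →ₐ[K] Module.End K D := (Algebra.lmul K D).comp g2
  have hcomm : ∀ l, Commute (Lm l) R := by
    intro l; ext z; simp [Lm, R, mul_assoc]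
  let T : L[X] →+* Module.End K D := Polynomial.eval₂RingHom' Lm.toRingHom R hcomm
  have hT : ∀ r : L[X], ∀ z, T r z = ∑ j ∈ Finset.range (r.natDegree + 1), g2 (r.coeff j) * z * g1 θ ^ j := by
    intro r z
    have : T r = r.eval₂ Lm.toRingHom R := rfl
    rw [this, eval₂_eq_sum_range]
    simp [Lm, R, LinearMap.sum_apply, mul_assoc]
  have hTP : T P = 0 := by
    have : T P = aeval R (minpoly K θ) := by
      have h1 : T P = P.eval₂ Lm.toRingHom R := rfl
      rw [h1, Polynomial.eval₂_map]
      have : Lm.toRingHom.comp (algebraMap K L) = algebraMap K (Module.End K D) := by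
        ext1 k; exact Lm.commutes k
      rw [this]; rfl
    rw [this]
    have hR : ∀ r : K[X], aeval R r = LinearMap.mulRight K (aeval (g1 θ) r) := by
      intro r
      ext z
      induction r using Polynomial.induction_on' with
      | add p q hp hq => simp [hp, hq, mul_add]
      | monomial n c =>
        simp [aeval_monomial, R, Algebra.commutes, mul_assoc, Algebra.smul_def]
    rw [hR, aeval_algHom_apply, minpoly.aeval, map_zero, LinearMap.mulRight_zero_eq_zero]
  have hTq : T q ≠ 0 := by
    intro h0
    have hli : LinearIndependent K (fun j : Fin (minpoly K θ).natDegree => g1 θ ^ (j : ℕ)) := by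
      have := (linearIndependent_pow (K := K) θ).map' g1.toLinearMap (LinearMap.ker_eq_bot.2 g1.toRingHom.injective)
      have e : (fun j : Fin (minpoly K θ).natDegree => g1 θ ^ (j : ℕ)) = g1.toLinearMap ∘ (fun j : Fin (minpoly K θ).natDegree => θ ^ (j : ℕ)) := by
        ext j; simp
      rw [e]; exact this
    have h1 := indepLR hcen _ hli Finset.univ (fun j => g2 (q.coeff j)) (fun y => by
      rw [Fin.sum_univ_eq_sum_range (fun j => g2 (q.coeff j) * y * g1 θ ^ j)]
      have := hT q y
      rw [h0, LinearMap.zero_apply] at this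
      rw [this]
      symm
      apply Finset.sum_subset (Finset.range_subset_range.2 hqd)
      intro j _ hj
      rw [Finset.mem_range, not_lt] at hj
      rw [coeff_eq_zero_of_natDegree_lt (by omega)]; simp)
    have h2 := h1 ⟨q.natDegree, hqd⟩ (Finset.mem_univ _)
    simp only [coeff_natDegree, hqm.leadingCoeff, map_one] at h2
    exact one_ne_zero h2
  obtain ⟨z, hz⟩ : ∃ z, T q z ≠ 0 := by
    by_contra hh
    push Not at hh
    exact hTq (LinearMap.ext hh)
  refine ⟨T q z, hz, ?_⟩
  have hbase : T q z * g1 θ = g2 θ * T q z := by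
    have h1 : T ((X - C θ) * q) z = 0 := by rw [← hq, hTP]; rfl
    rw [map_mul, map_sub] at h1
    have h2 : T X = R := eval₂_X _ _
    have h3 : T (C θ) = Lm θ := eval₂_C _ _
    rw [h2, h3] at h1
    simpa [R, Lm, sub_eq_zero] using h1
  intro x
  have hx : x ∈ Algebra.adjoin K {θ} := by
    have : x ∈ IntermediateField.adjoin K {θ} := by rw [hθ]; trivial
    rwa [← IntermediateField.mem_toSubalgebra, IntermediateField.adjoin_simple_toSubalgebra_of_isAlgebraic hiv.isAlgebraic] at this
  induction hx using Algebra.adjoin_induction with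
  | mem x hx => rw [Set.mem_singleton_iff.1 hx]; exact hbase
  | algebraMap k => rw [g1.commutes, g2.commutes]; exact (Algebra.commutes _ _).symm
  | add x y _ _ h1 h2 => rw [map_add, map_add, mul_add, add_mul, h1, h2]
  | mul x y _ _ h1 h2 => rw [map_mul, map_mul, ← mul_assoc, h1, mul_assoc, h2, mul_assoc]

end
end BQ

namespace BQ
open Module Polynomial

section
set_option linter.unusedSectionVars false
variable {K D : Type*} [Field K] [CharZero K] [DivisionRing D] [Algebra K D] [FiniteDimensional K D]

/-- a subfield of prime degree p in degree p algebra is its own centralizer -/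
theorem selfcen {L : Type*} [Field L] [Algebra K L] (g : L →ₐ[K] D) {p : ℕ} (hp : p.Prime)
    (hL : finrank K L = p) (hD : finrank K D = p ^ 2) (hcen : ∀ z : D, (∀ x, z * x = x * z) → ∃ k : K, z = algebraMap K D k)
    {c : D} (hc : ∀ x, c * g x = g x * c) : ∃ l, c = g l := by
  let E := Algebra.adjoin K (insert c (Set.range g))
  have hE : g.range ≤ E := by
    rintro _ ⟨x, rfl⟩
    exact Algebra.subset_adjoin (Or.inr ⟨x, rfl⟩)
  have hgr : finrank K g.range = p := by
    rw [← hL]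
    exact (AlgEquiv.ofInjective g g.toRingHom.injective).toLinearEquiv.finrank_eq.symm
  have hge : p ≤ finrank K E := by
    rw [← hgr]
    exact Submodule.finrank_mono (s := Subalgebra.toSubmodule g.range) (t := Subalgebra.toSubmodule E) hE
  have hcE : c ∈ E := Algebra.subset_adjoin (Or.inl rfl)
  have hdvd : finrank K E ∣ p ^ 2 := by rw [← hD]; exact finrank_dvd E
  obtain ⟨k, hk, hEk⟩ := (Nat.dvd_prime_pow hp).1 hdvd
  have hp2 := hp.two_le
  interval_cases k
  · rw [pow_zero] at hEk; omega
  · rw [pow_one] at hEk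
    have heq := Submodule.eq_of_le_of_finrank_eq (S₁ := Subalgebra.toSubmodule g.range) (S₂ := Subalgebra.toSubmodule E) hE (hgr.trans hEk.symm)
    have : c ∈ Subalgebra.toSubmodule g.range := by rw [heq]; exact hcE
    obtain ⟨l, hl⟩ := this
    exact ⟨l, hl.symm⟩
  · exfalso
    have htop : E = ⊤ := by
      apply Subalgebra.toSubmodule_injective
      rw [Algebra.top_toSubmodule]
      apply Submodule.eq_top_of_finrank_eq
      rw [hD]; exact hEk
    have hcomm : ∀ x ∈ insert c (Set.range g), ∀ y ∈ insert c (Set.range g), x * y = y * x := by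
      rintro x (rfl | ⟨x, rfl⟩) y (rfl | ⟨y, rfl⟩)
      · rfl
      · exact hc y
      · exact (hc x).symm
      · rw [← map_mul, ← map_mul, mul_comm]
    have hall : ∀ x y : D, x * y = y * x := by
      let _ := Algebra.adjoinCommRingOfComm K hcomm
      intro x y
      have hx : x ∈ E := by rw [htop]; trivial
      have hy : y ∈ E := by rw [htop]; trivial
      have := mul_comm (⟨x, hx⟩ : E) ⟨y, hy⟩
      exact congrArg Subtype.val this
    have hbot : (⊤ : Subalgebra K D) = ⊥ := by
      rw [eq_bot_iff]
      intro x _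
      obtain ⟨k, hk⟩ := hcen x (hall x)
      rw [hk]; exact Subalgebra.algebraMap_mem _ _
    have h1 : finrank K D = 1 := by
      rw [← Subalgebra.topEquiv.toLinearEquiv.finrank_eq (R := K), hbot]; exact Subalgebra.finrank_bot
    rw [hD] at h1
    nlinarith

theorem powform {L : Type*} [Field L] [Algebra K L] (g : L →ₐ[K] D) (σ : L ≃ₐ[K] L) {y : D} (hy : ∀ x, y * g x = g (σ x) * y) (e : L) (n : ℕ) :
    (g e * y) ^ n = g (∏ k ∈ Finset.range n, (σ ^ k) e) * y ^ n := by
  have hyn : ∀ (n : ℕ) (x : L), y ^ n * g x = g ((σ ^ n) x) * y ^ n := by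
    intro n
    induction n with
    | zero => simp
    | succ n ih => intro x; rw [pow_succ, mul_assoc, hy, ← mul_assoc, ih, mul_assoc, pow_succ σ]; rfl
  induction n with
  | zero => simp
  | succ n ih =>
    rw [pow_succ, ih, mul_assoc, ← mul_assoc (y ^ n), hyn, Finset.prod_range_succ, map_mul, pow_succ]; simp only [mul_assoc]

theorem partOdd (hcen : ∀ z : D, (∀ x, z * x = x * z) → ∃ k : K, z = algebraMap K D k)
    {L : Type*} [Field L] [Algebra K L] [FiniteDimensional K L] [IsGalois K L] (g : L →ₐ[K] D) {p : ℕ} (hp : p.Prime) (hp2 : p ≠ 2)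
    (hL : finrank K L = p) (hD : finrank K D = p ^ 2) (f : D →ₗ[K] D) (hf : Anti f) : False := by
  have hGc : Nat.card (L ≃ₐ[K] L) = p := by rw [IsGalois.card_aut_eq_finrank, hL]
  have := Fact.mk hp
  have : Nontrivial (L ≃ₐ[K] L) := Finite.one_lt_card_iff_nontrivial.1 (by rw [hGc]; exact hp.one_lt)
  obtain ⟨σ, hσ⟩ := exists_ne (1 : L ≃ₐ[K] L)
  have hz : Subgroup.zpowers σ = ⊤ := zpowers_eq_top_of_prime_card hGc hσ
  have hord : orderOf σ = p := by
    rw [← Nat.card_zpowers, hz, Subgroup.card_top, hGc]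
  have hfix : ∀ x, σ x = x → ∃ k : K, x = algebraMap K L k := by
    intro x hx
    have : ∀ τ : L ≃ₐ[K] L, τ x = x := by
      intro τ
      have hτ : τ ∈ Subgroup.zpowers σ := by rw [hz]; trivial
      have hle : Subgroup.zpowers σ ≤ MulAction.stabilizer (L ≃ₐ[K] L) x := by
        rw [Subgroup.zpowers_le]; exact hx
      exact hle hτ
    obtain ⟨k, hk⟩ := (IsGalois.mem_range_algebraMap_iff_fixed x).2 this
    exact ⟨k, hk.symm⟩
  -- adjust f
  let fg : L →ₐ[K] D := AlgHom.ofLinearMap (f ∘ₗ g.toLinearMap) (by simp [hf.one]) (fun x y => by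
    simp only [LinearMap.comp_apply, AlgHom.toLinearMap_apply]
    rw [mul_comm, map_mul, hf.mul])
  obtain ⟨w, hw0, hw⟩ := skolem hcen g fg
  obtain ⟨f1, hf1, he1⟩ := hf.twist hw0
  have hfg : ∀ x, f1 (g x) = g x := by
    intro x
    have := hw x
    change w * g x = f (g x) * w at this
    rw [he1, mul_assoc, ← this, inv_mul_cancel_left₀ hw0]
  obtain ⟨y, hy0, hy⟩ := skolem hcen g (g.comp (σ : L →ₐ[K] L))
  replace hy : ∀ x, y * g x = g (σ x) * y := hy
  have hcc : ∀ t : D, (∀ x, t * g x = g (σ x) * t) → ∃ e, t = g e * y := by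
    intro t ht
    obtain ⟨l, hl⟩ := selfcen g hp hL hD hcen (c := t * y⁻¹) (fun x => by
      have h1 : y⁻¹ * g x = g (σ.symm x) * y⁻¹ := by
        rw [inv_mul_eq_iff_eq_mul₀ hy0, ← mul_assoc, hy, σ.apply_symm_apply, mul_assoc, mul_inv_cancel₀ hy0, mul_one]
      rw [mul_assoc, h1, ← mul_assoc, ht, σ.apply_symm_apply, mul_assoc])
    exact ⟨l, by rw [← hl, mul_assoc, inv_mul_cancel₀ hy0, mul_one]⟩
  -- y ^ p
  have hσp : σ ^ p = 1 := by rw [← hord]; exact pow_orderOf_eq_one σ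
  have hyn : ∀ (n : ℕ) (x : L), y ^ n * g x = g ((σ ^ n) x) * y ^ n := by
    intro n
    induction n with
    | zero => simp
    | succ n ih => intro x; rw [pow_succ, mul_assoc, hy, ← mul_assoc, ih, mul_assoc, pow_succ σ]; rfl
  obtain ⟨b', hb'⟩ := selfcen g hp hL hD hcen (c := y ^ p) (fun x => by rw [hyn, hσp]; rfl)
  obtain ⟨b, hb⟩ := hfix b' (by
    have h1 := hy b'
    rw [← hb', ← pow_succ', pow_succ] at h1
    exact g.toRingHom.injective ((mul_right_cancel₀ hy0 h1).symm.trans hb'))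
  have hyp : y ^ p = algebraMap K D b := by rw [hb', hb, g.commutes]
  have hb0 : b ≠ 0 := by
    rintro rfl
    rw [map_zero] at hyp
    exact pow_ne_zero p hy0 hyp
  -- z = (f y)⁻¹
  obtain ⟨e, he⟩ := hcc (f1 y)⁻¹ (fun x => by
    have h1 := congrArg f1 (hy x)
    rw [hf1.mul, hf1.mul, hfg, hfg] at h1
    have := hf1.ne hy0
    rw [inv_mul_eq_iff_eq_mul₀ this, ← mul_assoc, ← h1, mul_assoc, mul_inv_cancel₀ this, mul_one])
  have hfp : ∀ n : ℕ, f1 (y ^ n) = f1 y ^ n := by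
    intro n
    induction n with
    | zero => simp [hf1.one]
    | succ n ih => rw [pow_succ, hf1.mul, ih, pow_succ']
  let Nm : L →* L := 
    { toFun := fun e => ∏ k ∈ Finset.range p, (σ ^ k) e
      map_one' := by simp
      map_mul' := fun x y => by simp [Finset.prod_mul_distrib] }
  have hNm : ∀ e, (g e * y) ^ p = g (Nm e) * y ^ p := fun e => powform g σ hy e p
  have hNb : ∀ k : K, Nm (algebraMap K L k) = algebraMap K L (k ^ p) := by
    intro k
    change ∏ m ∈ Finset.range p, (σ ^ m) (algebraMap K L k) = _
    simp only [AlgEquiv.commutes, Finset.prod_const, Finset.card_range, map_pow]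
  have hNe : Nm e = algebraMap K L (b⁻¹ * b⁻¹) := by
    have h1 := hNm e
    rw [← he, inv_pow, ← hfp, hyp, hf1.alg, ← map_inv₀, ← g.commutes, ← g.commutes, ← map_mul] at h1
    have h2 := g.toRingHom.injective h1
    have hbL : algebraMap K L b ≠ 0 := by rw [Ne, map_eq_zero]; exact hb0
    apply mul_right_cancel₀ hbL
    rw [← map_mul, mul_assoc, inv_mul_cancel₀ hb0, mul_one]
    exact h2.symm
  obtain ⟨q, hq⟩ := hp.odd_of_ne_two hp2
  let δ := algebraMap K L b * e ^ (q + 1)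
  have hNδ : Nm δ = algebraMap K L b⁻¹ := by
    rw [map_mul, map_pow, hNb, hNe, ← map_pow, ← map_mul, hq]
    have : (b⁻¹ * b⁻¹) ^ (q + 1) = (b ^ (2 * q + 1))⁻¹ * b⁻¹ := by
      rw [← mul_inv, inv_pow, ← mul_inv]; congr 1; ring
    rw [this, mul_inv_cancel_left₀ (pow_ne_zero _ hb0)]
  obtain ⟨x, hx⟩ : ∃ x, x = g δ * y := ⟨_, rfl⟩
  have hxp : x ^ p = 1 := by
    rw [hx, hNm, hNδ, hyp, g.commutes, ← map_mul, inv_mul_cancel₀ hb0, map_one]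
  have hxg : ∀ l, x * g l = g (σ l) * x := by
    intro l
    rw [hx, mul_assoc, hy, ← mul_assoc, ← mul_assoc, ← map_mul, ← map_mul, mul_comm]
  have hx1 : x ≠ 1 := by
    rintro rfl
    apply hσ
    ext l
    have := hxg l
    rw [one_mul, mul_one] at this
    exact (g.toRingHom.injective this).symm
  have hx0 : x ≠ 0 := by
    rintro rfl
    rw [zero_pow hp.ne_zero] at hxp
    exact zero_ne_one hxp
  have hsum : ∑ k ∈ Finset.range p, x ^ k = 0 := by
    have := mul_geom_sum x p
    rw [hxp, sub_self] at this
    exact (mul_eq_zero.1 this).resolve_left (sub_ne_zero.2 hx1)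
  -- independence
  obtain ⟨θ, hθ⟩ := Field.exists_primitive_element K L
  let _ : Module L D := Module.compHom D g.toRingHom
  have hsm : ∀ (l : L) (t : D), l • t = g l * t := fun l t => rfl
  let R : Module.End L D :=
    { toFun := fun t => t * g θ
      map_add' := fun s t => add_mul _ _ _
      map_smul' := fun l t => by simp only [hsm, mul_assoc, RingHom.id_apply] }
  have hli := Module.End.eigenvectors_linearIndependent' R (fun k : Fin p => (σ ^ (k : ℕ)) θ) (by
    intro k l hkl
    have : σ ^ (k : ℕ) = σ ^ (l : ℕ) := by
      have hext : ∀ t : L, (σ ^ (k : ℕ)) t = (σ ^ (l : ℕ)) t := by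
        have : ((σ ^ (k : ℕ) : L ≃ₐ[K] L) : L →ₐ[K] L) = ((σ ^ (l : ℕ) : L ≃ₐ[K] L) : L →ₐ[K] L) := by
          have hadj : Algebra.adjoin K {θ} = ⊤ := by
            rw [← IntermediateField.adjoin_simple_toSubalgebra_of_isAlgebraic (IsIntegral.of_finite K θ).isAlgebraic, hθ]
            rfl
          apply AlgHom.ext_of_adjoin_eq_top hadj
          rintro _ rfl
          exact hkl
        intro t
        exact DFunLike.congr_fun this t
      exact AlgEquiv.ext hext
    have := pow_injOn_Iio_orderOf (by simp [hord]) (by simp [hord]) this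
    exact Fin.ext this) (fun k => x ^ (k : ℕ)) (fun k => by
    constructor
    · rw [Module.End.mem_eigenspace_iff, hsm]
      change x ^ (k : ℕ) * g θ = _
      have : ∀ (n : ℕ) (l : L), x ^ n * g l = g ((σ ^ n) l) * x ^ n := by
        intro n
        induction n with
        | zero => simp
        | succ n ih => intro x; rw [pow_succ, mul_assoc, hxg, ← mul_assoc, ih, mul_assoc, pow_succ σ]; rfl
      exact this _ _
    · exact pow_ne_zero _ hx0)
  have h1 := Fintype.linearIndependent_iff.1 hli (fun _ => 1) (by
    simp only [one_smul]
    rw [Fin.sum_univ_eq_sum_range (fun k => x ^ k)]; exact hsum) ⟨0, hp.pos⟩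
  exact one_ne_zero h1

end
end BQ

namespace BQ
open Module Polynomial

section
set_option linter.unusedSectionVars false

theorem quadgen {K L : Type*} [Field K] [CharZero K] [Field L] [Algebra K L] (hL : finrank K L = 2) :
    ∃ (t : L) (a : K), t ^ 2 = algebraMap K L a ∧ ∀ k : K, t ≠ algebraMap K L k := by
  have hfd : FiniteDimensional K L := FiniteDimensional.of_finrank_pos (by omega)
  obtain ⟨x, hx⟩ : ∃ x : L, ∀ k : K, x ≠ algebraMap K L k := by
    by_contra hh
    push Not at hh
    have h1 : finrank K L ≤ 1 := finrank_le_one (1 : L) (fun w => by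
      obtain ⟨k, hk⟩ := hh w
      exact ⟨k, by rw [hk, Algebra.algebraMap_eq_smul_one]⟩)
    omega
  have li : LinearIndependent K ![1, x] := by
    rw [LinearIndependent.pair_iff]
    intro s t hst
    have ht : t = 0 := by
      by_contra ht
      apply hx (t⁻¹ * -s)
      rw [Algebra.smul_def, Algebra.smul_def, mul_one, add_comm, ← eq_neg_iff_add_eq_zero] at hst
      have ht' : algebraMap K L t ≠ 0 := by rw [Ne, map_eq_zero]; exact ht
      rw [map_mul, map_inv₀, map_neg, ← hst, inv_mul_cancel_left₀ ht']
    subst ht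
    rw [zero_smul, add_zero, Algebra.smul_def, mul_one, map_eq_zero] at hst
    exact ⟨hst, rfl⟩
  have hspan := li.span_eq_top_of_card_eq_finrank' (by simp [hL])
  have hm : x ^ 2 ∈ Submodule.span K (Set.range ![1, x]) := by rw [hspan]; trivial
  obtain ⟨c, hc⟩ := (Submodule.mem_span_range_iff_exists_fun K).1 hm
  simp only [Fin.sum_univ_two, Algebra.smul_def, Matrix.cons_val, mul_one] at hc
  refine ⟨x - algebraMap K L (c 1 / 2), c 0 + (c 1 / 2) ^ 2, ?_, fun k hk => hx (k + c 1 / 2) (by rw [map_add, ← hk]; ring)⟩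
  have e : algebraMap K L (c 1) = 2 * algebraMap K L (c 1 / 2) := by
    rw [← map_ofNat (algebraMap K L) 2, ← map_mul]; congr 1; field_simp
  rw [e] at hc
  rw [sub_sq, ← hc, map_add, map_pow]; ring

theorem partTwo {K D : Type*} [Field K] [NumberField K] [DivisionRing D] [Algebra K D] [FiniteDimensional K D]
    (hcen : ∀ z : D, (∀ x, z * x = x * z) → ∃ k : K, z = algebraMap K D k)
    {L : Type*} [Field L] [Algebra K L] (g : L →ₐ[K] D) 
    (hL : finrank K L = 2) (hD : finrank K D = 16) (f : D →ₗ[K] D) (hf : Anti f) : False := by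
  obtain ⟨t, a, h1, h2⟩ := quadgen hL
  refine partB (i := g t) (a := a) ⟨hcen, hD, by rw [← map_pow, h1, g.commutes], fun k hk => h2 k ?_⟩ f hf
  rw [← g.commutes] at hk
  exact g.toRingHom.injective hk

end
end BQ

namespace BQ
open Module Polynomial

section
set_option linter.unusedSectionVars false

/-- dimension of a module over a division algebra -/
theorem dvdmod {K D W : Type*} [Field K] [DivisionRing D] [Algebra K D] [FiniteDimensional K D] [AddCommGroup W] [Module K W] [FiniteDimensional K W]
    (ψ : D →ₐ[K] Module.End K W) : finrank K D ∣ finrank K W := by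
  let _ : Module D W := Module.compHom W ψ.toRingHom
  have hsm : ∀ (x : D) (w : W), x • w = ψ x w := fun x w => rfl
  have : IsScalarTower K D W := ⟨fun k x w => by rw [hsm, hsm, map_smul]; rfl⟩
  exact ⟨_, (finrank_mul_finrank K D W).symm⟩

theorem embedmod {K D W L : Type*} [Field K] [DivisionRing D] [Algebra K D] [FiniteDimensional K D] [AddCommGroup W] [Module K W] [FiniteDimensional K W]
    (ψ : D →ₐ[K] Module.End K W) (hdim : finrank K D = finrank K W) [Ring L] [Algebra K L] (ρ : L →ₐ[K] Module.End K W)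
    (hcomm : ∀ x l w, ψ x (ρ l w) = ρ l (ψ x w)) : ∃ g : L →ₗ[K] D, g 1 = 1 ∧ ∀ x y, g (x * y) = g y * g x := by
  let _ : Module D W := Module.compHom W ψ.toRingHom
  have hsm : ∀ (x : D) (w : W), x • w = ψ x w := fun x w => rfl
  have : IsScalarTower K D W := ⟨fun k x w => by rw [hsm, hsm, map_smul]; rfl⟩
  have h1 : finrank D W = 1 := by
    have := finrank_mul_finrank K D W
    rw [← hdim] at this
    have hpos : 0 < finrank K D := finrank_pos
    exact Nat.eq_of_mul_eq_mul_left hpos (this.trans (mul_one _).symm)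
  obtain ⟨w, hw0, hw⟩ := finrank_eq_one_iff'.1 h1
  have hw' : ∀ l, ∃ c : D, ψ c w = ρ l w := fun l => hw (ρ l w)
  choose g hg using hw'
  have inj : ∀ c c' : D, ψ c w = ψ c' w → c = c' := fun c c' h => smul_left_injective D hw0 h
  refine ⟨{ toFun := g, map_add' := ?_, map_smul' := ?_ }, ?_, ?_⟩
  · intro x y; apply inj
    rw [hg, map_add, map_add, LinearMap.add_apply, LinearMap.add_apply, hg, hg]
  · intro k x; apply inj
    rw [hg, map_smul, RingHom.id_apply, map_smul, LinearMap.smul_apply, LinearMap.smul_apply, hg]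
  · apply inj
    change ψ (g 1) w = _
    rw [hg, map_one, map_one]
  · intro x y; apply inj
    change ψ (g (x * y)) w = ψ (g y * g x) w
    rw [hg, map_mul, map_mul, Module.End.mul_apply, Module.End.mul_apply, hg, hcomm, ← hg y]

theorem lemE {K R V D1 : Type*} [Field K] [DivisionRing R] [Algebra K R] [AddCommGroup V] [Module R V] [Module K V] [IsScalarTower K R V]
    [Ring D1] [Algebra K D1] {r : ℕ} [NeZero r] (φ : Matrix (Fin r) (Fin r) D1 →ₐ[K] Module.End R V) :
    ∃ (U : Submodule R V) (_ : D1 →ₐ[K] Module.End R U), r * finrank R U = finrank R V := by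
  let E : Fin r → Fin r → D1 → Matrix (Fin r) (Fin r) D1 := fun i j x => Matrix.single i j x
  have hE : ∀ i j k x y v, φ (E i j x) (φ (E j k y) v) = φ (E i k (x * y)) v := by
    intro i j k x y v
    rw [← Module.End.mul_apply, ← map_mul, Matrix.single_mul_single_same]
  have hE0 : ∀ i j k l x y v, j ≠ k → φ (E i j x) (φ (E k l y) v) = 0 := by
    intro i j k l x y v hjk
    rw [← Module.End.mul_apply, ← map_mul, Matrix.single_mul_single_of_ne _ _ _ _ hjk, map_zero, LinearMap.zero_apply]
  have hE1 : ∀ v, ∑ k, φ (E k k 1) v = v := by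
    intro v
    rw [← LinearMap.sum_apply, ← map_sum]
    have : ∑ k, E k k 1 = 1 := by
      exact (Matrix.sum_single_one)
    rw [this, map_one]; rfl
  let U : Submodule R V := LinearMap.range (φ (E 0 0 1))
  have hU : ∀ u ∈ U, φ (E 0 0 1) u = u := by
    rintro _ ⟨v, rfl⟩
    rw [hE, mul_one]
  have hUm : ∀ j x v, φ (E 0 j x) v ∈ U := fun j x v => ⟨φ (E 0 j x) v, by rw [hE, one_mul]⟩
  refine ⟨U, ?_, ?_⟩
  · refine AlgHom.ofLinearMap { toFun := fun x => LinearMap.restrict (φ (E 0 0 x)) (fun u _ => hUm 0 x u), map_add' := ?_, map_smul' := ?_ } ?_ ?_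
    · intro x y; ext u
      simp [E, Matrix.single_add]
    · intro k x; ext u
      have : E 0 0 (k • x) = k • E 0 0 x := (Matrix.smul_single _ _ _ _).symm
      simp [this]
    · ext u
      simp only [LinearMap.coe_mk, AddHom.coe_mk, LinearMap.restrict_apply]
      exact hU u u.2
    · intro x y; ext u
      simp only [LinearMap.coe_mk, AddHom.coe_mk, Module.End.mul_apply, LinearMap.restrict_apply]
      rw [hE]
  · let Φ : V ≃ₗ[R] (Fin r → U) :=
      { toFun := fun v k => ⟨φ (E 0 k 1) v, hUm _ _ _⟩
        map_add' := fun v w => by ext k; simp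
        map_smul' := fun c v => by ext k; simp
        invFun := fun w => ∑ k, φ (E k 0 1) (w k)
        left_inv := fun v => by
          simp only [hE, mul_one, hE1]
        right_inv := fun w => by
          ext k
          simp only [map_sum]
          rw [Finset.sum_eq_single k]
          · rw [hE, mul_one]; exact hU _ (w k).2
          · intro j _ hj; exact hE0 _ _ _ _ _ _ _ (Ne.symm hj)
          · simp }
    rw [Φ.finrank_eq]
    by_cases hfin : Module.Finite R U
    · rw [finrank_pi_fintype]; simp
    · rw [Module.finrank_of_not_finite hfin, mul_zero]
      symm
      apply Module.finrank_of_not_finite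
      intro h
      apply hfin
      exact Module.Finite.of_surjective (LinearMap.proj (R := R) (φ := fun _ : Fin r => U) 0) (LinearMap.proj_surjective 0)

end
end BQ

namespace BQ
open Module Polynomial
open scoped TensorProduct

section
universe u v
set_option linter.unusedSectionVars false

theorem tcoord {K L D ι : Type*} [Field K] [Field L] [Algebra K L] [DivisionRing D] [Algebra K D] [DecidableEq ι] (b : Basis ι K L)
    (x : D) (z : L ⊗[K] D) (i : ι) :
    TensorProduct.equivFinsuppOfBasisLeft b ((1 ⊗ₜ[K] x : L ⊗[K] D) * z) i = x * TensorProduct.equivFinsuppOfBasisLeft b z i ∧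
    TensorProduct.equivFinsuppOfBasisLeft b (z * (1 ⊗ₜ[K] x : L ⊗[K] D)) i = TensorProduct.equivFinsuppOfBasisLeft b z i * x := by
  induction z with
  | zero => simp
  | add z w hz hw =>
    constructor
    · rw [mul_add, map_add, map_add, Finsupp.add_apply, Finsupp.add_apply, hz.1, hw.1, mul_add]
    · rw [add_mul, map_add, map_add, Finsupp.add_apply, Finsupp.add_apply, hz.2, hw.2, add_mul]
  | tmul l y =>
    rw [Algebra.TensorProduct.tmul_mul_tmul, Algebra.TensorProduct.tmul_mul_tmul, one_mul, mul_one]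
    simp only [TensorProduct.equivFinsuppOfBasisLeft_apply_tmul_apply]
    constructor
    · rw [mul_smul_comm]
    · rw [smul_mul_assoc]

theorem tcentral {K L D : Type*} [Field K] [Field L] [Algebra K L] [DivisionRing D] [Algebra K D]
    (hcen : ∀ z : D, (∀ x, z * x = x * z) → ∃ k : K, z = algebraMap K D k)
    (z : L ⊗[K] D) (hz : ∀ x : D, (1 ⊗ₜ[K] x : L ⊗[K] D) * z = z * (1 ⊗ₜ[K] x)) : ∃ l : L, z = l ⊗ₜ[K] 1 := by
  classical
  let b := Basis.ofVectorSpace K L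
  have h : ∀ i, ∃ k : K, TensorProduct.equivFinsuppOfBasisLeft b z i = algebraMap K D k := by
    intro i
    apply hcen
    intro x
    rw [← (tcoord b x z i).1, ← (tcoord b x z i).2, hz]
  choose k hk using h
  refine ⟨∑ i ∈ (TensorProduct.equivFinsuppOfBasisLeft b z).support, k i • b i, ?_⟩
  rw [TensorProduct.sum_tmul]
  conv_lhs => rw [← (TensorProduct.equivFinsuppOfBasisLeft b).symm_apply_apply z, TensorProduct.equivFinsuppOfBasisLeft_symm_apply, Finsupp.sum]
  refine Finset.sum_congr rfl fun i _ => ?_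
  rw [hk, TensorProduct.smul_tmul, Algebra.algebraMap_eq_smul_one]

theorem tsimple {K L D : Type*} [Field K] [Field L] [Algebra K L] [DivisionRing D] [Algebra K D]
    (hcen : ∀ z : D, (∀ x, z * x = x * z) → ∃ k : K, z = algebraMap K D k) : IsSimpleRing (L ⊗[K] D) := by
  classical
  apply IsSimpleRing.of_eq_bot_or_eq_top
  intro I
  by_contra hI
  push Not at hI
  obtain ⟨hb, ht⟩ := hI
  let b := Basis.ofVectorSpace K L
  let c := TensorProduct.equivFinsuppOfBasisLeft (N := D) b
  have hex : ∃ n : ℕ, ∃ z ∈ I, z ≠ 0 ∧ (c z).support.card = n := by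
    by_contra hno
    push Not at hno
    apply hb
    ext z
    rw [TwoSidedIdeal.mem_bot]
    constructor
    · intro hz
      by_contra h0
      exact hno _ z hz h0 rfl
    · rintro rfl; exact I.zero_mem
  obtain ⟨z, hzI, hz0, hzc⟩ := Nat.find_spec hex
  have hmin : ∀ w ∈ I, (c w).support.card < (c z).support.card → w = 0 := by
    intro w hw hlt
    by_contra h0
    rw [hzc] at hlt
    exact Nat.find_min hex hlt ⟨w, hw, h0, rfl⟩
  have hcz : c z ≠ 0 := by simpa using hz0
  obtain ⟨j, hj⟩ := Finsupp.ne_iff.1 hcz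
  rw [Finsupp.zero_apply] at hj
  let z' := z * (1 ⊗ₜ[K] (c z j)⁻¹ : L ⊗[K] D)
  have hz'I : z' ∈ I := I.mul_mem_right _ _ hzI
  have hz'c : ∀ i, c z' i = c z i * (c z j)⁻¹ := fun i => (tcoord b _ z i).2
  have hcomm : ∀ x : D, (1 ⊗ₜ[K] x : L ⊗[K] D) * z' = z' * (1 ⊗ₜ[K] x) := by
    intro x
    rw [← sub_eq_zero]
    apply hmin
    · exact I.sub_mem (I.mul_mem_left _ _ hz'I) (I.mul_mem_right _ _ hz'I)
    · apply Finset.card_lt_card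
      have hv : ∀ i, c ((1 ⊗ₜ[K] x : L ⊗[K] D) * z' - z' * (1 ⊗ₜ[K] x)) i = x * (c z i * (c z j)⁻¹) - (c z i * (c z j)⁻¹) * x := by
        intro i
        rw [map_sub, Finsupp.sub_apply]
        rw [show c ((1 ⊗ₜ[K] x : L ⊗[K] D) * z') i = x * c z' i from (tcoord b x z' i).1,
          show c (z' * (1 ⊗ₜ[K] x : L ⊗[K] D)) i = c z' i * x from (tcoord b x z' i).2, hz'c]
      rw [Finset.ssubset_iff_of_subset]
      · refine ⟨j, Finsupp.mem_support_iff.2 hj, ?_⟩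
        rw [Finsupp.notMem_support_iff, hv, mul_inv_cancel₀ hj, mul_one, one_mul, sub_self]
      · intro i hi
        rw [Finsupp.mem_support_iff] at hi ⊢
        intro h0
        apply hi
        rw [hv, h0]; simp
  obtain ⟨l, hl⟩ := tcentral hcen z' hcomm
  have hl0 : l ≠ 0 := by
    rintro rfl
    rw [TensorProduct.zero_tmul] at hl
    have := hz'c j
    rw [hl, map_zero, Finsupp.zero_apply, mul_inv_cancel₀ hj] at this
    exact zero_ne_one this
  apply ht
  rw [← TwoSidedIdeal.one_mem_iff]
  have := I.mul_mem_left (l⁻¹ ⊗ₜ[K] 1) _ hz'I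
  rwa [hl, Algebra.TensorProduct.tmul_mul_tmul, inv_mul_cancel₀ hl0, one_mul, ← Algebra.TensorProduct.one_def] at this

/-- Wedderburn decomposition after base change -/
theorem wedd {K : Type*} {L : Type u} {D : Type v} [Field K] [Field L] [Algebra K L] [DivisionRing D] [Algebra K D] [FiniteDimensional K D]
    (hcen : ∀ z : D, (∀ x, z * x = x * z) → ∃ k : K, z = algebraMap K D k) :
    ∃ (r : ℕ) (_ : NeZero r) (D2 : Type (max u v)) (_ : DivisionRing D2) (_ : Algebra L D2) (_ : FiniteDimensional L D2)
      (_ : (L ⊗[K] D) ≃ₐ[L] Matrix (Fin r) (Fin r) D2),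
      (∀ z : D2, (∀ x, z * x = x * z) → ∃ k : L, z = algebraMap L D2 k) ∧ r * r * finrank L D2 = finrank K D := by
  have := tsimple (L := L) hcen
  have := IsArtinianRing.of_finite L (L ⊗[K] D)
  obtain ⟨r, hr, D2, i1, i2, i3, ⟨e⟩⟩ := IsSimpleRing.exists_algEquiv_matrix_divisionRing_finite L (L ⊗[K] D)
  refine ⟨r, hr, D2, i1, i2, i3, e, ?_, ?_⟩
  · intro z hz
    obtain ⟨l, hl⟩ := tcentral hcen (e.symm (Matrix.scalar (Fin r) z)) (by
      intro x
      apply e.injective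
      rw [map_mul, map_mul, e.apply_symm_apply]
      exact ((Matrix.scalar_commute z (fun y => hz y) _).symm))
    refine ⟨l, ?_⟩
    have h1 : (l ⊗ₜ[K] 1 : L ⊗[K] D) = algebraMap L _ l := rfl
    rw [h1, AlgEquiv.symm_apply_eq, AlgEquiv.commutes] at hl
    have := congrFun (congrFun hl 0) 0
    simpa [Matrix.algebraMap_matrix_apply] using this
  · have h1 := e.toLinearEquiv.finrank_eq
    rw [Module.finrank_matrix, finrank_baseChange] at h1
    rw [h1]; simp
end
end BQ

namespace BQ
open Module Polynomial
open scoped TensorProduct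

section
universe u v
set_option linter.unusedSectionVars false

theorem antiTransfer {K A D2 : Type*} [Field K] [Ring A] [Algebra K A] [DivisionRing D2] [Algebra K D2] [FiniteDimensional K D2]
    {r : ℕ} [NeZero r] (e : A ≃ₐ[K] Matrix (Fin r) (Fin r) D2) (α : A →ₗ[K] A) (h1 : α 1 = 1) (hm : ∀ x y, α (x * y) = α y * α x) :
    ∃ f : D2 →ₗ[K] D2, Anti f := by
  let φ : Matrix (Fin r) (Fin r) D2 →ₐ[K] Module.End D2 (Fin r → D2) :=
    AlgHom.ofLinearMap
      { toFun := fun M =>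
          { toFun := fun v => Matrix.vecMul v (e (α (e.symm M)))
            map_add' := fun v w => Matrix.add_vecMul _ _ _
            map_smul' := fun c v => by rw [RingHom.id_apply, Matrix.smul_vecMul] }
        map_add' := fun M N => by
          apply LinearMap.ext; intro v
          simp [Matrix.vecMul_add]
        map_smul' := fun k M => by
          apply LinearMap.ext; intro v
          simp [Matrix.vecMul_smul] }
      (by
        apply LinearMap.ext; intro v
        simp [h1])
      (by
        intro M N
        apply LinearMap.ext; intro v
        simp [hm])
  obtain ⟨U, ψ, hU⟩ := lemE φ
  have hU1 : finrank D2 U = 1 := by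
    rw [finrank_fin_fun] at hU
    exact Nat.eq_of_mul_eq_mul_left (Nat.pos_of_ne_zero (NeZero.ne r)) (hU.trans (mul_one r).symm)
  have : FiniteDimensional K U := Module.Finite.trans D2 U
  let ρ : D2 →ₐ[K] Module.End K U := AlgHom.ofLinearMap
      { toFun := fun x => (ψ x).restrictScalars K
        map_add' := fun x y => by rw [map_add]; rfl
        map_smul' := fun k x => by rw [map_smul]; rfl }
      (by apply LinearMap.ext; intro u; simp)
      (by intro x y; apply LinearMap.ext; intro u; simp)
  have hdim : finrank K D2 = finrank K U := by
    rw [← finrank_mul_finrank K D2 U, hU1, mul_one]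
  obtain ⟨g, hg1, hg⟩ := embedmod (Algebra.lsmul K K U : D2 →ₐ[K] Module.End K U) hdim ρ (by
    intro x l w
    exact ((ψ l).map_smul x w).symm)
  exact ⟨g, hg1, hg⟩

theorem splTransfer {L A D2 N : Type*} [Field L] [Ring A] [Algebra L A] [DivisionRing D2] [Algebra L D2] [Field N] [Algebra L N]
    {r d : ℕ} [NeZero r] (e : A ≃ₐ[L] Matrix (Fin r) (Fin r) D2) (φ : A →ₐ[L] Matrix (Fin d) (Fin d) N) :
    ∃ d2 : ℕ, r * d2 = d ∧ Nonempty (D2 →ₐ[L] Matrix (Fin d2) (Fin d2) N) := by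
  let t : Matrix (Fin d) (Fin d) N ≃ₐ[N] Module.End N (Fin d → N) := Matrix.toLinAlgEquiv'
  let φ1 : Matrix (Fin r) (Fin r) D2 →ₐ[L] Module.End N (Fin d → N) :=
    ((t.restrictScalars L).toAlgHom.comp φ).comp e.symm.toAlgHom
  obtain ⟨U, ψ, hU⟩ := lemE φ1
  rw [finrank_fin_fun] at hU
  let t2 := LinearMap.toMatrixAlgEquiv (Module.finBasis N U)
  exact ⟨finrank N U, hU, ⟨(t2.restrictScalars L).toAlgHom.comp ψ⟩⟩

theorem antiBase {K L D : Type*} [Field K] [Field L] [Algebra K L] [DivisionRing D] [Algebra K D] (f : D →ₗ[K] D) (hf : Anti f) :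
    ∃ α : (L ⊗[K] D) →ₗ[L] (L ⊗[K] D), α 1 = 1 ∧ ∀ x y, α (x * y) = α y * α x := by
  refine ⟨f.baseChange L, ?_, ?_⟩
  · rw [Algebra.TensorProduct.one_def, LinearMap.baseChange_tmul, hf.one]
  · intro x y
    induction x with
    | zero => simp
    | add x x' hx hx' => rw [add_mul, map_add, hx, hx', map_add, mul_add]
    | tmul l x =>
      induction y with
      | zero => simp
      | add y y' hy hy' => rw [mul_add, map_add, hy, hy', map_add, add_mul]
      | tmul m y =>
        simp only [Algebra.TensorProduct.tmul_mul_tmul, LinearMap.baseChange_tmul, hf.mul, mul_comm l m]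

theorem indexPart {K L D D2 : Type*} [Field K] [Field L] [Algebra K L] [FiniteDimensional K L] [DivisionRing D] [Algebra K D] [FiniteDimensional K D]
    [DivisionRing D2] [Algebra L D2] [FiniteDimensional L D2]
    {r : ℕ} [NeZero r] (e : (L ⊗[K] D) ≃ₐ[L] Matrix (Fin r) (Fin r) D2) :
    finrank K D ∣ finrank K L * (r * finrank L D2) ∧ (finrank K D = finrank K L * (r * finrank L D2) → Nonempty (L →ₐ[K] D)) := by
  let _ : Module K D2 := Module.compHom D2 (algebraMap K L)
  have : IsScalarTower K L D2 := IsScalarTower.of_algebraMap_smul (fun _ _ => rfl)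
  let W := Fin r → D2
  have hW : finrank K L * (r * finrank L D2) = finrank K W := by
    rw [← finrank_mul_finrank K L W, finrank_pi_fintype]; simp
  have : FiniteDimensional K W := Module.Finite.trans L W
  let ψ : D →ₐ[K] Module.End K W := AlgHom.ofLinearMap
      { toFun := fun x =>
          { toFun := fun v => Matrix.mulVec (e (1 ⊗ₜ[K] x)) v
            map_add' := fun v w => Matrix.mulVec_add _ _ _
            map_smul' := fun c v => by
              rw [RingHom.id_apply, ← algebraMap_smul L c v, ← algebraMap_smul L c, Matrix.mulVec_smul] }
        map_add' := fun x y => by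
          apply LinearMap.ext; intro v
          simp [TensorProduct.tmul_add, Matrix.add_mulVec]
        map_smul' := fun k x => by
          apply LinearMap.ext; intro v
          change Matrix.mulVec (e (1 ⊗ₜ[K] (k • x))) v = k • Matrix.mulVec (e (1 ⊗ₜ[K] x)) v
          rw [TensorProduct.tmul_smul, ← algebraMap_smul L k (1 ⊗ₜ[K] x : L ⊗[K] D), map_smul, Matrix.smul_mulVec, algebraMap_smul] }
      (by
        apply LinearMap.ext; intro v
        change Matrix.mulVec (e (1 ⊗ₜ[K] 1)) v = v
        rw [← Algebra.TensorProduct.one_def, map_one, Matrix.one_mulVec])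
      (by
        intro x y
        apply LinearMap.ext; intro v
        change Matrix.mulVec (e (1 ⊗ₜ[K] (x * y))) v = Matrix.mulVec (e (1 ⊗ₜ[K] x)) (Matrix.mulVec (e (1 ⊗ₜ[K] y)) v)
        rw [Matrix.mulVec_mulVec, ← map_mul, Algebra.TensorProduct.tmul_mul_tmul, one_mul])
  rw [hW]
  refine ⟨dvdmod ψ, fun h => ?_⟩
  obtain ⟨g, hg1, hg⟩ := embedmod ψ h (Algebra.lsmul K K W : L →ₐ[K] Module.End K W) (by
    intro x l w
    exact Matrix.mulVec_smul (e (1 ⊗ₜ[K] x)) l w)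
  exact ⟨AlgHom.ofLinearMap g hg1 (fun x y => by rw [mul_comm, hg])⟩

theorem red {K N : Type*} {L : Type u} {D : Type v} [Field K] [Field L] [Field N] [Algebra K L] [Algebra K N] [Algebra L N] [IsScalarTower K L N]
    [FiniteDimensional K L] [DivisionRing D] [Algebra K D] [FiniteDimensional K D]
    (hcen : ∀ z : D, (∀ x, z * x = x * z) → ∃ k : K, z = algebraMap K D k)
    (f : D →ₗ[K] D) (hf : Anti f) {d : ℕ} (hd : finrank K D = d ^ 2) (φ : D →ₐ[K] Matrix (Fin d) (Fin d) N) :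
    ∃ (r d2 : ℕ) (D2 : Type (max u v)) (_ : DivisionRing D2) (_ : Algebra L D2) (_ : FiniteDimensional L D2) (f2 : D2 →ₗ[L] D2),
      (∀ z : D2, (∀ x, z * x = x * z) → ∃ k : L, z = algebraMap L D2 k) ∧ Anti f2 ∧ finrank L D2 = d2 ^ 2 ∧
      Nonempty (D2 →ₐ[L] Matrix (Fin d2) (Fin d2) N) ∧ d = r * d2 ∧ r ∣ finrank K L ∧ (r = finrank K L → Nonempty (L →ₐ[K] D)) := by
  obtain ⟨r, hr, D2, i1, i2, i3, e, hcen2, hfr⟩ := wedd (L := L) hcen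
  obtain ⟨α, h1, hm⟩ := antiBase (L := L) f hf
  obtain ⟨f2, hf2⟩ := antiTransfer e α h1 hm
  let Φ : (L ⊗[K] D) →ₐ[L] Matrix (Fin d) (Fin d) N :=
    Algebra.TensorProduct.lift (Algebra.ofId L _) φ (fun l x => Algebra.commutes l (φ x))
  obtain ⟨d2, hd2, hspl⟩ := splTransfer e Φ
  have hr0 : 0 < r := Nat.pos_of_ne_zero (NeZero.ne r)
  have hD2 : finrank L D2 = d2 ^ 2 := by
    rw [hd, ← hd2] at hfr
    have : (r * r) * finrank L D2 = (r * r) * d2 ^ 2 := by rw [hfr]; ring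
    exact Nat.eq_of_mul_eq_mul_left (Nat.mul_pos hr0 hr0) this
  have hpos : 0 < d2 ^ 2 := by rw [← hD2]; exact finrank_pos
  obtain ⟨hi1, hi2⟩ := indexPart e
  have hk : finrank K D = (r * d2 ^ 2) * r := by rw [hd, ← hd2]; ring
  have hk2 : finrank K L * (r * finrank L D2) = (r * d2 ^ 2) * finrank K L := by rw [hD2]; ring
  rw [hk2, hk] at hi1 hi2
  refine ⟨r, d2, D2, i1, i2, i3, f2, hcen2, hf2, hD2, hspl, hd2.symm, ?_, ?_⟩
  · exact Nat.dvd_of_mul_dvd_mul_left (Nat.mul_pos hr0 hpos) hi1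
  · intro h
    exact hi2 (by rw [← h])
end
end BQ

namespace BQ
open Module Polynomial
open scoped TensorProduct

section
universe u v
set_option linter.unusedSectionVars false

theorem degdvd {K N D : Type*} [Field K] [Field N] [Algebra K N] [FiniteDimensional K N] [DivisionRing D] [Algebra K D] [FiniteDimensional K D]
    {d : ℕ} (hd : finrank K D = d ^ 2) (φ : D →ₐ[K] Matrix (Fin d) (Fin d) N) : d ∣ finrank K N := by
  let t : Matrix (Fin d) (Fin d) N ≃ₐ[N] Module.End N (Fin d → N) := Matrix.toLinAlgEquiv'
  let ρ : D →ₐ[K] Module.End K (Fin d → N) := AlgHom.ofLinearMap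
      { toFun := fun x => (t (φ x)).restrictScalars K
        map_add' := fun x y => by rw [map_add, map_add]; rfl
        map_smul' := fun k x => by
          rw [map_smul, ← algebraMap_smul N k (φ x), map_smul, RingHom.id_apply]
          apply LinearMap.ext; intro v
          change (algebraMap K N k) • (t (φ x) v) = k • (t (φ x) v)
          rw [algebraMap_smul] }
      (by apply LinearMap.ext; intro u; simp)
      (by intro x y; apply LinearMap.ext; intro u; simp)
  have h := dvdmod ρ
  have h2 : finrank K (Fin d → N) = d * finrank K N := by rw [finrank_pi_fintype]; simp
  have hpos : 0 < d ^ 2 := by rw [← hd]; exact finrank_pos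
  have hd0 : 0 < d := Nat.pos_of_ne_zero (by rintro rfl; simp at hpos)
  rw [h2, hd, pow_two] at h
  exact Nat.dvd_of_mul_dvd_mul_left hd0 h

theorem claimA (m : ℕ) : ∀ (K N : Type u) (D : Type (max u v)) [Field K] [NumberField K] [Field N] [Algebra K N] [FiniteDimensional K N] [IsGalois K N]
    [DivisionRing D] [Algebra K D] [FiniteDimensional K D]
    (_ : ∀ z : D, (∀ x, z * x = x * z) → ∃ k : K, z = algebraMap K D k)
    (f : D →ₗ[K] D) (_ : Anti f) (d : ℕ) (_ : finrank K D = d ^ 2) (_ : D →ₐ[K] Matrix (Fin d) (Fin d) N) (_ : finrank K N = m), d ≤ 2 := by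
  induction m using Nat.strong_induction_on with
  | _ m IH =>
  intro K N D _ _ _ _ _ _ _ _ _ hcen f hf d hd φ hm
  have hpos : 0 < d ^ 2 := by rw [← hd]; exact finrank_pos
  have hd0 : 0 < d := Nat.pos_of_ne_zero (by rintro rfl; simp at hpos)
  have hmpos : 0 < m := by rw [← hm]; exact finrank_pos
  have hdm : d ∣ m := hm ▸ degdvd hd φ
  have hG : Nat.card Gal(N/K) = m := by rw [IsGalois.card_aut_eq_finrank, hm]
  have hidx : ∀ H : Subgroup Gal(N/K), finrank K (IntermediateField.fixedField H) = H.index := by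
    intro H
    have h1 := finrank_mul_finrank K (IntermediateField.fixedField H) N
    rw [IntermediateField.finrank_fixedField_eq_card, hm, ← hG, ← H.card_mul_index, mul_comm] at h1
    exact Nat.eq_of_mul_eq_mul_left Nat.card_pos h1
  have step : ∀ H : Subgroup Gal(N/K), H.index ≠ 1 → ∃ r d2 : ℕ, 0 < d2 ∧ d2 ≤ 2 ∧ d = r * d2 ∧ r ∣ H.index ∧
      (r = H.index → Nonempty (IntermediateField.fixedField H →ₐ[K] D)) := by
    intro H hH
    have : NumberField (IntermediateField.fixedField H) := NumberField.of_module_finite K _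
    obtain ⟨r, d2, D2, i1, i2, i3, f2, hcen2, hf2, hd2, ⟨φ2⟩, e1, e2, e3⟩ :=
      red (L := IntermediateField.fixedField H) hcen f hf hd φ
    rw [hidx] at e2 e3
    refine ⟨r, d2, ?_, ?_, e1, e2, e3⟩
    · apply Nat.pos_of_ne_zero
      rintro rfl
      rw [mul_zero] at e1
      omega
    · refine IH (finrank (IntermediateField.fixedField H) N) ?_ _ N D2 hcen2 f2 hf2 d2 hd2 φ2 rfl
      have h1 := finrank_mul_finrank K (IntermediateField.fixedField H) N
      rw [hidx, hm] at h1
      have h2 : 0 < finrank (IntermediateField.fixedField H) N := finrank_pos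
      have h3 : H.index ≠ 0 := by rintro h; rw [h, zero_mul] at h1; omega
      have h4 : 2 ≤ H.index := by omega
      nlinarith
  by_cases hall : ∀ p : ℕ, p.Prime → ∃ H : Subgroup Gal(N/K), ¬ p ∣ H.index ∧ H.index ≠ 1
  · apply Nat.le_of_dvd (by norm_num)
    rw [Nat.dvd_iff_prime_pow_dvd_dvd]
    intro p k hp hk
    obtain ⟨H, h1, h2⟩ := hall p hp
    obtain ⟨r, d2, g0, g1, g2, g3, _⟩ := step H h2
    have hc : Nat.Coprime (p ^ k) r := by
      apply Nat.Coprime.pow_left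
      rw [hp.coprime_iff_not_dvd]
      exact fun h => h1 (h.trans g3)
    rw [g2] at hk
    have := hc.dvd_of_dvd_mul_left hk
    have h12 : d2 = 1 ∨ d2 = 2 := by omega
    rcases h12 with rfl | rfl
    · exact this.trans (by norm_num)
    · exact this
  · push Not at hall
    obtain ⟨p, hp, hall⟩ := hall
    have := Fact.mk hp
    obtain ⟨P⟩ : Nonempty (Sylow p Gal(N/K)) := inferInstance
    have hP1 := hall (P : Subgroup Gal(N/K)) P.not_dvd_index
    obtain ⟨k, hk⟩ := IsPGroup.iff_card.1 P.isPGroup'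
    have hcard := (P : Subgroup Gal(N/K)).card_mul_index
    rw [hP1, mul_one, hk] at hcard
    have hmk : m = p ^ k := by rw [← hG, ← hcard]
    rcases Nat.eq_zero_or_pos k with rfl | hk0
    · rw [hmk, pow_zero, Nat.dvd_one] at hdm
      omega
    obtain ⟨H, hH⟩ := Sylow.exists_subgroup_card_pow_prime (G := Gal(N/K)) p (n := k - 1) (by
      rw [← hcard]; exact pow_dvd_pow _ (Nat.sub_le _ _))
    have hi : H.index = p := by
      have h1 := H.card_mul_index
      rw [hH, ← hcard] at h1
      have h2 : p ^ k = p ^ (k - 1) * p := by rw [← pow_succ, Nat.sub_add_cancel hk0]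
      rw [h2] at h1
      exact Nat.eq_of_mul_eq_mul_left (pow_pos hp.pos _) h1
    have hn : H.Normal := by
      apply Subgroup.normal_of_index_eq_minFac_card
      rw [← hcard, hi, hp.pow_minFac hk0.ne']
    have hgal := IsGalois.of_fixedField_normal_subgroup H
    obtain ⟨r, d2, g0, g1, g2, g3, g4⟩ := step H (by rw [hi]; exact hp.ne_one)
    have hL : finrank K (IntermediateField.fixedField H) = p := by rw [hidx, hi]
    rw [hi] at g3 g4
    rcases (Nat.dvd_prime hp).1 g3 with rfl | rfl
    · omega
    obtain ⟨g⟩ := g4 rfl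
    have h12 : d2 = 1 ∨ d2 = 2 := by omega
    by_cases hp2 : r = 2
    · rcases h12 with rfl | rfl
      · omega
      · exact (partTwo hcen g (by rw [hL, hp2]) (by rw [hd, g2, hp2]; norm_num) f hf).elim
    · rcases h12 with rfl | rfl
      · exact (partOdd hcen g hp hp2 hL (by rw [hd, g2, mul_one]) f hf).elim
      · exfalso
        have h2 : 2 ∣ r ^ k := by rw [← hmk]; exact (Dvd.intro_left _ g2.symm).trans hdm
        have := (Nat.prime_dvd_prime_iff_eq Nat.prime_two hp).1 (Nat.prime_two.dvd_of_dvd_pow h2)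
        exact hp2 this.symm
end
end BQ

namespace BQ
open Module Polynomial
open scoped TensorProduct

section
universe u v
set_option linter.unusedSectionVars false

theorem exSplit {F D : Type*} [Field F] [CharZero F] [DivisionRing D] [Algebra F D] [FiniteDimensional F D]
    (hcen : ∀ z : D, (∀ x, z * x = x * z) → ∃ k : F, z = algebraMap F D k) {n : ℕ} (hn : finrank F D = n ^ 2) :
    ∃ N : IntermediateField F (AlgebraicClosure F), FiniteDimensional F N ∧ IsGalois F N ∧ Nonempty (D →ₐ[F] Matrix (Fin n) (Fin n) N) := by
  classical
  let Ω := AlgebraicClosure F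
  have := tsimple (L := Ω) hcen
  obtain ⟨m, _, ⟨e⟩⟩ := IsSimpleRing.exists_algEquiv_matrix_of_isAlgClosed Ω (Ω ⊗[F] D)
  have hmn : m = n := by
    have h1 := e.toLinearEquiv.finrank_eq
    rw [Module.finrank_matrix, finrank_baseChange, hn] at h1
    simp at h1
    nlinarith [Nat.mul_self_inj.1 ((pow_two n).symm.trans h1).symm]
  subst hmn
  let φ : D →ₐ[F] Matrix (Fin m) (Fin m) Ω := (e.restrictScalars F).toAlgHom.comp Algebra.TensorProduct.includeRight
  let b := Module.finBasis F D
  let S : Set Ω := Set.range (fun t : Fin (finrank F D) × Fin m × Fin m => φ (b t.1) t.2.1 t.2.2)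
  let E := IntermediateField.adjoin F S
  have hfin : FiniteDimensional F E := by
    have : Finite S := Set.finite_range _
    exact IntermediateField.finiteDimensional_adjoin (fun x _ => Algebra.IsIntegral.isIntegral x)
  let N := IntermediateField.normalClosure F E Ω
  have hN : FiniteDimensional F N := normalClosure.is_finiteDimensional F E Ω
  have hEN : E ≤ N := E.le_normalClosure
  have hnor : Normal F N := normalClosure.normal F E Ω
  have hmem : ∀ x, φ x ∈ (N.val.mapMatrix (m := Fin m)).range := by
    intro x
    rw [← b.sum_repr x, map_sum]
    refine sum_mem fun i _ => ?_
    rw [map_smul]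
    refine Subalgebra.smul_mem _ ?_ _
    refine ⟨Matrix.of fun p q => ⟨φ (b i) p q, hEN (IntermediateField.subset_adjoin F S ⟨(i, p, q), rfl⟩)⟩, ?_⟩
    ext p q
    rfl
  have hinj : Function.Injective (N.val.mapMatrix (m := Fin m)) := by
    intro A B h
    ext p q
    exact congrFun (congrFun h p) q
  refine ⟨N, hN, ⟨⟩, ⟨(AlgEquiv.ofInjective _ hinj).symm.toAlgHom.comp (φ.codRestrict _ hmem)⟩⟩

theorem final {F : Type u} {D : Type v} [Field F] [NumberField F] [DivisionRing D] [Algebra F D] [FiniteDimensional F D]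
    (hcen : ∀ z : D, (∀ x, z * x = x * z) → ∃ k : F, z = algebraMap F D k) {n : ℕ} (hn : finrank F D = n ^ 2)
    (f : D →ₗ[F] D) (hf : Anti f) : n ≤ 2 := by
  obtain ⟨N, h1, h2, ⟨φ⟩⟩ := exSplit hcen hn
  let ε : ULift.{u} D ≃ₐ[F] D := ULift.algEquiv
  have : FiniteDimensional F (ULift.{u} D) := Module.Finite.equiv ε.symm.toLinearEquiv
  refine claimA.{u, v} (finrank F N) F N (ULift.{u} D) ?_ (ε.symm.toLinearMap ∘ₗ f ∘ₗ ε.toLinearMap) ?_ n ?_ (φ.comp ε.toAlgHom) rfl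
  · intro z hz
    obtain ⟨k, hk⟩ := hcen (ε z) (fun x => by
      have := congrArg ε (hz (ε.symm x))
      simpa using this)
    exact ⟨k, ε.injective (by rw [hk, AlgEquiv.commutes])⟩
  · refine ⟨?_, fun x y => ?_⟩
    · simp [hf.one]
    · simp [hf.mul]
  · rw [ε.toLinearEquiv.finrank_eq, hn]
end
end BQ

/-- Let `F` be a number field and `D` a central division `F`-algebra of
degree `n > 2` (so `dim_F D = n²`).  Then `D` admits no `F`-linear anti-automorphism;
in particular, `D` has no involution of the first kind. -/
theorem stmt18 {F D : Type*} [Field F] [NumberField F] [DivisionRing D]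
    [Algebra F D] [FiniteDimensional F D]
    (hcentral : Subalgebra.center F D = ⊥)
    (n : ℕ) (hn : 2 < n) (hdeg : Module.finrank F D = n ^ 2) :
    ¬ ∃ f : D → D, Function.Bijective f ∧
        (∀ x y : D, f (x + y) = f x + f y) ∧
        (∀ x y : D, f (x * y) = f y * f x) ∧
        (∀ (c : F) (x : D), f (c • x) = c • f x) := by
  rintro ⟨f, hb, ha, hm, hs⟩
  have h0 : f 0 = 0 := by
    have := hs 0 0
    simpa using this
  have h1 : f 1 = 1 := by
    have h := hm 1 1
    rw [mul_one] at h
    have hne : f 1 ≠ 0 := fun h' => one_ne_zero (hb.1 (h'.trans h0.symm))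
    exact (mul_left_cancel₀ hne (by rw [mul_one, ← h])).symm
  have hcen : ∀ z : D, (∀ x, z * x = x * z) → ∃ k : F, z = algebraMap F D k := by
    intro z hz
    have : z ∈ Subalgebra.center F D := Subalgebra.mem_center_iff.2 (fun x => (hz x).symm)
    rw [hcentral] at this
    obtain ⟨k, hk⟩ := Algebra.mem_bot.1 this
    exact ⟨k, hk.symm⟩
  have := BQ.final hcen hdeg { toFun := f, map_add' := ha, map_smul' := hs } ⟨h1, hm⟩
  omega
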